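/- For all integers s, t with 2 ≤ s ≤ t there exists k₀ = k₀(s,t) such that for every integer k ≥ k₀ the following holds: every finite graph G with average degree d(G) ≥ k^{4000t} satisfies at least one of: (i) G contains a clique on k vertices; (ii) G contains an induced proper balanced subdivision of K_h for some integer h ≥ d(G)^{1/(10⁹ s)}; (iii) G contains an induced subgraph isomorphic to the complete bipartite graph K_{s,t}. -/

import Mathlib

open Finset

/-- The average degree `2|E|/|V|` of a finite simple graph. -/
noncomputable def avgDeg {V : Type*} [Fintype V] (G : SimpleGraph V) : ℝ :=
  2 * G.edgeSet.ncard / Fintype.card V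

/-- The degree of a vertex. -/
noncomputable def deg {V : Type*} (G : SimpleGraph V) (v : V) : ℕ :=
  (G.neighborSet v).ncard

/-- `G` contains `K_{s,s}` as a (not necessarily induced) subgraph. -/
def HasKssSubgraph {V : Type*} (G : SimpleGraph V) (s : ℕ) : Prop :=
  ∃ f : completeBipartiteGraph (Fin s) (Fin s) →g G, Function.Injective f

/-- `G` contains no cycle of length 4, even as a non-induced subgraph. -/
def C4Free {V : Type*} (G : SimpleGraph V) : Prop :=
  ¬ ∃ a b c d : V, a ≠ b ∧ a ≠ c ∧ a ≠ d ∧ b ≠ c ∧ b ≠ d ∧ c ≠ d ∧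
      G.Adj a b ∧ G.Adj b c ∧ G.Adj c d ∧ G.Adj d a

/-- The balanced subdivision of `K_h` in which every edge of `K_h` is replaced by a
path with exactly `ℓ` edges (intended for `ℓ ≥ 2`): branch vertices are `Fin h`,
and each pair `a < b` gets a path of `ℓ - 1` new internal vertices. -/
def balancedSubdivision (h ℓ : ℕ) :
    SimpleGraph (Fin h ⊕ ({p : Fin h × Fin h // p.1 < p.2} × Fin (ℓ - 1))) :=
  SimpleGraph.fromRel (fun x y =>
    match x, y with
    | Sum.inl u, Sum.inr ⟨⟨⟨a, b⟩, _⟩, i⟩ => (u = a ∧ (i : ℕ) = 0) ∨ (u = b ∧ (i : ℕ) = ℓ - 2)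
    | Sum.inr ⟨e, i⟩, Sum.inr ⟨e', j⟩ => e = e' ∧ (j : ℕ) = (i : ℕ) + 1
    | _, _ => False)

/-- `G` contains an induced proper balanced subdivision of `K_h`. -/
def HasInducedBalancedSubdivision {V : Type*} (G : SimpleGraph V) (h : ℕ) : Prop :=
  ∃ ℓ : ℕ, 2 ≤ ℓ ∧ Nonempty (balancedSubdivision h ℓ ↪g G)

/-- The number of edges of `G` with one endpoint in `A` and the other in `B`
(for disjoint `A`, `B`). -/
noncomputable def crossEdges {V : Type*} (G : SimpleGraph V) (A B : Set V) : ℕ :=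
  Set.ncard {p : V × V | p.1 ∈ A ∧ p.2 ∈ B ∧ G.Adj p.1 p.2}

/-- `G` is `d`-degenerate: every (induced) subgraph has a vertex of degree at most `d`. -/
def Degenerate {V : Type*} (G : SimpleGraph V) (d : ℕ) : Prop :=
  ∀ s : Finset V, s.Nonempty → ∃ v ∈ s, ((s : Set V) ∩ G.neighborSet v).ncard ≤ d

/-- The 1-subdivision of the multihypergraph with hyperedges `edges e`, `e : E`,
on vertex set `V`. -/
def oneSubdivision {E V : Type*} (edges : E → Finset V) : SimpleGraph (E ⊕ V) :=
  SimpleGraph.fromRel (fun x y =>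
    match x, y with
    | Sum.inl a, Sum.inr b => b ∈ edges a
    | _, _ => False)

/-- The 1-subdivision of a simple graph `G`. -/
def graphOneSubdivision {W : Type*} (G : SimpleGraph W) : SimpleGraph (G.edgeSet ⊕ W) :=
  SimpleGraph.fromRel (fun x y =>
    match x, y with
    | Sum.inl e, Sum.inr w => w ∈ (e : Sym2 W)
    | _, _ => False)

/-- `I` is an independent set of `G`. -/
def IndepSet {V : Type*} (G : SimpleGraph V) (I : Set V) : Prop :=
  I.Pairwise fun u v => ¬ G.Adj u v

/-- `G` has a clique on `k` vertices. -/
def HasClique {V : Type*} (G : SimpleGraph V) (k : ℕ) : Prop :=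
  ∃ t : Finset V, G.IsNClique k t

namespace Bal
section
open scoped Classical

/-- `f` traces a walk of length `ℓ` in `G`. -/
def IsW {V : Type*} (G : SimpleGraph V) (f : ℕ → V) (ℓ : ℕ) : Prop :=
  ∀ i < ℓ, G.Adj (f i) (f (i + 1))

/-- `u` and `v` are joined by a path of length `ℓ` with interior in `I`. -/
def Lk {V : Type*} (G : SimpleGraph V) (I : Set V) (ℓ : ℕ) (u v : V) : Prop :=
  ∃ f : ℕ → V, f 0 = u ∧ f ℓ = v ∧ IsW G f ℓ ∧ Set.InjOn f (Set.Iic ℓ) ∧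
    ∀ i, 0 < i → i < ℓ → f i ∈ I

variable {V : Type*} {G : SimpleGraph V}

lemma IsW.glue {f g : ℕ → V} {a b : ℕ} (hf : IsW G f a) (hg : IsW G g b) (h : f a = g 0) :
    IsW G (fun i => if i ≤ a then f i else g (i - a)) (a + b) := by
  intro i hi
  by_cases h1 : i + 1 ≤ a
  · have h2 : i ≤ a := by omega
    simpa [h1, h2] using hf i (by omega)
  · by_cases h2 : i ≤ a
    · have h3 : i = a := by omega
      subst h3
      have := hg 0 (by omega)
      simpa [h] using this
    · have := hg (i - a) (by omega)
      simp only [h1, h2, if_false]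
      rwa [show i + 1 - a = i - a + 1 by omega]

lemma IsW.reverse {f : ℕ → V} {a : ℕ} (hf : IsW G f a) : IsW G (fun i => f (a - i)) a := by
  intro i hi
  have := hf (a - (i + 1)) (by omega)
  rw [show a - (i + 1) + 1 = a - i by omega] at this
  exact this.symm

lemma IsW.mono {f : ℕ → V} {a b : ℕ} (hf : IsW G f a) (h : b ≤ a) : IsW G f b :=
  fun i hi => hf i (by omega)

lemma Lk.mono {I I' : Set V} {ℓ : ℕ} {u v : V} (h : Lk G I ℓ u v) (hI : I ⊆ I') :
    Lk G I' ℓ u v := by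
  obtain ⟨f, h0, h1, h2, h3, h4⟩ := h
  exact ⟨f, h0, h1, h2, h3, fun i hi hi' => hI (h4 i hi hi')⟩

lemma Lk.symm {I : Set V} {ℓ : ℕ} {u v : V} (h : Lk G I ℓ u v) : Lk G I ℓ v u := by
  obtain ⟨f, h0, h1, h2, h3, h4⟩ := h
  refine ⟨fun i => f (ℓ - i), by simpa, by simpa, h2.reverse, ?_, ?_⟩
  · intro i hi j hj hij
    have := h3 (show ℓ - i ∈ Set.Iic ℓ by simp) (show ℓ - j ∈ Set.Iic ℓ by simp) hij
    simp at hi hj; omega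
  · intro i hi hi'
    exact h4 _ (by omega) (by omega)

lemma Lk.of_adj {u v : V} (I : Set V) (h : G.Adj u v) : Lk G I 1 u v := by
  refine ⟨fun i => if i = 0 then u else v, by simp, by simp, ?_, ?_, ?_⟩
  · intro i hi
    obtain rfl : i = 0 := by omega
    simpa
  · intro i hi j hj hij
    have := h.ne
    simp at hi hj
    interval_cases i <;> interval_cases j <;> simp_all
  · intro i hi hi'; omega

lemma Lk.trans {I I' : Set V} {ℓ ℓ' : ℕ} {u v w : V} (h : Lk G I ℓ u v) (h' : Lk G I' ℓ' v w)
    (hd : Disjoint I I') (hu : u ∉ I') (hw : w ∉ I) (huw : u ≠ w) :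
    Lk G (I ∪ I' ∪ {v}) (ℓ + ℓ') u w := by
  obtain ⟨f, f0, f1, f2, f3, f4⟩ := h
  obtain ⟨g, g0, g1, g2, g3, g4⟩ := h'
  refine ⟨fun i => if i ≤ ℓ then f i else g (i - ℓ), by simpa, ?_, f2.glue g2 (by rw [f1, g0]),
    ?_, ?_⟩
  · by_cases h : ℓ' = 0
    · subst h; simp [f1, ← g1, g0]
    · simp [h, g1]
  · have key : ∀ i j, i ≤ ℓ → ℓ < j → j ≤ ℓ + ℓ' → f i ≠ g (j - ℓ) := by
      intro i j hi hj hj' heq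
      by_cases hjl : j = ℓ + ℓ'
      · have : g (j - ℓ) = w := by rw [← g1]; congr 1; omega
        rw [this] at heq
        rcases Nat.eq_zero_or_pos i with rfl | hi0
        · exact huw (by rw [← f0, heq])
        · rcases hi.eq_or_lt with rfl | hil
          · have := g3 (show 0 ∈ Set.Iic ℓ' by simp) (show ℓ' ∈ Set.Iic ℓ' by simp)
              (by rw [g0, g1, ← f1, heq])
            omega
          · exact hw (heq ▸ f4 i hi0 hil)
      · have hg : g (j - ℓ) ∈ I' := g4 _ (by omega) (by omega)
        rcases Nat.eq_zero_or_pos i with rfl | hi0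
        · exact hu (by rw [← f0, heq]; exact hg)
        · rcases hi.eq_or_lt with rfl | hil
          · have := g3 (show 0 ∈ Set.Iic ℓ' by simp) (show j - i ∈ Set.Iic ℓ' by simp; omega)
              (by rw [g0, ← f1, heq])
            omega
          · exact Set.disjoint_left.1 hd (f4 i hi0 hil) (heq ▸ hg)
    intro i hi j hj hij
    simp only [Set.mem_Iic] at hi hj
    by_cases h1 : i ≤ ℓ <;> by_cases h2 : j ≤ ℓ <;> simp only [h1, h2, if_true, if_false] at hij
    · exact f3 h1 h2 hij
    · exact absurd hij (key i j h1 (by omega) hj)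
    · exact absurd hij.symm (key j i h2 (by omega) hi)
    · have := g3 (show i - ℓ ∈ Set.Iic ℓ' by simp; omega) (show j - ℓ ∈ Set.Iic ℓ' by simp; omega) hij
      omega
  · intro i hi hi'
    by_cases h1 : i ≤ ℓ
    · simp only [h1, if_true]
      rcases h1.eq_or_lt with rfl | h1
      · right; simpa using f1
      · left; left; exact f4 i hi h1
    · simp only [h1, if_false]
      left; right; exact g4 _ (by omega) (by omega)

/-- A walk between distinct vertices contains a path that is no longer. -/
lemma Lk.of_walk {f : ℕ → V} {ℓ : ℕ} (hf : IsW G f ℓ) (hne : f 0 ≠ f ℓ) :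
    ∃ ℓ' ≤ ℓ, 1 ≤ ℓ' ∧ Lk G {x | (∃ i ≤ ℓ, f i = x) ∧ x ≠ f 0 ∧ x ≠ f ℓ} ℓ' (f 0) (f ℓ) := by
  have hex : ∃ m, ∃ g : ℕ → V, g 0 = f 0 ∧ g m = f ℓ ∧ IsW G g m ∧ ∀ i ≤ m, ∃ j ≤ ℓ, f j = g i :=
    ⟨ℓ, f, rfl, rfl, hf, fun i hi => ⟨i, hi, rfl⟩⟩
  have hle : Nat.find hex ≤ ℓ := Nat.find_le ⟨f, rfl, rfl, hf, fun i hi => ⟨i, hi, rfl⟩⟩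
  obtain ⟨g, g0, g1, g2, g3⟩ := Nat.find_spec hex
  have hmin := fun m (hm : m < Nat.find hex) => Nat.find_min hex hm
  revert hle g1 g2 g3 hmin
  generalize Nat.find hex = m
  intro hle g1 g2 g3 hmin
  have hinj : Set.InjOn g (Set.Iic m) := by
    have key : ∀ a b, a < b → b ≤ m → g a ≠ g b := by
      intro a b hab hb heq
      refine hmin (m - (b - a)) (by omega) ⟨fun i => if i ≤ a then g i else g (i - a + b), by simpa,
        ?_, ?_, ?_⟩
      · beta_reduce
        by_cases h : m = b
        · subst h
          rw [if_pos (by omega), show m - (m - a) = a by omega, heq, g1]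
        · rw [if_neg (by omega), show m - (b - a) - a + b = m by omega, g1]
      · have := (g2.mono (show a ≤ m by omega)).glue (g := fun i => g (i + b)) (b := m - b)
          (fun i hi => by
            have := g2 (i + b) (by omega)
            rwa [show i + b + 1 = i + 1 + b by omega] at this) (by simpa using heq)
        rwa [show a + (m - b) = m - (b - a) by omega] at this
      · intro i hi
        by_cases h : i ≤ a
        · simp only [h, if_true]; exact g3 i (by omega)
        · simp only [h, if_false]; exact g3 _ (by omega)
    intro i hi j hj hij
    simp only [Set.mem_Iic] at hi hj
    rcases lt_trichotomy i j with h | h | h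
    · exact absurd hij (key i j h hj)
    · exact h
    · exact absurd hij.symm (key j i h hi)
  refine ⟨m, hle, ?_, g, g0, g1, g2, hinj, ?_⟩
  · rcases Nat.eq_zero_or_pos m with rfl | h
    · exact absurd (g0.symm.trans g1) hne
    · exact h
  · intro i hi hi'
    refine ⟨g3 i (by omega), ?_, ?_⟩
    · rw [← g0]; intro h
      have := hinj (by simp; omega) (by simp) h; omega
    · rw [← g1]; intro h
      have := hinj (by simp; omega) (by simp) h; omega

/-- `G` contains a subdivision of `F` in which each edge becomes a path of length `ℓ`. -/
def Sub {V W : Type*} (G : SimpleGraph V) (F : SimpleGraph W) (ℓ : ℕ) : Prop :=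
  ∃ φ : W → V, Function.Injective φ ∧ ∃ I : Sym2 W → Set V,
    (∀ e ∈ F.edgeSet, ∀ e' ∈ F.edgeSet, e ≠ e' → Disjoint (I e) (I e')) ∧
    (∀ e ∈ F.edgeSet, ∀ w, φ w ∉ I e) ∧
    ∀ a b, F.Adj a b → Lk G (I s(a, b)) ℓ (φ a) (φ b)

/-- `G` contains a balanced subdivision of the complete graph on `h` vertices. -/
def BS {V : Type*} (G : SimpleGraph V) (h : ℕ) : Prop :=
  ∃ ℓ, 1 ≤ ℓ ∧ Sub G (⊤ : SimpleGraph (Fin h)) ℓ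

lemma Lk.map {W : Type*} {F : SimpleGraph W} {φ : W → V} (hφ : Function.Injective φ)
    (h : ∀ a b, F.Adj a b → G.Adj (φ a) (φ b)) {I : Set W} {ℓ : ℕ} {u v : W}
    (hl : Lk F I ℓ u v) : Lk G (φ '' I) ℓ (φ u) (φ v) := by
  obtain ⟨f, f0, f1, f2, f3, f4⟩ := hl
  exact ⟨φ ∘ f, by simp [f0], by simp [f1], fun i hi => h _ _ (f2 i hi),
    hφ.comp_injOn f3, fun i hi hi' => ⟨_, f4 i hi hi', rfl⟩⟩

lemma BS.map {W : Type*} {F : SimpleGraph W} {φ : W → V} (hφ : Function.Injective φ)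
    (h : ∀ a b, F.Adj a b → G.Adj (φ a) (φ b)) {m : ℕ} (hb : BS F m) : BS G m := by
  obtain ⟨ℓ, hℓ, θ, hθ, I, h1, h2, h3⟩ := hb
  refine ⟨ℓ, hℓ, φ ∘ θ, hφ.comp hθ, fun e => φ '' I e, ?_, ?_, ?_⟩
  · intro e he e' he' hne
    exact (Set.disjoint_image_iff hφ).2 (h1 e he e' he' hne)
  · rintro e he w ⟨x, hx, hx'⟩
    exact h2 e he w (hφ hx' ▸ hx)
  · intro a b hab
    exact (h3 a b hab).map hφ h

lemma BS.induce {U : Set V} {m : ℕ} (hb : BS (G.induce U) m) : BS G m :=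
  hb.map Subtype.val_injective (fun _ _ h => h)

lemma Sub.comp {W X : Type*} {F : SimpleGraph W} {K : SimpleGraph X} {ℓ ℓ' : ℕ}
    (h : Sub G F ℓ) (h' : Sub F K ℓ') : Sub G K (ℓ' * ℓ) := by
  obtain ⟨φ, hφ, I, h1, h2, h3⟩ := h
  obtain ⟨θ, hθ, J, j1, j2, j3⟩ := h'
  let R : Sym2 X → Set W := fun e => J e ∪ {w | ∃ x ∈ e, θ x = w}
  let T : Sym2 X → Set (Sym2 W) := fun e =>
    {q | q ∈ F.edgeSet ∧ (∀ w ∈ q, w ∈ R e) ∧ ((∃ w ∈ q, w ∈ J e) ∨ q = e.map θ)}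
  have hT : ∀ e ∈ K.edgeSet, ∀ e' ∈ K.edgeSet, e ≠ e' → ∀ q ∈ T e, q ∉ T e' := by
    rintro e he e' he' hne q ⟨hq, hq1, hq2⟩ ⟨-, hq3, hq4⟩
    have aux : ∀ a ∈ K.edgeSet, ∀ b ∈ K.edgeSet, a ≠ b → (∀ w ∈ q, w ∈ R b) →
        ¬ ∃ w ∈ q, w ∈ J a := by
      rintro a ha b hb hab hR ⟨w, hw, hwJ⟩
      rcases hR w hw with h | ⟨x, -, rfl⟩
      · exact Set.disjoint_left.1 (j1 a ha b hb hab) hwJ h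
      · exact j2 a ha x hwJ
    have e1 := hq2.resolve_left (aux e he e' he' hne hq3)
    have e2 := hq4.resolve_left (aux e' he' e he hne.symm hq1)
    exact hne (Sym2.map.injective hθ (e1.symm.trans e2))
  refine ⟨φ ∘ θ, hφ.comp hθ, fun e => φ '' J e ∪ ⋃ q ∈ T e, I q, ?_, ?_, ?_⟩
  · intro e he e' he' hne
    rw [Set.disjoint_left]
    rintro v (⟨w, hw, rfl⟩ | hv) (⟨w', hw', hww⟩ | hv')
    · obtain rfl := hφ hww
      exact Set.disjoint_left.1 (j1 e he e' he' hne) hw hw'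
    · simp only [Set.mem_iUnion] at hv'
      obtain ⟨q, hq, hv'⟩ := hv'
      exact h2 q hq.1 w hv'
    · simp only [Set.mem_iUnion] at hv
      obtain ⟨q, hq, hv⟩ := hv
      exact h2 q hq.1 w' (hww ▸ hv)
    · simp only [Set.mem_iUnion] at hv hv'
      obtain ⟨q, hq, hv⟩ := hv
      obtain ⟨q', hq', hv'⟩ := hv'
      by_cases hqq : q = q'
      · subst hqq; exact hT e he e' he' hne q hq hq'
      · exact Set.disjoint_left.1 (h1 q hq.1 q' hq'.1 hqq) hv hv'
  · rintro e he x (⟨w, hw, hwx⟩ | hv)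
    · exact j2 e he x (hφ hwx ▸ hw)
    · simp only [Set.mem_iUnion] at hv
      obtain ⟨q, hq, hv⟩ := hv
      exact h2 q hq.1 _ hv
  · intro a b hab
    obtain ⟨f, f0, f1, f2, f3, f4⟩ := j3 a b hab
    have hℓ' : 1 ≤ ℓ' := by
      rcases Nat.eq_zero_or_pos ℓ' with rfl | h
      · exact absurd (hθ (f0.symm.trans f1)) hab.ne
      · exact h
    have main : ∀ m, 1 ≤ m → m ≤ ℓ' → Lk G ((φ '' {w | ∃ i, 0 < i ∧ i < m ∧ f i = w}) ∪
        ⋃ i ∈ Set.Iio m, I s(f i, f (i + 1))) (m * ℓ) (φ (f 0)) (φ (f m)) := by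
      intro m hm
      induction m, hm using Nat.le_induction with
      | base =>
        intro _
        rw [one_mul]
        refine (h3 _ _ (f2 0 (by omega))).mono ?_
        refine Set.subset_union_of_subset_right ?_ _
        exact Set.subset_biUnion_of_mem (u := fun i => I s(f i, f (i + 1))) (by simp)
      | succ m hm ih =>
        intro hm'
        rw [add_mul, one_mul]
        refine ((ih (by omega)).trans (h3 _ _ (f2 m (by omega))) ?_ ?_ ?_ ?_).mono ?_
        · rw [Set.disjoint_left]
          rintro v (⟨w, -, rfl⟩ | hv) hv'
          · exact h2 _ (f2 m (by omega)) _ hv'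
          · simp only [Set.mem_iUnion] at hv
            obtain ⟨i, hi, hv⟩ := hv
            simp only [Set.mem_Iio] at hi
            refine Set.disjoint_left.1 (h1 _ (f2 i (by omega)) _ (f2 m (by omega)) ?_) hv hv'
            intro heq
            rcases Sym2.eq_iff.1 heq with ⟨e1, e2⟩ | ⟨e1, e2⟩
            · have := f3 (by simp; omega) (by simp; omega) e1; omega
            · have := f3 (by simp; omega) (by simp; omega) e1; omega
        · exact h2 _ (f2 m (by omega)) _
        · rintro (⟨w, ⟨i, hi, hi', rfl⟩, hw⟩ | hv)
          · have := f3 (by simp; omega) (by simp; omega) (hφ hw); omega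
          · simp only [Set.mem_iUnion] at hv
            obtain ⟨i, hi, hv⟩ := hv
            simp only [Set.mem_Iio] at hi
            exact h2 _ (f2 i (by omega)) _ hv
        · intro heq
          have := f3 (by simp) (by simp; omega) (hφ heq); omega
        · rintro v ((( ⟨w, ⟨i, hi, hi', rfl⟩, rfl⟩ | hv) | hv) | hv)
          · exact Or.inl ⟨_, ⟨i, hi, by omega, rfl⟩, rfl⟩
          · right
            simp only [Set.mem_iUnion] at hv ⊢
            obtain ⟨i, hi, hv⟩ := hv
            exact ⟨i, by simp at hi ⊢; omega, hv⟩
          · right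
            simp only [Set.mem_iUnion]
            exact ⟨m, by simp, hv⟩
          · left
            exact ⟨_, ⟨m, by omega, by omega, rfl⟩, hv.symm⟩
    have hmain := main ℓ' hℓ' le_rfl
    rw [f0, f1] at hmain
    refine hmain.mono ?_
    have hR : ∀ i ≤ ℓ', f i ∈ R s(a, b) := by
      intro i hi
      rcases Nat.eq_zero_or_pos i with rfl | h0
      · right; exact ⟨a, by simp, f0.symm⟩
      · rcases hi.eq_or_lt with rfl | h
        · right; exact ⟨b, by simp, f1.symm⟩
        · left; exact f4 i h0 h
    rintro v (⟨w, ⟨i, hi, hi', rfl⟩, rfl⟩ | hv)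
    · exact Or.inl ⟨_, f4 i hi hi', rfl⟩
    · right
      simp only [Set.mem_iUnion] at hv ⊢
      obtain ⟨i, hi, hv⟩ := hv
      simp only [Set.mem_Iio] at hi
      refine ⟨s(f i, f (i + 1)), ⟨f2 i hi, ?_, ?_⟩, hv⟩
      · intro w hw
        rcases Sym2.mem_iff.1 hw with rfl | rfl
        · exact hR _ (by omega)
        · exact hR _ (by omega)
      · rcases Nat.eq_zero_or_pos i with rfl | h0
        · rcases hℓ'.eq_or_lt with rfl | h
          · right; simp [f0, f1]
          · left; exact ⟨f 1, by simp, f4 1 (by omega) h⟩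
        · left; exact ⟨f i, by simp, f4 i h0 hi⟩

lemma BS.comp {W : Type*} {F : SimpleGraph W} {ℓ m : ℕ} (hℓ : 1 ≤ ℓ)
    (h : Sub G F ℓ) (h' : BS F m) : BS G m := by
  obtain ⟨ℓ', hℓ', hsub⟩ := h'
  exact ⟨ℓ' * ℓ, Nat.mul_pos hℓ' hℓ, h.comp hsub⟩

/-- `G` contains the `1`-subdivision of `H` as an induced subgraph. -/
def IndSub {V W : Type*} (G : SimpleGraph V) (H : SimpleGraph W) : Prop :=
  ∃ φ : W → V, ∃ ψ : Sym2 W → V, Function.Injective φ ∧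
    (∀ a b, ¬ G.Adj (φ a) (φ b)) ∧
    (∀ e ∈ H.edgeSet, ∀ e' ∈ H.edgeSet, ¬ G.Adj (ψ e) (ψ e')) ∧
    ∀ e ∈ H.edgeSet, ∀ w, G.Adj (ψ e) (φ w) ↔ w ∈ e

end
section
open scoped Classical
variable {V : Type*} {G : SimpleGraph V}

/-- The `j`-th vertex of the `1`-subdivision of the path traced by `f`. -/
def subPos {W : Type*} (f : ℕ → W) (j : ℕ) : W ⊕ Sym2 W :=
  if j % 2 = 0 then Sum.inl (f (j / 2)) else Sum.inr s(f (j / 2), f (j / 2 + 1))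

/-- Adjacency in the `1`-subdivision. -/
def subAdj {W : Type*} : W ⊕ Sym2 W → W ⊕ Sym2 W → Prop
  | Sum.inl w, Sum.inr e => w ∈ e
  | Sum.inr e, Sum.inl w => w ∈ e
  | _, _ => False

lemma subPos_adj_iff {W : Type*} {f : ℕ → W} {ℓ : ℕ} (hf : Set.InjOn f (Set.Iic ℓ)) {i j : ℕ}
    (hi : i ≤ 2 * ℓ) (hj : j ≤ 2 * ℓ) : subAdj (subPos f i) (subPos f j) ↔ j = i + 1 ∨ i = j + 1 := by
  have key : ∀ a b, a ≤ ℓ → b < ℓ → (f a ∈ s(f b, f (b + 1)) ↔ a = b ∨ a = b + 1) := by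
    intro a b ha hb
    rw [Sym2.mem_iff, hf.eq_iff (by simpa) (by simp; omega), hf.eq_iff (by simpa) (by simp; omega)]
  unfold subPos
  by_cases h1 : i % 2 = 0 <;> by_cases h2 : j % 2 = 0 <;>
    simp only [h1, h2, if_true, if_false, subAdj]
  · simp; omega
  · rw [key _ _ (by omega) (by omega)]; omega
  · rw [key _ _ (by omega) (by omega)]; omega
  · simp; omega

lemma subPos_inj {W : Type*} {f : ℕ → W} {ℓ : ℕ} (hf : Set.InjOn f (Set.Iic ℓ)) {i j : ℕ}
    (hi : i ≤ 2 * ℓ) (hj : j ≤ 2 * ℓ) (h : subPos f i = subPos f j) : i = j := by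
  unfold subPos at h
  by_cases h1 : i % 2 = 0 <;> by_cases h2 : j % 2 = 0 <;>
    simp only [h1, h2, if_true, if_false, Sum.inl.injEq, Sum.inr.injEq, reduceCtorEq] at h
  · have := hf (by simp; omega) (by simp; omega) h
    omega
  · rcases Sym2.eq_iff.1 h with ⟨e1, e2⟩ | ⟨e1, e2⟩
    · have := hf (by simp; omega) (by simp; omega) e1
      omega
    · have := hf (by simp; omega) (by simp; omega) e1
      have := hf (by simp; omega) (by simp; omega) e2
      omega

theorem IndSub.hasInduced {W : Type*} {H : SimpleGraph W} {m : ℕ} (hi : IndSub G H)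
    (hb : BS H m) : HasInducedBalancedSubdivision G m := by
  obtain ⟨φ, ψ, hφ, h1, h2, h3⟩ := hi
  obtain ⟨ℓ, hℓ, θ, hθ, I, i1, i2, i3⟩ := hb
  choose f f0 f1 f2 f3 f4 using fun p : {p : Fin m × Fin m // p.1 < p.2} =>
    i3 p.1.1 p.1.2 (by simpa using p.2.ne)
  let good : W ⊕ Sym2 W → Prop := fun x => match x with
    | Sum.inl _ => True
    | Sum.inr e => e ∈ H.edgeSet
  let Φ : W ⊕ Sym2 W → V := Sum.elim φ ψ
  have hΦadj : ∀ x y, good x → good y → (G.Adj (Φ x) (Φ y) ↔ subAdj x y) := by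
    rintro (x | x) (y | y) hx hy
    · simpa [Φ, subAdj] using h1 x y
    · simpa [Φ, subAdj, G.adj_comm] using h3 y hy x
    · simpa [Φ, subAdj] using h3 x hx y
    · simpa [Φ, subAdj] using h2 x hx y hy
  have hne : ∀ w, ∀ e ∈ H.edgeSet, φ w ≠ ψ e := by
    intro w e he heq
    induction e with | _ a b =>
    exact h1 w a (heq ▸ (h3 _ he a).2 (by simp))
  have hΦinj : ∀ x y, good x → good y → Φ x = Φ y → x = y := by
    rintro (x | x) (y | y) hx hy h
    · exact congrArg _ (hφ h)
    · exact absurd h (hne x y hy)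
    · exact absurd h.symm (hne y x hx)
    · congr 1
      ext w
      rw [← h3 x hx w, ← h3 y hy w, show ψ x = ψ y from h]
  have hedge : ∀ p : {p : Fin m × Fin m // p.1 < p.2}, s(p.1.1, p.1.2) ∈
      (⊤ : SimpleGraph (Fin m)).edgeSet := fun p => by simpa using p.2.ne
  let Ψ : Fin m ⊕ ({p : Fin m × Fin m // p.1 < p.2} × Fin (2 * ℓ - 1)) → W ⊕ Sym2 W := fun x =>
    match x with
    | Sum.inl u => Sum.inl (θ u)
    | Sum.inr (p, i) => subPos (f p) (i + 1)
  have hΨgood : ∀ x, good (Ψ x) := by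
    rintro (u | ⟨p, i⟩)
    · trivial
    · have := i.2
      simp only [Ψ, subPos]
      split_ifs
      · trivial
      · exact f2 p _ (by omega)
  have h_end : ∀ u p j, j ≤ ℓ → (θ u = f p j ↔ (u = p.1.1 ∧ j = 0) ∨ (u = p.1.2 ∧ j = ℓ)) := by
    intro u p j hj
    constructor
    · intro h
      rcases Nat.eq_zero_or_pos j with rfl | h0
      · left; rw [f0] at h; exact ⟨hθ h, rfl⟩
      · rcases hj.eq_or_lt with rfl | hlt
        · right; rw [f1] at h; exact ⟨hθ h, rfl⟩
        · exact absurd (h ▸ f4 p j h0 hlt) (i2 _ (hedge p) u)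
    · rintro (⟨rfl, rfl⟩ | ⟨rfl, rfl⟩)
      · exact (f0 p).symm
      · exact (f1 p).symm
  have h_int : ∀ p q, p ≠ q → ∀ i j, 0 < i → i < ℓ → j ≤ ℓ → f p i ≠ f q j := by
    intro p q hpq i j hi hi' hj heq
    have hpi := f4 p i hi hi'
    rcases Nat.eq_zero_or_pos j with rfl | h0
    · rw [heq, f0] at hpi; exact i2 _ (hedge p) _ hpi
    · rcases hj.eq_or_lt with rfl | hlt
      · rw [heq, f1] at hpi; exact i2 _ (hedge p) _ hpi
      · refine Set.disjoint_left.1 (i1 _ (hedge p) _ (hedge q) ?_) hpi (heq ▸ f4 q j h0 hlt)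
        intro h
        apply hpq
        have hp := p.2
        have hq := q.2
        rcases Sym2.eq_iff.1 h with ⟨e1, e2⟩ | ⟨e1, e2⟩
        · exact Subtype.ext (Prod.ext e1 e2)
        · rw [e1, e2] at hp; exact absurd hp (by omega)
  have hΨinj : Function.Injective Ψ := by
    rintro (u | ⟨p, i⟩) (v | ⟨q, j⟩) h
    · simp only [Ψ, Sum.inl.injEq] at h; rw [hθ h]
    · simp only [Ψ, subPos] at h
      have := j.2
      split_ifs at h with h'
      rw [Sum.inl.injEq, h_end _ _ _ (by omega)] at h
      omega
    · simp only [Ψ, subPos] at h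
      have := i.2
      split_ifs at h with h'
      rw [Sum.inl.injEq, eq_comm, h_end _ _ _ (by omega)] at h
      omega
    · have hi := i.2
      have hj := j.2
      by_cases hpq : p = q
      · subst hpq
        have := subPos_inj (f3 p) (by omega) (by omega) h
        have : i = j := Fin.ext (by omega)
        rw [this]
      · exfalso
        simp only [Ψ, subPos] at h
        split_ifs at h with h1 h2 h2
        · simp only [Sum.inl.injEq] at h
          exact h_int p q hpq _ _ (by omega) (by omega) (by omega) h
        · simp only [Sum.inr.injEq] at h
          have hinj := f3 p
          -- one of the two endpoints is interior, or both edges join branch vertices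
          by_cases hl : ℓ = 1
          · have a1 : ((i : ℕ) + 1) / 2 = 0 := by omega
            have a2 : ((j : ℕ) + 1) / 2 = 0 := by omega
            have e1 : ∀ p, f p (0 + 1) = θ p.1.2 := fun p => by rw [← f1 p, hl]
            rw [a1, a2, f0, f0, e1, e1] at h
            have hp := p.2
            have hq := q.2
            rcases Sym2.eq_iff.1 h with ⟨e1, e2⟩ | ⟨e1, e2⟩
            · exact hpq (Subtype.ext (Prod.ext (hθ e1) (hθ e2)))
            · rw [hθ e1, hθ e2] at hp; exact absurd hp (by omega)
          · by_cases h0 : ((i : ℕ) + 1) / 2 = 0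
            · have : f p (((i : ℕ) + 1) / 2 + 1) ∈ s(f q (((j : ℕ) + 1) / 2), f q (((j : ℕ) + 1) / 2 + 1)) := by
                rw [← h]; simp
              rcases Sym2.mem_iff.1 this with e | e
              · exact h_int p q hpq _ _ (by omega) (by omega) (by omega) e
              · exact h_int p q hpq _ _ (by omega) (by omega) (by omega) e
            · have : f p (((i : ℕ) + 1) / 2) ∈ s(f q (((j : ℕ) + 1) / 2), f q (((j : ℕ) + 1) / 2 + 1)) := by
                rw [← h]; simp
              rcases Sym2.mem_iff.1 this with e | e
              · exact h_int p q hpq _ _ (by omega) (by omega) (by omega) e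
              · exact h_int p q hpq _ _ (by omega) (by omega) (by omega) e
  have hcross : ∀ p q, p ≠ q → ∀ i j : Fin (2 * ℓ - 1),
      ¬ subAdj (subPos (f p) (i + 1)) (subPos (f q) (j + 1)) := by
    intro p q hpq i j h
    have hi := i.2
    have hj := j.2
    unfold subPos at h
    split_ifs at h with h1 h2 h2 <;> simp only [subAdj] at h
    · rcases Sym2.mem_iff.1 h with e | e
      · exact h_int p q hpq _ _ (by omega) (by omega) (by omega) e
      · exact h_int p q hpq _ _ (by omega) (by omega) (by omega) e
    · rcases Sym2.mem_iff.1 h with e | e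
      · exact h_int q p hpq.symm _ _ (by omega) (by omega) (by omega) e
      · exact h_int q p hpq.symm _ _ (by omega) (by omega) (by omega) e
  have hmix : ∀ u p (i : Fin (2 * ℓ - 1)), subAdj (Sum.inl (θ u)) (subPos (f p) (i + 1)) ↔
      (u = p.1.1 ∧ (i : ℕ) = 0) ∨ (u = p.1.2 ∧ (i : ℕ) = 2 * ℓ - 2) := by
    intro u p i
    have hi := i.2
    unfold subPos
    split_ifs with h1 <;> simp only [subAdj, Sym2.mem_iff]
    · rw [false_iff]
      rintro (h | h) <;> omega
    · rw [h_end _ _ _ (by omega), h_end _ _ _ (by omega)]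
      omega
  have hsymm : ∀ x y : W ⊕ Sym2 W, subAdj x y ↔ subAdj y x := by
    rintro (x | x) (y | y) <;> simp [subAdj]
  refine ⟨2 * ℓ, by omega, ⟨⟨⟨fun x => Φ (Ψ x), fun x y h => hΨinj (hΦinj _ _ (hΨgood x) (hΨgood y) h)⟩, ?_⟩⟩⟩
  intro x y
  change G.Adj (Φ (Ψ x)) (Φ (Ψ y)) ↔ _
  rw [hΦadj _ _ (hΨgood x) (hΨgood y), balancedSubdivision, SimpleGraph.fromRel_adj]
  rcases x with u | ⟨p, i⟩ <;> rcases y with v | ⟨q, j⟩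
  · simp [Ψ, subAdj]
  · simp only [Ψ]
    rw [hmix]
    simp
  · simp only [Ψ]
    rw [hsymm, hmix]
    simp
  · simp only [Ψ]
    have hi := i.2
    have hj := j.2
    by_cases hpq : p = q
    · subst hpq
      rw [subPos_adj_iff (f3 p) (by omega) (by omega)]
      constructor
      · intro h
        refine ⟨?_, by simp only [true_and]; omega⟩
        rintro h'
        simp only [Sum.inr.injEq, Prod.mk.injEq, true_and] at h'
        subst h'
        omega
      · rintro ⟨-, h⟩
        omega
    · refine iff_of_false (hcross p q hpq i j) ?_
      rintro ⟨-, h | h⟩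
      · exact hpq h.1
      · exact hpq h.1.symm

end
section
open scoped Classical

/-- The number of ordered adjacent pairs inside `U`. -/
noncomputable def e2 {V : Type*} (G : SimpleGraph V) (U : Finset V) : ℕ :=
  #{p ∈ U ×ˢ U | G.Adj p.1 p.2}

/-- The neighbours of `v`, as a finset. -/
noncomputable def nbr {V : Type*} [Fintype V] (G : SimpleGraph V) (v : V) : Finset V :=
  {y | G.Adj v y}

/-- The external neighbourhood of `X`. -/
noncomputable def nb {V : Type*} [Fintype V] (G : SimpleGraph V) (X : Finset V) : Finset V :=
  {y | y ∉ X ∧ ∃ x ∈ X, G.Adj x y}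

/-- Minimum degree at least `d` together with sublinear expansion. -/
structure Expander {V : Type*} [Fintype V] (G : SimpleGraph V) (d : ℕ) : Prop where
  deg_le : ∀ v, d ≤ #(nbr G v)
  expand : ∀ X : Finset V, X.Nonempty → 2 * #X ≤ Fintype.card V →
    #X ≤ 8 * (Nat.log 2 #X + 3) ^ 2 * #(nb G X)

variable {V : Type*}

@[simp] lemma mem_nbr [Fintype V] {G : SimpleGraph V} {v y : V} : y ∈ nbr G v ↔ G.Adj v y := by
  simp [nbr]

@[simp] lemma mem_nb [Fintype V] {G : SimpleGraph V} {X : Finset V} {y : V} :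
    y ∈ nb G X ↔ y ∉ X ∧ ∃ x ∈ X, G.Adj x y := by
  simp [nb]

lemma e2_erase (G : SimpleGraph V) (U : Finset V) {v : V} (hv : v ∈ U) :
    e2 G U = e2 G (U.erase v) + 2 * #{y ∈ U | G.Adj v y} := by
  have h1 : #{y ∈ U | G.Adj v y} = #(image (fun y => (v, y)) {y ∈ U | G.Adj v y}) :=
    (card_image_of_injective _ (fun a b h => by simpa using h)).symm
  have h2 : #{y ∈ U | G.Adj v y} = #(image (fun y => (y, v)) {y ∈ U | G.Adj v y}) :=
    (card_image_of_injective _ (fun a b h => by simpa using h)).symm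
  rw [two_mul]
  nth_rw 1 [h1]
  rw [h2, e2, e2, ← card_union_of_disjoint, ← card_union_of_disjoint]
  · congr 1
    ext ⟨a, b⟩
    simp only [mem_filter, mem_product, mem_union, mem_erase, mem_image, Prod.mk.injEq]
    constructor
    · rintro ⟨⟨ha, hb⟩, hab⟩
      by_cases h : a = v
      · subst h; right; left; exact ⟨b, ⟨hb, hab⟩, rfl, rfl⟩
      · by_cases h' : b = v
        · subst h'; right; right; exact ⟨a, ⟨ha, hab.symm⟩, rfl, rfl⟩
        · left; exact ⟨⟨⟨h, ha⟩, ⟨h', hb⟩⟩, hab⟩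
    · rintro (⟨⟨⟨h, ha⟩, ⟨h', hb⟩⟩, hab⟩ | ⟨y, ⟨hy, hy'⟩, rfl, rfl⟩ | ⟨y, ⟨hy, hy'⟩, rfl, rfl⟩)
      · exact ⟨⟨ha, hb⟩, hab⟩
      · exact ⟨⟨hv, hy⟩, hy'⟩
      · exact ⟨⟨hy, hv⟩, hy'.symm⟩
  · rw [Finset.disjoint_left]
    rintro ⟨a, b⟩
    simp only [mem_filter, mem_product, mem_union, mem_erase, mem_image, Prod.mk.injEq]
    rintro ⟨⟨⟨h, -⟩, ⟨h', -⟩⟩, -⟩ (⟨y, -, rfl, -⟩ | ⟨y, -, -, rfl⟩)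
    · exact h rfl
    · exact h' rfl
  · rw [Finset.disjoint_left]
    rintro ⟨a, b⟩
    simp only [mem_image, Prod.mk.injEq, mem_filter]
    rintro ⟨y, ⟨-, hy⟩, rfl, rfl⟩ ⟨z, -, rfl, rfl⟩
    exact hy.ne rfl

/-- Potential used to extract an expander. -/
noncomputable def pot (m : ℕ) : ℝ := 2 - 1 / (1 + Real.log m)

lemma pot_ge {m : ℕ} (hm : 1 ≤ m) : 1 ≤ pot m := by
  have : 0 ≤ Real.log m := Real.log_nonneg (by exact_mod_cast hm)
  unfold pot
  have : 1 / (1 + Real.log m) ≤ 1 := by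
    rw [div_le_one (by linarith)]; linarith
  linarith

lemma pot_le {m : ℕ} (hm : 1 ≤ m) : pot m ≤ 2 := by
  have : 0 ≤ Real.log m := Real.log_nonneg (by exact_mod_cast hm)
  unfold pot
  have : 0 ≤ 1 / (1 + Real.log m) := by positivity
  linarith

lemma pot_mono {m n : ℕ} (hm : 1 ≤ m) (h : m ≤ n) : pot m ≤ pot n := by
  have h0 : 0 ≤ Real.log m := Real.log_nonneg (by exact_mod_cast hm)
  have h1 : Real.log m ≤ Real.log n := Real.log_le_log (by exact_mod_cast hm) (by exact_mod_cast h)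
  unfold pot
  have : 1 / (1 + Real.log n) ≤ 1 / (1 + Real.log m) :=
    one_div_le_one_div_of_le (by linarith) (by linarith)
  linarith

lemma pot_gap {x b n : ℕ} (hx : 1 ≤ x) (hn : 2 * x ≤ n)
    (h : (x : ℝ) * pot n ≤ (x + b : ℕ) * pot (x + b)) :
    x ≤ 8 * (Nat.log 2 x + 3) ^ 2 * b := by
  by_contra hlt
  push Not at hlt
  set L := Nat.log 2 x with hL
  have hxR : (1 : ℝ) ≤ x := by exact_mod_cast hx
  have hLR : (0 : ℝ) ≤ L := by positivity
  have hb : 8 * ((L : ℝ) + 3) ^ 2 * b < x := by exact_mod_cast hlt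
  have hbb : 72 * (b : ℝ) ≤ x := by
    have : (9 : ℝ) ≤ ((L : ℝ) + 3) ^ 2 := by nlinarith
    have hb0 : (0 : ℝ) ≤ b := by positivity
    nlinarith
  have hb0 : (0 : ℝ) ≤ b := by positivity
  have h2 : (x : ℝ) * pot (2 * x) ≤ (x + b : ℕ) * pot (x + b) :=
    le_trans (by gcongr; exact pot_mono (by omega) hn) h
  set u := Real.log ((x + b : ℕ) : ℝ) with hu
  set w := Real.log ((2 * x : ℕ) : ℝ) with hw
  have hu0 : 0 ≤ u := Real.log_nonneg (by push_cast; linarith)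
  have hlog2 := Real.log_two_gt_d9
  have hlog2' := Real.log_two_lt_d9
  have hwL : w + 1 ≤ L + 3 := by
    have : (2 * x : ℕ) ≤ 2 ^ (L + 2) := by
      have := Nat.lt_pow_succ_log_self (b := 2) (by norm_num) x
      rw [← hL] at this
      rw [pow_succ]; simp only [Nat.succ_eq_add_one] at this; omega
    have h3 : w ≤ Real.log ((2 : ℝ) ^ (L + 2)) := by
      apply Real.log_le_log (by push_cast; linarith)
      exact_mod_cast this
    rw [Real.log_pow] at h3
    push_cast at h3
    nlinarith
  have hdiff : 0.6 ≤ w - u := by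
    have : u ≤ Real.log ((2 : ℝ) * x / (2 * 36 / 37)) := by
      apply Real.log_le_log (by push_cast; linarith)
      push_cast
      rw [le_div_iff₀ (by norm_num)]
      nlinarith
    have e : Real.log ((2 : ℝ) * x / (2 * 36 / 37)) = w - Real.log (2 * 36 / 37) := by
      rw [Real.log_div (by positivity) (by norm_num), hw]; push_cast; rfl
    have h37 : (0.6 : ℝ) ≤ Real.log (2 * 36 / 37) := by
      rw [mul_div_assoc, Real.log_mul (by norm_num) (by norm_num)]
      have := Real.one_sub_inv_le_log_of_pos (show (0 : ℝ) < 36 / 37 by norm_num)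
      norm_num at this ⊢
      linarith
    linarith
  have hgap : 0.6 / ((L : ℝ) + 3) ^ 2 ≤ 1 / (1 + u) - 1 / (1 + w) := by
    have hw0 : 0 ≤ w := by linarith
    rw [div_sub_div _ _ (by linarith) (by linarith), div_le_div_iff₀ (by positivity) (by positivity)]
    have h3 : (1 + u) * (1 + w) ≤ ((L : ℝ) + 3) ^ 2 := by nlinarith
    have h4 : 1 * (1 + w) - (1 + u) * 1 = w - u := by ring
    rw [h4]
    nlinarith [sq_nonneg ((L : ℝ) + 3)]
  have hp1 : pot (2 * x) = 2 - 1 / (1 + w) := rfl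
  have hp2 : pot (x + b) = 2 - 1 / (1 + u) := rfl
  have h5 : (x : ℝ) * (pot (2 * x) - pot (x + b)) ≤ b * pot (x + b) := by
    push_cast at h2; linarith
  have h6 : pot (x + b) ≤ 2 := pot_le (by omega)
  have h7 : (x : ℝ) * (0.6 / ((L : ℝ) + 3) ^ 2) ≤ 2 * b := by
    calc (x : ℝ) * (0.6 / ((L : ℝ) + 3) ^ 2) ≤ x * (pot (2 * x) - pot (x + b)) := by
          gcongr; rw [hp1, hp2]; linarith
      _ ≤ b * pot (x + b) := h5
      _ ≤ 2 * b := by nlinarith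
  rw [mul_div_assoc', div_le_iff₀ (by positivity)] at h7
  nlinarith

theorem exists_expander [Fintype V] (G : SimpleGraph V) {d : ℕ} (hd : 0 < d) [Nonempty V]
    (h : 4 * d * Fintype.card V ≤ e2 G univ) :
    ∃ U : Finset V, U.Nonempty ∧ Expander (G.induce (U : Set V)) d := by
  obtain ⟨U, hU, hmax⟩ := exists_max_image (univ.filter (fun U : Finset V => U.Nonempty))
    (fun U => (e2 G U : ℝ) / (#U * pot #U)) ⟨univ, by simp⟩
  simp only [mem_filter, mem_univ, true_and] at hU hmax
  set M : ℝ := (e2 G U : ℝ) / (#U * pot #U) with hM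
  have hpos : ∀ S : Finset V, S.Nonempty → (0 : ℝ) < #S * pot #S := by
    intro S hS
    have h1 : 1 ≤ #S := hS.card_pos
    have := pot_ge h1
    have : (0 : ℝ) < #S := by exact_mod_cast h1
    positivity
  have hmax' : ∀ S : Finset V, (e2 G S : ℝ) ≤ M * (#S * pot #S) := by
    intro S
    by_cases hS : S.Nonempty
    · rw [← div_le_iff₀ (hpos S hS)]; exact hmax S hS
    · rw [not_nonempty_iff_eq_empty] at hS
      subst hS; simp [e2]
  have hMU : (e2 G U : ℝ) = M * (#U * pot #U) := by
    rw [hM, div_mul_cancel₀ _ (hpos U hU).ne']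
  have hMnn : 0 ≤ M := div_nonneg (by positivity) (hpos U hU).le
  clear_value M
  have hMd : 2 * (d : ℝ) ≤ M := by
    have h1 : (4 * d * Fintype.card V : ℝ) ≤ e2 G univ := by exact_mod_cast h
    have h2 := hmax' univ
    rw [card_univ] at h2
    have hc : 1 ≤ Fintype.card V := Fintype.card_pos
    have h3 := pot_le hc
    have hcR : (0 : ℝ) < Fintype.card V := by exact_mod_cast hc
    have h4 := pot_ge hc
    have h5 : M * (Fintype.card V * pot (Fintype.card V)) ≤ 2 * M * Fintype.card V := by
      have : M * Fintype.card V * pot (Fintype.card V) ≤ M * Fintype.card V * 2 := by gcongr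
      linarith
    have h6 : (4 * d : ℝ) * Fintype.card V ≤ 2 * M * Fintype.card V := by linarith
    have := le_of_mul_le_mul_right h6 hcR
    linarith
  have hdR : (1 : ℝ) ≤ d := by exact_mod_cast hd
  refine ⟨U, hU, ?_, ?_⟩
  · rintro ⟨v, hv⟩
    have hv' : v ∈ U := by simpa using hv
    have h1 := e2_erase G U hv'
    have h2 := hmax' (U.erase v)
    have h3 : (#(U.erase v) : ℝ) = #U - 1 := by
      rw [card_erase_of_mem hv', Nat.cast_sub hU.card_pos]; simp
    have h4 : M * (#(U.erase v) * pot #(U.erase v)) ≤ M * ((#U - 1) * pot #U) := by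
      rw [h3]
      by_cases hz : #(U.erase v) = 0
      · have : (#U : ℝ) - 1 = 0 := by rw [← h3, hz]; simp
        rw [this]; simp
      · have : (0 : ℝ) ≤ #U - 1 := by rw [← h3]; exact Nat.cast_nonneg _
        have hM0 : 0 ≤ M := by linarith
        gcongr
        exact pot_mono (by omega) (card_erase_le)
    have h5 := pot_ge hU.card_pos
    have h6 : (e2 G U : ℝ) = e2 G (U.erase v) + 2 * #{y ∈ U | G.Adj v y} := by exact_mod_cast h1
    have h7 : (d : ℝ) ≤ #{y ∈ U | G.Adj v y} := by
      have : M * pot #U ≤ 2 * #{y ∈ U | G.Adj v y} := by nlinarith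
      nlinarith
    have h8 : d ≤ #{y ∈ U | G.Adj v y} := by exact_mod_cast h7
    refine h8.trans (le_of_eq ?_)
    rw [← card_map (Function.Embedding.subtype _)]
    congr 1
    ext y
    simp [nbr, and_comm]
  · intro X hX hc
    simp only [Fintype.card_coe, Finset.coe_sort_coe] at hc
    set X' := X.map (Function.Embedding.subtype _) with hX'
    have hcX : #X' = #X := card_map _
    set N' := (nb (G.induce (U : Set V)) X).map (Function.Embedding.subtype _) with hN'
    have hcN : #N' = #(nb (G.induce (U : Set V)) X) := card_map _
    have hXU : X' ⊆ U := by
      intro y; simp [X']; tauto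
    have hdisj : Disjoint X' N' := by
      rw [hX', hN', disjoint_map, Finset.disjoint_left]
      intro a ha; simp [ha]
    have key : e2 G U ≤ e2 G (X' ∪ N') + e2 G (U \ X') := by
      refine (card_le_card ?_).trans (card_union_le _ _)
      rintro ⟨a, b⟩
      simp only [mem_filter, mem_product, mem_union, mem_sdiff]
      rintro ⟨⟨ha, hb⟩, hab⟩
      have aux : ∀ a b, a ∈ U → b ∈ U → G.Adj a b → a ∈ X' → b ∈ X' ∨ b ∈ N' := by
        intro a b ha hb hab haX
        by_cases hbX : b ∈ X'
        · exact Or.inl hbX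
        · right
          rw [hX', mem_map] at haX hbX
          rw [hN', mem_map]
          obtain ⟨a', ha', rfl⟩ := haX
          refine ⟨⟨b, hb⟩, ?_, rfl⟩
          rw [mem_nb]
          refine ⟨fun h => hbX ⟨_, h, rfl⟩, a', ha', hab⟩
      by_cases h1 : a ∈ X'
      · left; exact ⟨⟨Or.inl h1, aux a b ha hb hab h1⟩, hab⟩
      · by_cases h2 : b ∈ X'
        · left; exact ⟨⟨aux b a hb ha hab.symm h2, Or.inl h2⟩, hab⟩
        · right; exact ⟨⟨⟨ha, h1⟩, ⟨hb, h2⟩⟩, hab⟩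
    have hx1 : 1 ≤ #X := hX.card_pos
    refine pot_gap (n := #U) hx1 (by simpa using hc) ?_
    have h1 := hmax' (X' ∪ N')
    have h2 := hmax' (U \ X')
    rw [card_union_of_disjoint hdisj, hcX, hcN] at h1
    have h3 : (#(U \ X') : ℝ) = #U - #X := by
      rw [card_sdiff_of_subset hXU, hcX, Nat.cast_sub (by rw [← hcX]; exact card_le_card hXU)]
    have h4 : pot #(U \ X') ≤ pot #U := by
      refine pot_mono ?_ (card_le_card sdiff_subset)
      rw [card_sdiff_of_subset hXU, hcX]
      have : 2 * #X ≤ #U := by simpa using hc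
      omega
    have keyR : (e2 G U : ℝ) ≤ e2 G (X' ∪ N') + e2 G (U \ X') := by exact_mod_cast key
    have hM0 : 0 < M := by linarith
    have h5 : M * (#(U \ X') * pot #(U \ X')) ≤ M * ((#U - #X) * pot #U) := by
      rw [← h3]
      exact mul_le_mul_of_nonneg_left (mul_le_mul_of_nonneg_left h4 (Nat.cast_nonneg _)) hM0.le
    have h6 : M * (#X * pot #U) ≤ M * ((#X + #(nb (G.induce (U : Set V)) X) : ℕ) *
      pot (#X + #(nb (G.induce (U : Set V)) X))) := by
      rw [hMU] at keyR
      linarith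
    exact le_of_mul_le_mul_left h6 hM0

end
section
open scoped Classical

/-- A monotone sequence which, at scale `2 ^ b`, gains a `1 / Gr b` fraction per step
reaches `2 ^ b` by time `T b`. -/
lemma dyadic_growth {a : ℕ → ℕ} (ha : Monotone a) {Gr T : ℕ → ℕ} (hGr : ∀ b, 0 < Gr b)
    (hT : ∀ b, T (b + 1) = T b + Gr b) {b₀ b₁ : ℕ} (h0 : 2 ^ b₀ ≤ a (T b₀)) (hb : b₀ ≤ b₁)
    (hstep : ∀ b i, b₀ ≤ b → b < b₁ → T b ≤ i → i < T (b + 1) → 2 ^ b ≤ a i → a i < 2 ^ (b + 1) →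
      2 ^ b ≤ Gr b * (a (i + 1) - a i)) : 2 ^ b₁ ≤ a (T b₁) := by
  induction b₁, hb using Nat.le_induction with
  | base => exact h0
  | succ b hb ih =>
    have ih := ih (fun b' i h1 h2 => hstep b' i h1 (by omega))
    by_contra hlt
    push Not at hlt
    have hrange : ∀ i, T b ≤ i → i ≤ T (b + 1) → 2 ^ b ≤ a i ∧ a i < 2 ^ (b + 1) :=
      fun i h1 h2 => ⟨ih.trans (ha h1), (ha h2).trans_lt hlt⟩
    have key : ∀ j ≤ Gr b, Gr b * a (T b) + j * 2 ^ b ≤ Gr b * a (T b + j) := by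
      intro j
      induction j with
      | zero => simp
      | succ j ihj =>
        intro hj
        have h1 := ihj (by omega)
        have h2 := hrange (T b + j) (by omega) (by rw [hT]; omega)
        have h3 := hstep b (T b + j) hb (by omega) (by omega) (by rw [hT]; omega) h2.1 h2.2
        have h4 : a (T b + j) ≤ a (T b + j + 1) := ha (by omega)
        rw [Nat.mul_sub] at h3
        have h5 := Nat.mul_le_mul_left (Gr b) h4
        rw [← add_assoc, add_mul, one_mul]
        omega
    have h1 := key (Gr b) le_rfl
    rw [← mul_add, ← hT] at h1
    have h2 := Nat.le_of_mul_le_mul_left h1 (hGr b)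
    rw [pow_succ] at hlt
    omega

variable {V : Type*}

/-- Vertices of a layered exploration are reached by short walks through the layers. -/
lemma exists_walk_of_layers {G : SimpleGraph V} {X : ℕ → Finset V} {W : Set V}
    (hX : ∀ i, ∀ y ∈ X (i + 1), y ∈ X i ∨ (y ∉ W ∧ ∃ x ∈ X i, G.Adj x y)) (i : ℕ) :
    ∀ y ∈ X i, ∃ j ≤ i, ∃ f : ℕ → V, IsW G f j ∧ f 0 ∈ X 0 ∧ f j = y ∧
      (∀ t, 0 < t → t ≤ j → f t ∉ W) ∧ (∀ t ≤ j, ∃ r ≤ i, f t ∈ X r) := by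
  induction i with
  | zero =>
    intro y hy
    exact ⟨0, le_rfl, fun _ => y, fun i hi => by omega, hy, rfl, fun t h1 h2 => by omega,
      fun t ht => ⟨0, le_rfl, hy⟩⟩
  | succ i ih =>
    intro y hy
    rcases hX i y hy with h | ⟨hyW, x, hx, hxy⟩
    · obtain ⟨j, hj, f, h1, h2, h3, h4, h5⟩ := ih y h
      exact ⟨j, by omega, f, h1, h2, h3, h4, fun t ht => by
        obtain ⟨r, hr, h⟩ := h5 t ht
        exact ⟨r, by omega, h⟩⟩
    · obtain ⟨j, hj, f, h1, h2, h3, h4, h5⟩ := ih x hx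
      refine ⟨j + 1, by omega, fun t => if t ≤ j then f t else y, ?_, by simpa, by simp, ?_, ?_⟩
      · intro t ht
        by_cases h : t + 1 ≤ j
        · have h' : t ≤ j := by omega
          simpa [h, h'] using h1 t (by omega)
        · obtain rfl : t = j := by omega
          simpa [h3] using hxy
      · intro t ht ht'
        by_cases h : t ≤ j
        · simpa [h] using h4 t ht h
        · simpa [h] using hyW
      · intro t ht
        by_cases h : t ≤ j
        · obtain ⟨r, hr, h'⟩ := h5 t h
          exact ⟨r, by omega, by simpa [h] using h'⟩
        · exact ⟨i + 1, le_rfl, by simpa [h] using hy⟩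

/-- Solve tasks one at a time, keeping their regions disjoint. -/
lemma sequential_selection {ι : Type*} [Fintype ι] (P : ι → Finset V → Prop) (r w : ℕ)
    (h : ∀ i, ∀ W : Finset V, #W ≤ w → ∃ I, P i I ∧ #I ≤ r ∧ Disjoint I W)
    (hw : Fintype.card ι * r ≤ w) :
    ∃ I : ι → Finset V, (∀ i, P i (I i) ∧ #(I i) ≤ r) ∧ ∀ i j, i ≠ j → Disjoint (I i) (I j) := by
  suffices hs : ∀ S : Finset ι, ∃ I : ι → Finset V, (∀ i ∈ S, P i (I i) ∧ #(I i) ≤ r) ∧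
      ∀ i ∈ S, ∀ j ∈ S, i ≠ j → Disjoint (I i) (I j) by
    obtain ⟨I, h1, h2⟩ := hs univ
    exact ⟨I, fun i => h1 i (mem_univ i), fun i j => h2 i (mem_univ i) j (mem_univ j)⟩
  intro S
  induction S using Finset.induction_on with
  | empty => exact ⟨fun _ => ∅, by simp, by simp⟩
  | insert a S ha ih =>
    obtain ⟨I, h1, h2⟩ := ih
    obtain ⟨J, j1, j2, j3⟩ := h a (S.biUnion I) (by
      calc #(S.biUnion I) ≤ ∑ i ∈ S, #(I i) := card_biUnion_le
        _ ≤ ∑ i ∈ S, r := sum_le_sum fun i hi => (h1 i hi).2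
        _ = #S * r := by simp
        _ ≤ Fintype.card ι * r := Nat.mul_le_mul_right _ (card_le_univ _)
        _ ≤ w := hw)
    have hJ : ∀ i ∈ S, Disjoint J (I i) := fun i hi =>
      j3.mono_right (subset_biUnion_of_mem I hi)
    have hne : ∀ i ∈ S, i ≠ a := fun i hi h => ha (h ▸ hi)
    refine ⟨Function.update I a J, ?_, ?_⟩
    · intro i hi
      rcases mem_insert.1 hi with rfl | hi
      · simpa using ⟨j1, j2⟩
      · simpa [hne i hi] using h1 i hi
    · intro i hi j hj hij
      rcases mem_insert.1 hi with hia | hi' <;> rcases mem_insert.1 hj with hja | hj'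
      · exact absurd (hia.trans hja.symm) hij
      · subst hia; simpa [hne j hj'] using hJ j hj'
      · subst hja; simpa [hne i hi'] using (hJ i hi').symm
      · simpa [hne i hi', hne j hj'] using h2 i hi' j hj' hij

variable [Fintype V]

/-- Bound on the inverse expansion rate. -/
def gN (n : ℕ) : ℕ := 8 * (Nat.log 2 n + 3) ^ 2

/-- Iterated neighbourhoods avoiding `W`. -/
noncomputable def ballAvoid (G : SimpleGraph V) (W X : Finset V) : ℕ → Finset V
  | 0 => X
  | i + 1 => ballAvoid G W X i ∪ (nb G (ballAvoid G W X i) \ W)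

lemma ballAvoid_mono (G : SimpleGraph V) (W X : Finset V) : Monotone (ballAvoid G W X) :=
  monotone_nat_of_le_succ fun _ => subset_union_left

lemma Expander.ball_large {G : SimpleGraph V} {d : ℕ} (hG : Expander G d) {W X : Finset V}
    (hX : X.Nonempty) (hW : 2 * gN (Fintype.card V) * #W ≤ #X) :
    Fintype.card V < 2 * #(ballAvoid G W X (2 * gN (Fintype.card V) * Nat.log 2 (Fintype.card V))) := by
  set n := Fintype.card V with hn
  set g := gN n with hg
  have hn0 : n ≠ 0 := by
    have := Fintype.card_pos_iff.2 ⟨hX.choose⟩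
    omega
  have hgpos : 0 < g := by rw [hg, gN]; positivity
  have hmono : Monotone fun i => #(ballAvoid G W X i) := fun i j h =>
    card_le_card (ballAvoid_mono G W X h)
  by_contra hlt
  push Not at hlt
  have h1 := dyadic_growth (a := fun i => #(ballAvoid G W X i)) hmono (Gr := fun _ => 2 * g)
    (T := fun b => 2 * g * b) (fun b => by omega) (fun b => by ring) (b₀ := 0)
    (b₁ := Nat.log 2 n) (by simpa [ballAvoid] using hX.card_pos) (Nat.zero_le _) ?_
  · have h2 := Nat.lt_pow_succ_log_self (b := 2) (by norm_num) n
    rw [Nat.succ_eq_add_one, pow_succ] at h2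
    omega
  · intro b i _ hb hi hi' h2 h3
    have hsmall : 2 * #(ballAvoid G W X i) ≤ n := by
      refine le_trans ?_ hlt
      refine Nat.mul_le_mul_left _ (hmono ?_)
      refine hi'.le.trans ?_
      exact Nat.mul_le_mul_left _ hb
    set Y := ballAvoid G W X i with hY
    have hXY : #X ≤ #Y := hmono (Nat.zero_le i)
    have hYne : Y.Nonempty := card_pos.1 (by have := hX.card_pos; omega)
    have h4 := hG.expand Y hYne hsmall
    have hlog : 8 * (Nat.log 2 #Y + 3) ^ 2 ≤ g := by
      rw [hg, gN]
      gcongr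
      exact card_le_univ _
    have h5 : #Y ≤ g * #(nb G Y) := h4.trans (Nat.mul_le_mul_right _ hlog)
    have h6 : #(nb G Y) ≤ #(nb G Y \ W) + #W := by
      have := le_card_sdiff W (nb G Y); omega
    have h7 : #(ballAvoid G W X (i + 1)) = #Y + #(nb G Y \ W) := by
      rw [ballAvoid, card_union_of_disjoint]
      rw [Finset.disjoint_left]
      intro y hy hy'
      simp only [mem_sdiff, mem_nb] at hy'
      exact hy'.1.1 hy
    rw [h7, Nat.add_sub_cancel_left]
    refine h2.trans ?_
    have h8 := Nat.mul_le_mul_left g h6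
    have h9 : 2 * (g * #W) ≤ #X := by rw [← mul_assoc]; exact hW
    rw [mul_add] at h8
    rw [mul_assoc]
    omega

/-- In an expander two large sets are joined by a short walk avoiding a small set. -/
theorem Expander.connect {G : SimpleGraph V} {d : ℕ} (hG : Expander G d) {W X Y : Finset V}
    (hX : X.Nonempty) (hY : Y.Nonempty) (hXW : Disjoint X W) (hYW : Disjoint Y W)
    (hX' : 2 * gN (Fintype.card V) * #W ≤ #X) (hY' : 2 * gN (Fintype.card V) * #W ≤ #Y) :
    ∃ j ≤ 32 * (Nat.log 2 (Fintype.card V) + 3) ^ 3, ∃ f : ℕ → V, IsW G f j ∧ f 0 ∈ X ∧ f j ∈ Y ∧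
      ∀ t ≤ j, f t ∉ W := by
  set n := Fintype.card V
  set T := 2 * gN n * Nat.log 2 n with hT
  have h1 : n < 2 * #(ballAvoid G W X T) := hG.ball_large hX hX'
  have h2 : n < 2 * #(ballAvoid G W Y T) := hG.ball_large hY hY'
  have hmeet : (ballAvoid G W X T ∩ ballAvoid G W Y T).Nonempty := by
    rw [← card_pos]
    have h3 := card_union_add_card_inter (ballAvoid G W X T) (ballAvoid G W Y T)
    have h4 : #(ballAvoid G W X T ∪ ballAvoid G W Y T) ≤ n := card_le_univ _
    omega
  obtain ⟨z, hz⟩ := hmeet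
  rw [mem_inter] at hz
  have hlay : ∀ X, ∀ i, ∀ y ∈ ballAvoid G W X (i + 1), y ∈ ballAvoid G W X i ∨
      (y ∉ (W : Set V) ∧ ∃ x ∈ ballAvoid G W X i, G.Adj x y) := by
    intro X i y hy
    rw [ballAvoid, mem_union, mem_sdiff, mem_nb] at hy
    rcases hy with h | h
    · exact Or.inl h
    · exact Or.inr ⟨by simpa using h.2, h.1.2⟩
  obtain ⟨j, hj, f, f1, f2, f3, f4, -⟩ := exists_walk_of_layers (hlay X) T z hz.1
  change f 0 ∈ X at f2
  obtain ⟨k, hk, g, g1, g2, g3, g4, -⟩ := exists_walk_of_layers (hlay Y) T z hz.2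
  change g 0 ∈ Y at g2
  have f4' : ∀ t ≤ j, f t ∉ W := by
    intro t ht
    rcases Nat.eq_zero_or_pos t with rfl | h
    · exact Finset.disjoint_left.1 hXW f2
    · exact f4 t h ht
  have g4' : ∀ t ≤ k, g t ∉ W := by
    intro t ht
    rcases Nat.eq_zero_or_pos t with rfl | h
    · exact Finset.disjoint_left.1 hYW g2
    · exact g4 t h ht
  refine ⟨j + k, ?_, _, f1.glue g1.reverse (by simp [f3, g3]), by simpa using f2, ?_, ?_⟩
  · have : T ≤ 16 * (Nat.log 2 n + 3) ^ 3 := by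
      rw [hT, gN]
      calc 2 * (8 * (Nat.log 2 n + 3) ^ 2) * Nat.log 2 n
          ≤ 2 * (8 * (Nat.log 2 n + 3) ^ 2) * (Nat.log 2 n + 3) := by gcongr; omega
        _ = _ := by ring
    omega
  · by_cases h : k = 0
    · subst h; simp only [add_zero, le_refl, if_true, f3, ← g3]; exact g2
    · simp only [add_le_iff_nonpos_right, nonpos_iff_eq_zero, h, if_false]
      simpa using g2
  · intro t ht
    by_cases h : t ≤ j
    · simpa [h] using f4' t h
    · simpa [h] using g4' (k - (t - j)) (by omega)

end
section
open scoped Classical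

lemma isW_edge {V : Type*} {G : SimpleGraph V} {u v : V} (h : G.Adj u v) :
    IsW G (fun i => if i = 0 then u else v) 1 := by
  intro i hi
  obtain rfl : i = 0 := by omega
  simpa

lemma Lk.of_walk_finset {V : Type*} {G : SimpleGraph V} {f : ℕ → V} {ℓ : ℕ} (hf : IsW G f ℓ)
    (hne : f 0 ≠ f ℓ) : ∃ ℓ' ≤ ℓ, 1 ≤ ℓ' ∧
      Lk G (↑((range (ℓ + 1)).image f \ {f 0, f ℓ}) : Set V) ℓ' (f 0) (f ℓ) := by
  obtain ⟨ℓ', h1, h2, h3⟩ := Lk.of_walk hf hne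
  refine ⟨ℓ', h1, h2, h3.mono ?_⟩
  rintro x ⟨⟨i, hi, rfl⟩, h4, h5⟩
  simp only [coe_sdiff, coe_image, coe_insert, coe_singleton, Set.mem_sdiff, Set.mem_image,
    Set.mem_insert_iff, Set.mem_singleton_iff, not_or]
  exact ⟨⟨i, by simp; omega, rfl⟩, h4, h5⟩

theorem Expander.link {V : Type*} [Fintype V] {G : SimpleGraph V} {d : ℕ} (hG : Expander G d)
    {W : Finset V} {u v : V} (huv : u ≠ v)
    (hd : (2 * gN (Fintype.card V) + 1) * (#W + 2) ≤ d) :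
    ∃ ℓ, 1 ≤ ℓ ∧ ℓ ≤ 33 * (Nat.log 2 (Fintype.card V) + 3) ^ 3 ∧ ∃ I : Finset V, Lk G I ℓ u v ∧
      #I ≤ 33 * (Nat.log 2 (Fintype.card V) + 3) ^ 3 ∧ Disjoint I W := by
  set W' := W ∪ {u, v} with hW'
  have hcW : #W' ≤ #W + 2 := (card_union_le _ _).trans (by
    have := card_le_two (a := u) (b := v); omega)
  have hg : 0 < gN (Fintype.card V) := by unfold gN; positivity
  have hsize : ∀ x, 2 * gN (Fintype.card V) * #W' ≤ #(nbr G x \ W') := by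
    intro x
    have h1 := hG.deg_le x
    have h2 := le_card_sdiff W' (nbr G x)
    have h3 := (Nat.mul_le_mul_left (2 * gN (Fintype.card V) + 1) hcW).trans hd
    rw [add_mul, one_mul] at h3
    omega
  have hW1 : 0 < #W' := card_pos.2 ⟨u, by simp [W']⟩
  have hne : ∀ x, (nbr G x \ W').Nonempty := by
    intro x
    rw [← card_pos]
    refine lt_of_lt_of_le ?_ (hsize x)
    positivity
  obtain ⟨j, hj, f, f1, f2, f3, f4⟩ := hG.connect (hne u) (hne v) sdiff_disjoint sdiff_disjoint
    (hsize u) (hsize v)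
  simp only [mem_sdiff, mem_nbr] at f2 f3
  have w1 := (isW_edge f2.1).glue f1 (by simp)
  have w2 := w1.glue (isW_edge f3.1.symm) (by
    simp only [add_le_iff_nonpos_right, nonpos_iff_eq_zero]
    by_cases h : j = 0
    · subst h; simp
    · simp [h])
  set F : ℕ → V := (fun i ↦ if i ≤ 1 + j then (if i ≤ 1 then if i = 0 then u else f 0 else f (i - 1))
      else if i - (1 + j) = 0 then f j else v) with hF
  have F0 : F 0 = u := by simp [F]
  have F1 : F (1 + j + 1) = v := by simp [F]
  have hFm : ∀ i ≤ 1 + j + 1, F i ≠ u → F i ≠ v → F i ∉ W := by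
    intro i hi h1 h2
    have hi0 : i ≠ 0 := by rintro rfl; exact h1 F0
    have hi1 : i ≠ 1 + j + 1 := by rintro rfl; exact h2 F1
    have hFi : F i = f (i - 1) := by
      simp only [F]
      rw [if_pos (by omega)]
      split_ifs with h3
      · congr 1; omega
      · rfl
    rw [hFi]
    have := f4 (i - 1) (by omega)
    simp only [W', mem_union, not_or] at this
    exact this.1
  obtain ⟨ℓ, hℓ, hℓ1, hlk⟩ := Lk.of_walk_finset w2 (by rw [F0, F1]; exact huv)
  rw [F0, F1] at hlk
  have hN : 27 ≤ (Nat.log 2 (Fintype.card V) + 3) ^ 3 := by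
    calc 27 = 3 ^ 3 := by norm_num
      _ ≤ _ := by gcongr; omega
  refine ⟨ℓ, hℓ1, by omega, _, hlk, ?_, ?_⟩
  · refine (card_le_card sdiff_subset).trans (card_image_le.trans ?_)
    rw [card_range]; omega
  · rw [Finset.disjoint_left]
    intro x hx
    simp only [mem_sdiff, mem_image, mem_range, mem_insert, mem_singleton, not_or] at hx
    obtain ⟨⟨i, hi, rfl⟩, h1, h2⟩ := hx
    exact hFm i (by omega) h1 h2

/-- `G` contains a subdivision of `F` in which the edge `e` becomes a path of length `lab e`. -/
def LSub {V W : Type*} (G : SimpleGraph V) (F : SimpleGraph W) (lab : Sym2 W → ℕ) : Prop :=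
  ∃ φ : W → V, Function.Injective φ ∧ ∃ I : Sym2 W → Set V,
    (∀ e ∈ F.edgeSet, ∀ e' ∈ F.edgeSet, e ≠ e' → Disjoint (I e) (I e')) ∧
    (∀ e ∈ F.edgeSet, ∀ w, φ w ∉ I e) ∧
    ∀ a b, F.Adj a b → Lk G (I s(a, b)) (lab s(a, b)) (φ a) (φ b)

/-- A labelled subdivision contains a balanced one of its most popular label. -/
lemma LSub.popular {V W : Type*} [Fintype W] {G : SimpleGraph V} {F : SimpleGraph W}
    {lab : Sym2 W → ℕ} (h : LSub G F lab) {R : ℕ} (hR : 0 < R)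
    (hlab : ∀ e ∈ F.edgeSet, 1 ≤ lab e ∧ lab e ≤ R) :
    ∃ ℓ, 1 ≤ ℓ ∧ ∃ F' : SimpleGraph W, Sub G F' ℓ ∧ e2 F univ ≤ R * e2 F' univ := by
  obtain ⟨φ, hφ, I, h1, h2, h3⟩ := h
  let F' : ℕ → SimpleGraph W := fun ℓ =>
    { Adj := fun a b => F.Adj a b ∧ lab s(a, b) = ℓ
      symm := ⟨fun a b hab => ⟨hab.1.symm, by rw [Sym2.eq_swap]; exact hab.2⟩⟩
      loopless := ⟨fun a ha => ha.1.ne rfl⟩ }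
  have hle : ∀ ℓ, F' ℓ ≤ F := fun ℓ a b hab => hab.1
  have hsum : e2 F univ ≤ ∑ ℓ ∈ Icc 1 R, e2 (F' ℓ) univ := by
    have hsub : ({p ∈ (univ : Finset W) ×ˢ univ | F.Adj p.1 p.2} : Finset (W × W)) ⊆
        (Icc 1 R).biUnion fun ℓ => {p ∈ (univ : Finset W) ×ˢ univ | (F' ℓ).Adj p.1 p.2} := by
      rintro ⟨a, b⟩ hab
      simp only [mem_filter, mem_product, mem_univ, true_and, and_true, mem_biUnion, mem_Icc] at hab ⊢
      exact ⟨lab s(a, b), hlab _ hab, hab, rfl⟩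
    refine (card_le_card hsub).trans (card_biUnion_le.trans (sum_le_sum fun ℓ _ => ?_))
    exact card_le_card fun x hx => by simpa using hx
  have hex : ∃ ℓ ∈ Icc 1 R, e2 F univ ≤ R * e2 (F' ℓ) univ := by
    by_contra hcon
    push Not at hcon
    have h4 : ∑ ℓ ∈ Icc 1 R, R * e2 (F' ℓ) univ < ∑ ℓ ∈ Icc 1 R, e2 F univ :=
      sum_lt_sum_of_nonempty ⟨1, by simp; omega⟩ hcon
    rw [← mul_sum, sum_const, Nat.card_Icc, smul_eq_mul, Nat.add_sub_cancel] at h4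
    exact absurd (Nat.mul_le_mul_left R hsum) (by omega)
  obtain ⟨ℓ, hℓ, hle'⟩ := hex
  have hmono : ∀ e ∈ (F' ℓ).edgeSet, e ∈ F.edgeSet := fun e he =>
    SimpleGraph.edgeSet_mono (hle ℓ) he
  refine ⟨ℓ, (mem_Icc.1 hℓ).1, F' ℓ, ⟨φ, hφ, I, ?_, ?_, ?_⟩, hle'⟩
  · exact fun e he e' he' => h1 e (hmono e he) e' (hmono e' he')
  · exact fun e he => h2 e (hmono e he)
  · intro a b hab
    have := h3 a b hab.1
    rwa [hab.2] at this

lemma e2_univ_eq {W : Type*} [Fintype W] (F : SimpleGraph W) :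
    e2 F univ = ∑ v, #(nbr F v) := by
  rw [e2, card_filter, sum_product]
  refine sum_congr rfl fun v _ => ?_
  rw [nbr, card_filter]

lemma card_sym2_le (h : ℕ) : Fintype.card (Sym2 (Fin h)) ≤ h ^ 2 := by
  have : Function.Surjective (fun p : Fin h × Fin h => s(p.1, p.2)) := by
    intro e
    induction e with | _ a b => exact ⟨(a, b), rfl⟩
  have := Fintype.card_le_of_surjective _ this
  simpa [sq] using this

/-- Dependent random choice: a dense graph contains a `1`-subdivision of a complete graph. -/
theorem BS.of_dense {W : Type*} [Fintype W] (F : SimpleGraph W) {h r : ℕ} (hh : 1 ≤ h) (hr : 1 ≤ r)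
    (hden : Fintype.card W ^ 2 ≤ r * e2 F univ) (hm : 17 * r ^ 2 * h ^ 4 ≤ Fintype.card W) :
    BS F h := by
  set m := Fintype.card W with hmdef
  have hm0 : 0 < m := lt_of_lt_of_le (by positivity) hm
  let cod : W → W → ℕ := fun u v => #(nbr F u ∩ nbr F v)
  let q := 4 * h ^ 2
  let A : W × W → Finset W := fun y => {v | F.Adj v y.1 ∧ F.Adj v y.2}
  let B : W × W → Finset (W × W) := fun y =>
    {p ∈ A y ×ˢ A y | p.1 ≠ p.2 ∧ cod p.1 p.2 < q}
  have hA : ∑ y, #(A y) = ∑ v, #(nbr F v) ^ 2 := by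
    simp only [A, card_filter]
    rw [sum_comm]
    refine sum_congr rfl fun v _ => ?_
    rw [sq, ← card_product, ← card_filter]
    congr 1
    ext y
    simp
  have hB : ∑ y, #(B y) ≤ m ^ 2 * q ^ 2 := by
    have : ∑ y, #(B y) = ∑ p : W × W, #{y : W × W | p ∈ B y} := by
      simp only [card_filter]
      rw [sum_comm]
      refine sum_congr rfl fun y _ => ?_
      rw [← card_filter]
      congr 1
      ext; simp
    rw [this]
    calc ∑ p : W × W, #{y : W × W | p ∈ B y} ≤ ∑ p : W × W, q ^ 2 := by
          refine sum_le_sum fun p _ => ?_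
          by_cases hp : p.1 ≠ p.2 ∧ cod p.1 p.2 < q
          · calc #{y : W × W | p ∈ B y} ≤ #((nbr F p.1 ∩ nbr F p.2) ×ˢ (nbr F p.1 ∩ nbr F p.2)) := by
                  refine card_le_card ?_
                  intro y hy
                  simp only [B, A, mem_filter, mem_univ, true_and, mem_product] at hy
                  simp only [mem_product, mem_inter, mem_nbr]
                  tauto
              _ = cod p.1 p.2 ^ 2 := by rw [card_product, sq]
              _ ≤ q ^ 2 := by gcongr; exact hp.2.le
          · have : ({y : W × W | p ∈ B y} : Finset (W × W)) = ∅ := by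
              ext y
              simp only [B, mem_filter, mem_univ, true_and, notMem_empty, iff_false]
              tauto
            rw [this]; simp
      _ = m ^ 2 * q ^ 2 := by simp [hmdef, sq]
  have hcs : m ^ 3 ≤ r ^ 2 * ∑ y, #(A y) := by
    have h1 : (∑ v, #(nbr F v)) ^ 2 ≤ m * ∑ v, #(nbr F v) ^ 2 := by
      have := sq_sum_le_card_mul_sum_sq (s := (univ : Finset W)) (f := fun v => #(nbr F v))
      simpa using this
    rw [← e2_univ_eq] at h1
    rw [hA]
    have h2 : (m ^ 2) ^ 2 ≤ (r * e2 F univ) ^ 2 := by gcongr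
    have h3 : m * m ^ 3 ≤ m * (r ^ 2 * ∑ v, #(nbr F v) ^ 2) := by
      calc m * m ^ 3 = (m ^ 2) ^ 2 := by ring
        _ ≤ r ^ 2 * (e2 F univ) ^ 2 := by rw [← mul_pow]; exact h2
        _ ≤ r ^ 2 * (m * ∑ v, #(nbr F v) ^ 2) := by gcongr
        _ = _ := by ring
    exact Nat.le_of_mul_le_mul_left h3 hm0
  have hex : ∃ y, #(B y) + h ≤ #(A y) := by
    by_contra hcon
    push Not at hcon
    have h1 : ∑ y, #(A y) ≤ ∑ y : W × W, (#(B y) + h) := sum_le_sum fun y _ => (hcon y).le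
    have hne : ∑ y, #(A y) < ∑ y : W × W, (#(B y) + h) := by
      have : Nonempty W := Fintype.card_pos_iff.1 hm0
      exact sum_lt_sum_of_nonempty univ_nonempty fun y _ => hcon y
    rw [sum_add_distrib, sum_const, card_univ, Fintype.card_prod, smul_eq_mul, ← hmdef] at hne
    have h2 : r ^ 2 * ∑ y, #(A y) < r ^ 2 * (m ^ 2 * q ^ 2 + m * m * h) := by
      refine Nat.mul_lt_mul_of_pos_left ?_ (by positivity)
      omega
    have h3 : r ^ 2 * (m ^ 2 * q ^ 2 + m * m * h) ≤ m ^ 3 := by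
      calc r ^ 2 * (m ^ 2 * q ^ 2 + m * m * h) = m ^ 2 * (r ^ 2 * (16 * h ^ 4 + h)) := by
            simp only [q]; ring
        _ ≤ m ^ 2 * (17 * r ^ 2 * h ^ 4) := by
            refine Nat.mul_le_mul_left _ ?_
            have : h ≤ h ^ 4 := Nat.le_self_pow (by norm_num) h
            calc r ^ 2 * (16 * h ^ 4 + h) ≤ r ^ 2 * (16 * h ^ 4 + h ^ 4) := by gcongr
              _ = _ := by ring
        _ ≤ m ^ 2 * m := by gcongr
        _ = m ^ 3 := by ring
    omega
  obtain ⟨y, hy⟩ := hex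
  let A' := A y \ (B y).image Prod.fst
  have hA' : h ≤ #A' := by
    have h1 := le_card_sdiff ((B y).image Prod.fst) (A y)
    have h2 : #((B y).image Prod.fst) ≤ #(B y) := card_image_le
    simp only [A']
    omega
  have hgood : ∀ u ∈ A', ∀ v ∈ A', u ≠ v → q ≤ cod u v := by
    intro u hu v hv huv
    by_contra hlt
    push Not at hlt
    simp only [A', mem_sdiff, mem_image, not_exists, not_and] at hu hv
    exact hu.2 (u, v) (by simp only [B, mem_filter, mem_product]; exact ⟨⟨hu.1, hv.1⟩, huv, hlt⟩) rfl
  obtain ⟨S, hS, hSc⟩ := exists_subset_card_eq hA'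
  let θ : Fin h → W := fun i => (S.equivFinOfCardEq hSc).symm i
  have hθ : Function.Injective θ := Subtype.val_injective.comp (Equiv.injective _)
  have hθS : ∀ i, θ i ∈ A' := fun i => hS ((S.equivFinOfCardEq hSc).symm i).2
  obtain ⟨I, hI, hId⟩ := sequential_selection (V := W) (ι := Sym2 (Fin h))
    (fun e I => Disjoint I (univ.image θ) ∧ ∀ a b, e = s(a, b) → a ≠ b → Lk F I 2 (θ a) (θ b))
    1 (h ^ 2) (by
      intro e X hX
      induction e with | _ a b =>
      by_cases hab : a = b
      · refine ⟨∅, ⟨by simp, ?_⟩, by simp, by simp⟩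
        intro a' b' he hne
        rcases Sym2.eq_iff.1 he with ⟨h1, h2⟩ | ⟨h1, h2⟩
        · exact absurd (h1 ▸ h2 ▸ hab) hne
        · exact absurd (h1 ▸ h2 ▸ hab.symm) hne
      · have h1 := hgood _ (hθS a) _ (hθS b) (hθ.ne hab)
        have h2 := le_card_sdiff (X ∪ univ.image θ) (nbr F (θ a) ∩ nbr F (θ b))
        have h3 : #(X ∪ univ.image θ) ≤ h ^ 2 + h := by
          refine (card_union_le _ _).trans (add_le_add hX ?_)
          exact card_image_le.trans (by simp)
        have h4 : h ≤ h ^ 2 := Nat.le_self_pow (by norm_num) h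
        have h5 : 0 < h ^ 2 := by positivity
        have h6 : (((nbr F (θ a) ∩ nbr F (θ b)) \ (X ∪ univ.image θ))).Nonempty := by
          rw [← card_pos]
          have : q ≤ #(nbr F (θ a) ∩ nbr F (θ b)) := h1
          simp only [q] at this
          omega
        obtain ⟨z, hz⟩ := h6
        simp only [mem_sdiff, mem_inter, mem_nbr, mem_union, not_or] at hz
        refine ⟨{z}, ⟨by simpa using hz.2.2, ?_⟩, by simp, by simpa using hz.2.1⟩
        have key : Lk F ((({z} : Finset W)) : Set W) 2 (θ a) (θ b) := by
          have := (Lk.of_adj ∅ hz.1.1).trans (Lk.of_adj ∅ hz.1.2.symm) (by simp) (by simp) (by simp)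
            (hθ.ne hab)
          simpa using this
        intro a' b' he hne
        rcases Sym2.eq_iff.1 he with ⟨h1, h2⟩ | ⟨h1, h2⟩
        · rw [← h1, ← h2]; exact key
        · rw [← h1, ← h2]; exact key.symm) (by simpa using card_sym2_le h)
  refine ⟨2, by norm_num, θ, hθ, fun e => I e, ?_, ?_, ?_⟩
  · intro e _ e' _ hne
    exact Finset.disjoint_coe.2 (hId e e' hne)
  · intro e _ w hw
    exact Finset.disjoint_left.1 (hI e).1.1 hw (by simp)
  · intro a b hab
    exact (hI s(a, b)).1.2 a b rfl hab

end
section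
open scoped Classical

lemma e2_top (m : ℕ) : e2 (⊤ : SimpleGraph (Fin m)) univ = m * (m - 1) := by
  rw [e2_univ_eq]
  have : ∀ v : Fin m, #(nbr (⊤ : SimpleGraph (Fin m)) v) = m - 1 := by
    intro v
    have : nbr (⊤ : SimpleGraph (Fin m)) v = univ.erase v := by
      ext y; simp [eq_comm]
    rw [this, card_erase_of_mem (mem_univ _)]; simp
  simp [this]

theorem Expander.bs {V : Type*} [Fintype V] [Nonempty V] {G : SimpleGraph V} {d h : ℕ}
    (hG : Expander G d)
    (hh : 1 ≤ h) (hd : (h * (Nat.log 2 (Fintype.card V) + 3)) ^ 50 ≤ d) : BS G h := by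
  set n := Fintype.card V with hn
  set N := Nat.log 2 n + 3 with hN
  set R := 33 * N ^ 3 with hR
  set m := 17 * (2 * R) ^ 2 * h ^ 4 with hm
  have hN3 : 3 ≤ N := by omega
  have hN0 : 0 < N := by omega
  have hR0 : 0 < R := by positivity
  have hm0 : 0 < m := by positivity
  have hgn : gN n = 8 * N ^ 2 := rfl
  have hbig : (2 * gN n + 1) * (m ^ 2 * R + m + 2) ≤ d := by
    refine le_trans ?_ hd
    have h1 : m ^ 2 * R + m + 2 ≤ 4 * (m ^ 2 * R) := by
      have : 0 < m ^ 2 * R := by positivity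
      have : m ≤ m ^ 2 * R := by
        calc m ≤ m ^ 2 := Nat.le_self_pow (by norm_num) m
          _ ≤ m ^ 2 * R := Nat.le_mul_of_pos_right _ hR0
      omega
    have h2 : 2 * gN n + 1 ≤ 17 * N ^ 2 := by
      rw [hgn]
      have : 1 ≤ N ^ 2 := Nat.one_le_pow _ _ hN0
      omega
    calc (2 * gN n + 1) * (m ^ 2 * R + m + 2) ≤ 17 * N ^ 2 * (4 * (m ^ 2 * R)) := Nat.mul_le_mul h2 h1
      _ = (68 ^ 3 * 33 ^ 5) * (N ^ 17 * h ^ 8) := by rw [hm, hR]; ring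
      _ ≤ 3 ^ 28 * (N ^ 17 * h ^ 8) := Nat.mul_le_mul_right _ (by norm_num)
      _ ≤ N ^ 28 * (N ^ 17 * h ^ 8) := by gcongr
      _ = N ^ 45 * h ^ 8 := by ring
      _ ≤ N ^ 50 * h ^ 50 := by
          apply Nat.mul_le_mul
          · exact Nat.pow_le_pow_right hN0 (by norm_num)
          · exact Nat.pow_le_pow_right hh (by norm_num)
      _ = (h * N) ^ 50 := by rw [mul_pow, mul_comm]
  have hmd : m ≤ d := by
    refine le_trans ?_ hbig
    calc m ≤ m ^ 2 * R + m + 2 := by omega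
      _ ≤ _ := Nat.le_mul_of_pos_left _ (by omega)
  have hmn : m ≤ Fintype.card V := by
    obtain ⟨v⟩ := ‹Nonempty V›
    exact hmd.trans ((hG.deg_le v).trans (card_le_univ _))
  obtain ⟨S, -, hSc⟩ := exists_subset_card_eq (s := (univ : Finset V)) hmn
  let θ : Fin m → V := fun i => (S.equivFinOfCardEq hSc).symm i
  have hθ : Function.Injective θ := Subtype.val_injective.comp (Equiv.injective _)
  obtain ⟨I, hI, hId⟩ := sequential_selection (V := V) (ι := Sym2 (Fin m))
    (fun e I => Disjoint I (univ.image θ) ∧ ∃ ℓ, 1 ≤ ℓ ∧ ℓ ≤ R ∧ ∀ a b, e = s(a, b) → a ≠ b →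
      Lk G I ℓ (θ a) (θ b)) R (m ^ 2 * R) (by
      intro e X hX
      induction e with | _ a b =>
      by_cases hab : a = b
      · refine ⟨∅, ⟨by simp, 1, le_rfl, hR0, ?_⟩, by simp, by simp⟩
        intro a' b' he hne
        rcases Sym2.eq_iff.1 he with ⟨h1, h2⟩ | ⟨h1, h2⟩
        · exact absurd (h1 ▸ h2 ▸ hab) hne
        · exact absurd (h1 ▸ h2 ▸ hab.symm) hne
      · have h3 : #(X ∪ univ.image θ) ≤ m ^ 2 * R + m := by
          refine (card_union_le _ _).trans (add_le_add hX ?_)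
          exact card_image_le.trans (by simp)
        obtain ⟨ℓ, hℓ1, hℓ2, I, hlk, hIc, hId⟩ := hG.link (W := X ∪ univ.image θ) (hθ.ne hab) (by
          refine le_trans (Nat.mul_le_mul_left _ ?_) hbig
          omega)
        rw [disjoint_union_right] at hId
        refine ⟨I, ⟨hId.2, ℓ, hℓ1, hℓ2, ?_⟩, hIc, hId.1⟩
        intro a' b' he hne
        rcases Sym2.eq_iff.1 he with ⟨h1, h2⟩ | ⟨h1, h2⟩
        · rw [← h1, ← h2]; exact hlk
        · rw [← h1, ← h2]; exact hlk.symm) (Nat.mul_le_mul_right _ (card_sym2_le m))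
  choose! lab hlab using fun e => (hI e).1.2
  have hL : LSub G (⊤ : SimpleGraph (Fin m)) lab := by
    refine ⟨θ, hθ, fun e => I e, ?_, ?_, ?_⟩
    · intro e _ e' _ hne
      exact Finset.disjoint_coe.2 (hId e e' hne)
    · intro e _ w hw
      exact Finset.disjoint_left.1 (hI e).1.1 hw (by simp)
    · intro a b hab
      exact (hlab s(a, b)).2.2 a b rfl hab
  obtain ⟨ℓ, hℓ, F', hS', he⟩ := hL.popular hR0 (fun e _ => ⟨(hlab e).1, (hlab e).2.1⟩)
  refine BS.comp hℓ hS' (BS.of_dense F' (r := 2 * R) hh (by omega) ?_ ?_)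
  · rw [e2_top] at he
    rw [Fintype.card_fin, mul_assoc]
    have hm2 : 2 ≤ m := by
      have : 0 < (2 * R) ^ 2 * h ^ 4 := by positivity
      rw [hm, mul_assoc]; omega
    calc m ^ 2 = m * m := sq m
      _ ≤ m * (2 * (m - 1)) := Nat.mul_le_mul_left _ (by omega)
      _ = 2 * (m * (m - 1)) := by ring
      _ ≤ _ := Nat.mul_le_mul_left _ he
  · rw [Fintype.card_fin]

/-- A graph whose average degree is polylogarithmically large contains a balanced subdivision. -/
theorem BS.of_avg {V : Type*} [Fintype V] [Nonempty V] (G : SimpleGraph V) {h : ℕ} (hh : 1 ≤ h)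
    (hd : (h * (Nat.log 2 (Fintype.card V) + 3)) ^ 52 * Fintype.card V ≤ e2 G univ) : BS G h := by
  set N := Nat.log 2 (Fintype.card V) + 3 with hN
  obtain ⟨U, hU, hE⟩ := exists_expander G (d := (h * N) ^ 50) (by positivity) (by
    refine le_trans (Nat.mul_le_mul_right _ ?_) hd
    rw [pow_add _ 50 2, mul_comm]
    refine Nat.mul_le_mul_left _ ?_
    calc 4 ≤ 3 ^ 2 := by norm_num
      _ ≤ (h * N) ^ 2 := by
        gcongr
        calc 3 = 1 * 3 := by norm_num
          _ ≤ h * N := Nat.mul_le_mul hh (by omega))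
  have : Nonempty (U : Set V) := hU.to_subtype
  have hc : Fintype.card (U : Set V) ≤ Fintype.card V :=
    Fintype.card_le_of_injective _ Subtype.val_injective
  have hlog := Nat.log_mono_right (b := 2) hc
  exact BS.induce (hE.bs hh (Nat.pow_le_pow_left (Nat.mul_le_mul_left _ (by omega)) _))

end
section
open scoped Classical

lemma LSub.bs_of_top {V W : Type*} [Fintype W] {G : SimpleGraph V} {lab : Sym2 W → ℕ} {h R : ℕ}
    (hS : LSub G (⊤ : SimpleGraph W) lab) (hh : 1 ≤ h) (hR : 0 < R)
    (hlab : ∀ e ∈ (⊤ : SimpleGraph W).edgeSet, 1 ≤ lab e ∧ lab e ≤ R)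
    (hm : 68 * R ^ 2 * h ^ 4 ≤ Fintype.card W) : BS G h := by
  obtain ⟨ℓ, hℓ, F', hS', he⟩ := hS.popular hR hlab
  refine BS.comp hℓ hS' (BS.of_dense F' (r := 2 * R) hh (by omega) ?_ ?_)
  · set m := Fintype.card W
    have hm2 : 2 ≤ m := by
      have : 0 < R ^ 2 * h ^ 4 := by positivity
      rw [mul_assoc] at hm; omega
    have htop : e2 (⊤ : SimpleGraph W) univ = m * (m - 1) := by
      rw [e2_univ_eq]
      have : ∀ v : W, #(nbr (⊤ : SimpleGraph W) v) = m - 1 := by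
        intro v
        have : nbr (⊤ : SimpleGraph W) v = univ.erase v := by
          ext w; simp [eq_comm]
        rw [this, card_erase_of_mem (mem_univ v), card_univ]
      simp [this, m]
    rw [htop] at he
    calc m ^ 2 = m * m := sq m
      _ ≤ m * (2 * (m - 1)) := Nat.mul_le_mul_left _ (by omega)
      _ = 2 * (m * (m - 1)) := by ring
      _ ≤ 2 * (R * e2 F' univ) := Nat.mul_le_mul_left _ he
      _ = 2 * R * e2 F' univ := by ring
  · calc 17 * (2 * R) ^ 2 * h ^ 4 = 68 * R ^ 2 * h ^ 4 := by ring
      _ ≤ _ := hm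

section
variable {V : Type*} [Fintype V] {G : SimpleGraph V}

/-- Any two outside neighbours of `X` are linked through `X` by a path of length at most `R`. -/
def Linking (G : SimpleGraph V) (R : ℕ) (X : Finset V) : Prop :=
  ∀ a ∈ nb G X, ∀ b ∈ nb G X, a ≠ b → ∃ ℓ, 1 ≤ ℓ ∧ ℓ ≤ R ∧ Lk G (X : Set V) ℓ a b

/-- `σ` assigns to every member of `𝒳` its own pair of neighbours in `E`. -/
def PairAssign (G : SimpleGraph V) (E : Finset V) (𝒳 : Finset (Finset V))
    (σ : Finset V → Sym2 V) : Prop :=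
  Set.InjOn σ 𝒳 ∧ ∀ X ∈ 𝒳, ∀ a b, σ X = s(a, b) → a ≠ b ∧ a ∈ nb G X ∩ E ∧ b ∈ nb G X ∩ E

/-- The graph on `K` whose edges are the assigned pairs. -/
def pairGraph (𝒳 : Finset (Finset V)) (σ : Finset V → Sym2 V) (K : Finset V) : SimpleGraph K where
  Adj a b := a ≠ b ∧ ∃ X ∈ 𝒳, σ X = s((a : V), (b : V))
  symm := ⟨fun a b h => ⟨h.1.symm, by rw [Sym2.eq_swap]; exact h.2⟩⟩
  loopless := ⟨fun _ h => h.1 rfl⟩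

lemma PairAssign.lsub {E K : Finset V} {𝒳 : Finset (Finset V)} {σ : Finset V → Sym2 V} {R : ℕ}
    (hσ : PairAssign G E 𝒳 σ) (hKE : K ⊆ E)
    (hdisj : ∀ X ∈ 𝒳, ∀ Y ∈ 𝒳, X ≠ Y → Disjoint X Y) (hE : ∀ X ∈ 𝒳, Disjoint X E)
    (hlink : ∀ X ∈ 𝒳, Linking G R X) :
    ∃ lab, LSub G (pairGraph 𝒳 σ K) lab ∧
      ∀ e ∈ (pairGraph 𝒳 σ K).edgeSet, 1 ≤ lab e ∧ lab e ≤ R := by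
  have key : ∀ e : Sym2 K, ∃ ℓ, ∃ I : Set V, e ∈ (pairGraph 𝒳 σ K).edgeSet →
      (1 ≤ ℓ ∧ ℓ ≤ R) ∧ (∃ X ∈ 𝒳, I = X ∧ σ X = e.map Subtype.val) ∧
      ∀ a b, e = s(a, b) → Lk G I ℓ a b := by
    intro e
    by_cases he : e ∈ (pairGraph 𝒳 σ K).edgeSet
    · induction e using Sym2.ind with
      | _ a b =>
        obtain ⟨hab, X, hX, hσX⟩ := (SimpleGraph.mem_edgeSet _).1 he
        obtain ⟨h1, h2, h3⟩ := hσ.2 X hX a b hσX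
        obtain ⟨ℓ, hℓ1, hℓR, hL⟩ :=
          hlink X hX a (mem_inter.1 h2).1 b (mem_inter.1 h3).1 h1
        refine ⟨ℓ, X, fun _ => ⟨⟨hℓ1, hℓR⟩, ⟨X, hX, rfl, by simpa using hσX⟩, ?_⟩⟩
        intro a' b' h
        rcases Sym2.eq_iff.1 h with ⟨rfl, rfl⟩ | ⟨rfl, rfl⟩
        · exact hL
        · exact hL.symm
    · exact ⟨0, ∅, fun h => (he h).elim⟩
  choose lab I hI using key
  refine ⟨lab, ⟨Subtype.val, Subtype.val_injective, I, ?_, ?_, ?_⟩, fun e he => (hI e he).1⟩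
  · intro e he e' he' hne
    obtain ⟨-, ⟨X, hX, h1, h2⟩, -⟩ := hI e he
    obtain ⟨-, ⟨Y, hY, h3, h4⟩, -⟩ := hI e' he'
    rw [h1, h3, Finset.disjoint_coe]
    refine hdisj X hX Y hY ?_
    rintro rfl
    exact hne (Sym2.map.injective Subtype.val_injective (h2.symm.trans h4))
  · intro e he w hw
    obtain ⟨-, ⟨X, hX, h1, h2⟩, -⟩ := hI e he
    rw [h1] at hw
    exact Finset.disjoint_left.1 (hE X hX) hw (hKE w.2)
  · intro a b hab
    exact (hI s(a, b) hab).2.2 a b rfl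

/-- Few disjoint linking sets can have many neighbours in a fixed set `E`. -/
theorem card_linking_le {h R : ℕ} (hh : 1 ≤ h) (hR : 0 < R) (hBS : ¬ BS G h) {E : Finset V}
    (𝒳 : Finset (Finset V)) (hdisj : ∀ X ∈ 𝒳, ∀ Y ∈ 𝒳, X ≠ Y → Disjoint X Y)
    (hE : ∀ X ∈ 𝒳, Disjoint X E) (hlink : ∀ X ∈ 𝒳, Linking G R X)
    (hm : ∀ X ∈ 𝒳, 68 * R ^ 2 * h ^ 4 ≤ #(nb G X ∩ E)) :
    #𝒳 ≤ R * (h * (Nat.log 2 (Fintype.card V) + 3)) ^ 52 * #E := by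
  rcases Finset.eq_empty_or_nonempty 𝒳 with rfl | ⟨X₀, hX₀⟩
  · simp
  have hEne : Nonempty E := by
    have h1 : 0 < #(nb G X₀ ∩ E) := lt_of_lt_of_le (by positivity) (hm X₀ hX₀)
    obtain ⟨x, hx⟩ := card_pos.1 h1
    exact ⟨⟨x, (mem_inter.1 hx).2⟩⟩
  have hV : Nonempty V := ⟨hEne.some⟩
  have hex : ∃ σ, PairAssign G E 𝒳 σ := by
    clear hX₀ X₀
    induction 𝒳 using Finset.induction_on with
    | empty =>
      obtain ⟨v⟩ := hV
      exact ⟨fun _ => s(v, v), by simp [PairAssign]⟩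
    | insert X 𝒴 hX ih =>
      obtain ⟨σ, hσ⟩ := ih (fun Y hY Z hZ => hdisj Y (mem_insert_of_mem hY) Z (mem_insert_of_mem hZ))
        (fun Y hY => hE Y (mem_insert_of_mem hY)) (fun Y hY => hlink Y (mem_insert_of_mem hY))
        (fun Y hY => hm Y (mem_insert_of_mem hY))
      set K := nb G X ∩ E with hK
      by_cases hun : ∃ a ∈ K, ∃ b ∈ K, a ≠ b ∧ ∀ Y ∈ 𝒴, σ Y ≠ s(a, b)
      · obtain ⟨a, ha, b, hb, hab, hnew⟩ := hun
        refine ⟨Function.update σ X s(a, b), ?_, ?_⟩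
        · intro Y hY Z hZ hYZ
          rw [Finset.mem_coe, mem_insert] at hY hZ
          by_cases hYX : Y = X <;> by_cases hZX : Z = X
          · rw [hYX, hZX]
          · subst hYX
            rw [Function.update_self, Function.update_of_ne hZX] at hYZ
            exact (hnew Z (hZ.resolve_left hZX) hYZ.symm).elim
          · subst hZX
            rw [Function.update_self, Function.update_of_ne hYX] at hYZ
            exact (hnew Y (hY.resolve_left hYX) hYZ).elim
          · rw [Function.update_of_ne hZX, Function.update_of_ne hYX] at hYZ
            exact hσ.1 (hY.resolve_left hYX) (hZ.resolve_left hZX) hYZ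
        · intro Y hY a' b' hab'
          by_cases hYX : Y = X
          · subst hYX
            rw [Function.update_self] at hab'
            rcases Sym2.eq_iff.1 hab' with ⟨rfl, rfl⟩ | ⟨rfl, rfl⟩
            · exact ⟨hab, ha, hb⟩
            · exact ⟨hab.symm, hb, ha⟩
          · rw [Function.update_of_ne hYX] at hab'
            exact hσ.2 Y ((mem_insert.1 hY).resolve_left hYX) a' b' hab'
      · exfalso
        push Not at hun
        obtain ⟨lab, hL, hlab⟩ := hσ.lsub (K := K) (R := R) inter_subset_right
          (fun Y hY Z hZ => hdisj Y (mem_insert_of_mem hY) Z (mem_insert_of_mem hZ))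
          (fun Y hY => hE Y (mem_insert_of_mem hY)) (fun Y hY => hlink Y (mem_insert_of_mem hY))
        have htop : pairGraph 𝒴 σ K = ⊤ := by
          ext a b
          simp only [SimpleGraph.top_adj]
          refine ⟨fun h => h.1, fun h => ⟨h, ?_⟩⟩
          obtain ⟨Y, hY, h1⟩ := hun a a.2 b b.2 (fun h' => h (Subtype.ext h'))
          exact ⟨Y, hY, h1⟩
        rw [htop] at hL hlab
        exact hBS (hL.bs_of_top hh hR hlab (by
          rw [Fintype.card_coe]; exact hm X (mem_insert_self _ _)))
  obtain ⟨σ, hσ⟩ := hex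
  obtain ⟨lab, hL, hlab⟩ := hσ.lsub (K := E) (R := R) subset_rfl hdisj hE hlink
  obtain ⟨ℓ, hℓ, F', hS', he⟩ := hL.popular hR hlab
  have hF' : e2 F' univ < (h * (Nat.log 2 (Fintype.card E) + 3)) ^ 52 * Fintype.card E := by
    by_contra hcon
    exact hBS (BS.comp hℓ hS' (BS.of_avg F' hh (not_lt.1 hcon)))
  have hcount : #𝒳 ≤ e2 (pairGraph 𝒳 σ E) univ := by
    have hpair : ∀ X ∈ 𝒳, ∃ p : E × E, σ X = s((p.1 : V), (p.2 : V)) ∧ p.1 ≠ p.2 := by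
      intro X hX
      obtain ⟨a, b, hab⟩ : ∃ a b, σ X = s(a, b) := by
        induction σ X using Sym2.ind with
        | _ a b => exact ⟨a, b, rfl⟩
      obtain ⟨h1, h2, h3⟩ := hσ.2 X hX a b hab
      exact ⟨(⟨a, (mem_inter.1 h2).2⟩, ⟨b, (mem_inter.1 h3).2⟩), hab,
        fun h => h1 (congrArg Subtype.val h)⟩
    choose! pr hpr hpr' using hpair
    refine card_le_card_of_injOn pr ?_ ?_
    · intro X hX
      simp only [Finset.mem_coe, mem_filter, mem_product, mem_univ, true_and]
      exact ⟨hpr' X hX, X, hX, hpr X hX⟩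
    · intro X hX Y hY hXY
      refine hσ.1 hX hY ?_
      rw [hpr X hX, hpr Y hY, hXY]
  have hEV : Fintype.card E ≤ Fintype.card V := Fintype.card_subtype_le _
  calc #𝒳 ≤ R * e2 F' univ := hcount.trans he
    _ ≤ R * ((h * (Nat.log 2 (Fintype.card E) + 3)) ^ 52 * Fintype.card E) :=
        Nat.mul_le_mul_left _ hF'.le
    _ ≤ R * ((h * (Nat.log 2 (Fintype.card V) + 3)) ^ 52 * #E) := by
        rw [Fintype.card_coe] at hEV ⊢
        gcongr
    _ = _ := by ring

end
end
section
open scoped Classical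
section
variable {V : Type*} [Fintype V] {G : SimpleGraph V}

/-- Every vertex of `X` is reached from `c` by a walk of length at most `i` inside `X`. -/
def Rad (G : SimpleGraph V) (i : ℕ) (c : V) (X : Finset V) : Prop :=
  ∀ x ∈ X, ∃ j ≤ i, ∃ f : ℕ → V, IsW G f j ∧ f 0 = c ∧ f j = x ∧ ∀ t ≤ j, f t ∈ X

lemma Rad.step {i : ℕ} {c a : V} {X : Finset V} (hX : Rad G i c X) (ha : a ∈ nb G X) :
    ∃ j ≤ i, ∃ f : ℕ → V, IsW G f (j + 1) ∧ f 0 = c ∧ f (j + 1) = a ∧ ∀ t ≤ j, f t ∈ X := by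
  obtain ⟨-, x, hx, hxa⟩ : a ∉ X ∧ ∃ x ∈ X, G.Adj x a := by simpa using ha
  obtain ⟨j, hj, f, hf, h0, h1, h2⟩ := hX x hx
  have hg := hf.glue (isW_edge hxa) (by simpa using h1)
  refine ⟨j, hj, _, hg, by simpa using h0, by simp, ?_⟩
  intro t ht
  simpa [ht] using h2 t ht

lemma Rad.linking {i : ℕ} {c : V} {X : Finset V} (hX : Rad G i c X) :
    Linking G (2 * i + 2) X := by
  intro a ha b hb hab
  obtain ⟨j, hj, f, hf, hf0, hf1, hf2⟩ := hX.step ha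
  obtain ⟨j', hj', f', hf', hf0', hf1', hf2'⟩ := hX.step hb
  have hw := hf.reverse.glue hf' (by simp [hf0, hf0'])
  set w : ℕ → V := fun t => if t ≤ j + 1 then f (j + 1 - t) else f' (t - (j + 1)) with hwdef
  have hw0 : w 0 = a := by simp [hwdef, hf1]
  have hw1 : w (j + 1 + (j' + 1)) = b := by
    simp [hwdef, hf1']
  obtain ⟨ℓ, hℓ, hℓ1, hL⟩ := Lk.of_walk hw (by rw [hw0, hw1]; exact hab)
  rw [hw0, hw1] at hL
  refine ⟨ℓ, hℓ1, by omega, hL.mono ?_⟩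
  rintro x ⟨⟨t, ht, rfl⟩, hxa, hxb⟩
  by_cases ht1 : t ≤ j + 1
  · have ht0 : t ≠ 0 := by
      rintro rfl; exact hxa hw0
    have : w t = f (j + 1 - t) := by simp [hwdef, ht1]
    rw [this]
    exact hf2 _ (by omega)
  · have hte : t ≠ j + 1 + (j' + 1) := by
      rintro rfl; exact hxb hw1
    have : w t = f' (t - (j + 1)) := by simp [hwdef, ht1]
    rw [this]
    exact hf2' _ (by omega)

/-- The factor in the closure bound. -/
def lam (V : Type*) [Fintype V] (h : ℕ) : ℕ := (h * (Nat.log 2 (Fintype.card V) + 3)) ^ 52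

/-- A closure of `E` outside of which small sets of radius `i` send few edges to `E`. -/
lemma exists_closure {h : ℕ} (hh : 1 ≤ h) (hBS : ¬ BS G h) (S i : ℕ) (E : Finset V) :
    ∃ E' : Finset V, E ⊆ E' ∧ #E' ≤ #E * (1 + S * ((2 * i + 2) * lam V h)) ∧
      ∀ X c, Rad G i c X → #X ≤ S → Disjoint X E' →
        #(nb G X ∩ E) < 68 * (2 * i + 2) ^ 2 * h ^ 4 := by
  let good : Finset (Finset V) → Prop := fun 𝒳 =>
    (∀ X ∈ 𝒳, ∀ Y ∈ 𝒳, X ≠ Y → Disjoint X Y) ∧ ∀ X ∈ 𝒳, Disjoint X E ∧ #X ≤ S ∧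
      Linking G (2 * i + 2) X ∧ 68 * (2 * i + 2) ^ 2 * h ^ 4 ≤ #(nb G X ∩ E)
  obtain ⟨𝒳, h𝒳, hmax⟩ := Finset.exists_max_image (univ.filter good) card
    ⟨∅, by simp [good]⟩
  simp only [mem_filter, mem_univ, true_and] at h𝒳 hmax
  have hcard := card_linking_le (G := G) hh (R := 2 * i + 2) (by omega) hBS (E := E) 𝒳 h𝒳.1
    (fun X hX => (h𝒳.2 X hX).1) (fun X hX => (h𝒳.2 X hX).2.2.1) (fun X hX => (h𝒳.2 X hX).2.2.2)
  refine ⟨E ∪ 𝒳.biUnion id, subset_union_left, ?_, ?_⟩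
  · calc #(E ∪ 𝒳.biUnion id) ≤ #E + #(𝒳.biUnion id) := card_union_le _ _
      _ ≤ #E + #𝒳 * S := Nat.add_le_add_left
          (card_biUnion_le_card_mul _ _ _ fun X hX => (h𝒳.2 X hX).2.1) _
      _ ≤ #E + (2 * i + 2) * lam V h * #E * S :=
          Nat.add_le_add_left (Nat.mul_le_mul_right _ hcard) _
      _ = _ := by ring
  · intro X c hX hS hd
    by_contra hcon
    rw [not_lt] at hcon
    rw [disjoint_union_right] at hd
    have hpos : 0 < #(nb G X ∩ E) := lt_of_lt_of_le (by positivity) hcon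
    have hXne : X.Nonempty := by
      rw [nonempty_iff_ne_empty]
      rintro rfl
      obtain ⟨x, hx⟩ := card_pos.1 hpos
      simp at hx
    have hdX : ∀ Y ∈ 𝒳, Disjoint X Y := fun Y hY => by
      have := (disjoint_biUnion_right _ _ _).1 hd.2 Y hY
      simpa using this
    have hXn : X ∉ 𝒳 := fun hX' => by
      have := hdX X hX'
      rw [disjoint_self] at this
      exact hXne.ne_empty this
    have := hmax (insert X 𝒳) ⟨?_, ?_⟩
    · rw [card_insert_of_notMem hXn] at this
      omega
    · intro Y hY Z hZ hYZ
      rcases mem_insert.1 hY with rfl | hY' <;> rcases mem_insert.1 hZ with rfl | hZ'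
      · exact (hYZ rfl).elim
      · exact hdX Z hZ'
      · exact (hdX Y hY').symm
      · exact h𝒳.1 Y hY' Z hZ' hYZ
    · intro Y hY
      rcases mem_insert.1 hY with rfl | hY
      · exact ⟨hd.1, hS, hX.linking, hcon⟩
      · exact h𝒳.2 Y hY

/-- Iterated closures, with radii decreasing from `J - 1` to `0`. -/
lemma exists_closure_chain {h : ℕ} (hh : 1 ≤ h) (hBS : ¬ BS G h) (S J : ℕ) (E : Finset V) :
    ∃ E' : ℕ → Finset V, E' 0 = E ∧ Monotone E' ∧
      (∀ j, #(E' j) ≤ #E * (1 + S * ((2 * J + 2) * lam V h)) ^ j) ∧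
      ∀ j, ∀ i, i + j + 1 = J → ∀ X c, Rad G i c X → #X ≤ S → Disjoint X (E' (j + 1)) →
        #(nb G X ∩ E' j) < 68 * (2 * i + 2) ^ 2 * h ^ 4 := by
  choose cl hcl1 hcl2 hcl3 using fun i E => exists_closure hh hBS S i E
  let E' : ℕ → Finset V := fun j => Nat.rec E (fun j F => cl (J - 1 - j) F) j
  have hs : ∀ j, E' (j + 1) = cl (J - 1 - j) (E' j) := fun j => rfl
  refine ⟨E', rfl, monotone_nat_of_le_succ fun j => ?_, fun j => ?_, ?_⟩
  · rw [hs]; exact hcl1 _ _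
  · induction j with
    | zero => simp [E']
    | succ j ih =>
      rw [hs]
      refine (hcl2 _ _).trans ?_
      rw [pow_succ]
      refine le_of_le_of_eq (Nat.mul_le_mul ih (Nat.add_le_add_left (Nat.mul_le_mul_left _
        (Nat.mul_le_mul_right _ (show 2 * (J - 1 - j) + 2 ≤ 2 * J + 2 by omega))) _)) ?_
      rw [mul_assoc]
  · intro j i hij X c hX hS hd
    obtain rfl : i = J - 1 - j := by omega
    rw [hs] at hd
    exact hcl3 _ _ X c hX hS hd

/-- At most `cap` neighbours of a vertex. -/
noncomputable def capN (G : SimpleGraph V) (cap : ℕ) (v : V) : Finset V :=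
  if h : cap ≤ #(nbr G v) then (exists_subset_card_eq h).choose else nbr G v

lemma capN_subset (cap : ℕ) (v : V) : capN G cap v ⊆ nbr G v := by
  unfold capN
  split_ifs with h
  · exact (exists_subset_card_eq h).choose_spec.1
  · exact subset_rfl

lemma card_capN_le (cap : ℕ) (v : V) : #(capN G cap v) ≤ cap := by
  unfold capN
  split_ifs with h
  · exact (exists_subset_card_eq h).choose_spec.2.le
  · omega

lemma card_capN (cap : ℕ) (v : V) : #(capN G cap v) = cap ∨ capN G cap v = nbr G v := by
  unfold capN
  split_ifs with h
  · exact Or.inl (exists_subset_card_eq h).choose_spec.2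
  · exact Or.inr rfl

lemma capN_sdiff_subset (cap : ℕ) (X : Finset V) : X.biUnion (capN G cap) \ X ⊆ nb G X := by
  intro y hy
  rw [mem_sdiff, mem_biUnion] at hy
  obtain ⟨⟨x, hx, hxy⟩, hyX⟩ := hy
  have := capN_subset _ _ hxy
  rw [mem_nbr] at this
  rw [mem_nb]
  exact ⟨hyX, x, hx, this⟩

lemma le_card_capN_sdiff {a cap : ℕ} {X : Finset V} (h1 : a ≤ #(nb G X)) (h2 : a + #X ≤ cap) :
    a ≤ #(X.biUnion (capN G cap) \ X) := by
  by_cases h : ∃ v ∈ X, #(capN G cap v) = cap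
  · obtain ⟨v, hv, hc⟩ := h
    calc a ≤ #(capN G cap v) - #X := by omega
      _ ≤ #(capN G cap v \ X) := le_card_sdiff _ _
      _ ≤ _ := card_le_card (sdiff_subset_sdiff (subset_biUnion_of_mem _ hv) subset_rfl)
  · push Not at h
    refine h1.trans (card_le_card ?_)
    intro y hy
    rw [mem_nb] at hy
    obtain ⟨hyX, x, hx, hxy⟩ := hy
    rw [mem_sdiff, mem_biUnion]
    refine ⟨⟨x, hx, ?_⟩, hyX⟩
    rw [(card_capN cap x).resolve_left (h x hx), mem_nbr]
    exact hxy

/-- Capped growth from `c` inside `al`, avoiding `P`. -/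
noncomputable def grow (G : SimpleGraph V) (cap : ℕ → ℕ) (al : ℕ → Finset V) (P : Finset V)
    (c : V) : ℕ → Finset V
  | 0 => {c}
  | i + 1 => grow G cap al P c i ∪
      (((grow G cap al P c i).biUnion (capN G (cap i)) ∩ al (i + 1)) \ P)

variable {cap : ℕ → ℕ} {al : ℕ → Finset V} {P : Finset V} {c : V}

lemma grow_mono : Monotone (grow G cap al P c) :=
  monotone_nat_of_le_succ fun i => by rw [grow]; exact subset_union_left

lemma mem_grow_self (i : ℕ) : c ∈ grow G cap al P c i :=
  grow_mono (Nat.zero_le i) (by simp [grow])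

lemma grow_subset (i : ℕ) : grow G cap al P c i ⊆ grow G cap al ∅ c i := by
  induction i with
  | zero => simp [grow]
  | succ i ih =>
    rw [grow, grow, sdiff_empty]
    exact union_subset_union ih (sdiff_subset.trans
      (inter_subset_inter (biUnion_subset_biUnion_of_subset_left _ ih) subset_rfl))

lemma card_grow_le {q : ℕ} (i : ℕ) (hq : ∀ j < i, cap j ≤ q) :
    #(grow G cap al P c i) ≤ (q + 1) ^ i := by
  induction i with
  | zero => simp [grow]
  | succ i ih =>
    have ih' := ih (fun j hj => hq j (by omega))
    rw [grow]
    calc _ ≤ #(grow G cap al P c i) + #((grow G cap al P c i).biUnion (capN G (cap i))) :=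
          (card_union_le _ _).trans (Nat.add_le_add_left
            (card_le_card (sdiff_subset.trans inter_subset_left)) _)
      _ ≤ #(grow G cap al P c i) + #(grow G cap al P c i) * q := Nat.add_le_add_left
          (card_biUnion_le_card_mul _ _ _ fun v _ =>
            (card_capN_le _ v).trans (hq i (by omega))) _
      _ = #(grow G cap al P c i) * (q + 1) := by ring
      _ ≤ (q + 1) ^ i * (q + 1) := Nat.mul_le_mul_right _ ih'
      _ = _ := (pow_succ _ _).symm

lemma grow_subset_al (hal : Monotone al) (hc : c ∈ al 0) (i : ℕ) :
    grow G cap al P c i ⊆ al i := by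
  induction i with
  | zero => simpa [grow] using hc
  | succ i ih =>
    rw [grow]
    exact union_subset (ih.trans (hal (Nat.le_succ i))) (sdiff_subset.trans inter_subset_right)

lemma grow_disjoint (hc : c ∉ P) (i : ℕ) : Disjoint (grow G cap al P c i) P := by
  induction i with
  | zero => simpa [grow] using hc
  | succ i ih =>
    rw [grow, disjoint_union_left]
    exact ⟨ih, sdiff_disjoint⟩

lemma grow_rad (i : ℕ) : Rad G i c (grow G cap al P c i) := by
  induction i with
  | zero =>
    intro x hx
    have hx : x = c := by simpa [grow] using hx
    subst hx
    exact ⟨0, le_rfl, fun _ => x, by intro i hi; omega, rfl, rfl, fun t _ => mem_grow_self 0⟩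
  | succ i ih =>
    have hsub := grow_mono (G := G) (cap := cap) (al := al) (P := P) (c := c) (Nat.le_succ i)
    intro x hx
    by_cases hxi : x ∈ grow G cap al P c i
    · obtain ⟨j, hj, f, h1, h2, h3, h4⟩ := ih x hxi
      exact ⟨j, by omega, f, h1, h2, h3, fun t ht => hsub (h4 t ht)⟩
    · have hx' := hx
      rw [grow, mem_union] at hx'
      have h1 := hx'.resolve_left hxi
      have h2 := (mem_inter.1 (mem_sdiff.1 h1).1).1
      obtain ⟨j, hj, f, h1, h2, h3, h4⟩ := ih.step (capN_sdiff_subset _ _ (mem_sdiff.2 ⟨h2, hxi⟩))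
      refine ⟨j + 1, by omega, f, h1, h2, h3, fun t ht => ?_⟩
      rcases Nat.lt_or_ge t (j + 1) with ht' | ht'
      · exact hsub (h4 t (by omega))
      · obtain rfl : t = j + 1 := by omega
        rw [h3]; exact hx

/-- One step of the growth loses only the neighbours that are not allowed or lie in `P`. -/
lemma card_grow_succ {a m : ℕ} (i : ℕ)
    (h1 : a + m ≤ #(nb G (grow G cap al P c i))) (h2 : a + m + #(grow G cap al P c i) ≤ cap i)
    (hm : #(nb G (grow G cap al P c i) \ al (i + 1)) +
      #((nb G (grow G cap al P c i) ∩ grow G cap al ∅ c (i + 1)) ∩ P) ≤ m) :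
    #(grow G cap al P c i) + a ≤ #(grow G cap al P c (i + 1)) := by
  set X := grow G cap al P c i with hX
  have h3 := le_card_capN_sdiff h1 h2
  set Nn := X.biUnion (capN G (cap i)) \ X with hN
  have hNnb : Nn ⊆ nb G X := capN_sdiff_subset _ _
  have hsub : Nn ⊆ ((nb G X \ al (i + 1)) ∪ ((nb G X ∩ grow G cap al ∅ c (i + 1)) ∩ P)) ∪
      ((X.biUnion (capN G (cap i)) ∩ al (i + 1)) \ P) \ X := by
    intro y hy
    have hynb := hNnb hy
    rw [hN, mem_sdiff] at hy
    by_cases hyal : y ∈ al (i + 1)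
    · by_cases hyP : y ∈ P
      · refine mem_union_left _ (mem_union_right _ (mem_inter.2 ⟨mem_inter.2 ⟨hynb, ?_⟩, hyP⟩))
        rw [grow, sdiff_empty]
        exact mem_union_right _ (mem_inter.2
          ⟨biUnion_subset_biUnion_of_subset_left _ (grow_subset i) hy.1, hyal⟩)
      · exact mem_union_right _ (mem_sdiff.2
          ⟨mem_sdiff.2 ⟨mem_inter.2 ⟨hy.1, hyal⟩, hyP⟩, hy.2⟩)
    · exact mem_union_left _ (mem_union_left _ (mem_sdiff.2 ⟨hynb, hyal⟩))
  have h4 := card_le_card hsub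
  have h5 := (card_union_le ((nb G X \ al (i + 1)) ∪
    ((nb G X ∩ grow G cap al ∅ c (i + 1)) ∩ P))
    (((X.biUnion (capN G (cap i)) ∩ al (i + 1)) \ P) \ X))
  have h6 := card_union_le (nb G X \ al (i + 1)) ((nb G X ∩ grow G cap al ∅ c (i + 1)) ∩ P)
  have h7 : #(grow G cap al P c (i + 1)) =
      #X + #(((X.biUnion (capN G (cap i)) ∩ al (i + 1)) \ P) \ X) := by
    rw [grow, ← hX, ← union_sdiff_self_eq_union, card_union_of_disjoint disjoint_sdiff]
  omega

end
end
section
open scoped Classical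

lemma pow_succ_le_two_mul (K m : ℕ) (h : 2 * K ≤ m + 1) : (m + 1) ^ K ≤ 2 * m ^ K := by
  have h1 : (1 : ℝ) + K * (-(1 / (m + 1 : ℝ))) ≤ (1 + -(1 / (m + 1 : ℝ))) ^ K := by
    apply one_add_mul_le_pow
    have : (1 : ℝ) / (m + 1) ≤ 1 := by
      rw [div_le_one (by positivity)]; linarith [Nat.cast_nonneg (α := ℝ) m]
    linarith
  have h2 : (1 : ℝ) + -(1 / (m + 1 : ℝ)) = m / (m + 1) := by field_simp; ring
  have h3 : (1 : ℝ) / 2 ≤ 1 + K * (-(1 / (m + 1 : ℝ))) := by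
    have h' : (2 : ℝ) * K ≤ m + 1 := by exact_mod_cast h
    have : (K : ℝ) * (1 / (m + 1 : ℝ)) ≤ 1 / 2 := by
      rw [mul_one_div, div_le_iff₀ (by positivity)]; linarith
    linarith
  rw [h2, div_pow] at h1
  have h4 := h3.trans h1
  rw [le_div_iff₀ (by positivity)] at h4
  have h5 : ((m : ℝ) + 1) ^ K ≤ 2 * (m : ℝ) ^ K := by linarith
  exact_mod_cast h5

lemma poly_le_two_pow {h K b₀ b : ℕ} (hb₀ : 2 * K ≤ b₀ + 5) (h0 : (h * (b₀ + 4)) ^ K ≤ 2 ^ b₀)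
    (hb : b₀ ≤ b) : (h * (b + 4)) ^ K ≤ 2 ^ b := by
  induction b, hb using Nat.le_induction with
  | base => exact h0
  | succ b hb ih =>
    calc (h * (b + 1 + 4)) ^ K = h ^ K * (b + 4 + 1) ^ K := by rw [mul_pow]
      _ ≤ h ^ K * (2 * (b + 4) ^ K) :=
          Nat.mul_le_mul_left _ (pow_succ_le_two_mul K (b + 4) (by omega))
      _ = 2 * (h * (b + 4)) ^ K := by rw [mul_pow]; ring
      _ ≤ 2 * 2 ^ b := Nat.mul_le_mul_left _ ih
      _ = _ := by ring

/-- The number of rounds after which a growing set has at least `2 ^ b` elements. -/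
def clk (b : ℕ) : ℕ := 1 + ∑ j ∈ range b, 16 * (j + 3) ^ 2

lemma clk_succ (b : ℕ) : clk (b + 1) = clk b + 16 * (b + 3) ^ 2 := by
  simp [clk, sum_range_succ, add_assoc]

lemma clk_mono : Monotone clk := monotone_nat_of_le_succ fun b => by rw [clk_succ]; omega

lemma one_le_clk (b : ℕ) : 1 ≤ clk b := by simp [clk]

lemma clk_le (b : ℕ) : clk b ≤ 16 * (b + 3) ^ 3 := by
  induction b with
  | zero => simp [clk]
  | succ b ih =>
    rw [clk_succ]
    have : 16 * (b + 1 + 3) ^ 3 = 16 * (b + 3) ^ 3 + 16 * (b + 3) ^ 2 +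
      16 * (2 * (b + 3) ^ 2 + 3 * (b + 3) + 1) := by ring
    omega

section
variable {V : Type*} [Fintype V] {G : SimpleGraph V}

/-- `P` meets the neighbourhood within `I` of any set of radius `i` around `c` in at most
`p * (i + 1)` vertices. -/
def LossOK (G : SimpleGraph V) (p : ℕ) (c : V) (I P : Finset V) : Prop :=
  ∀ i X, X ⊆ I → c ∈ X → Disjoint X P → Rad G i c X → #((nb G X ∩ I) ∩ P) ≤ p * (i + 1)

lemma LossOK.of_disjoint {p : ℕ} {c : V} {I P : Finset V} (h : Disjoint I P) :
    LossOK G p c I P := by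
  intro i X _ _ _ _
  have : (nb G X ∩ I) ∩ P = ∅ := by
    rw [inter_assoc, disjoint_iff_inter_eq_empty.1 h, inter_empty]
  simp [this]

lemma loss_bound {h p b i : ℕ} (hh : 1 ≤ h) (hp : p ≤ h ^ 4) (hi : i + 1 ≤ 16 * (b + 4) ^ 3) :
    (68 * (2 * i + 2) ^ 2 * h ^ 4 + p * (i + 1)) * (16 * (b + 3) ^ 2) * 2 ≤
      (h * (b + 4)) ^ 20 := by
  have h1 : 68 * (2 * i + 2) ^ 2 * h ^ 4 + p * (i + 1) ≤ 273 * (16 * (b + 4) ^ 3) ^ 2 * h ^ 4 := by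
    have e : 68 * (2 * i + 2) ^ 2 * h ^ 4 = 272 * (i + 1) ^ 2 * h ^ 4 := by ring
    have e1 : (i + 1) ≤ (i + 1) ^ 2 := Nat.le_self_pow (by norm_num) _
    have e2 : (i + 1) ^ 2 ≤ (16 * (b + 4) ^ 3) ^ 2 := Nat.pow_le_pow_left hi 2
    calc _ ≤ 272 * (i + 1) ^ 2 * h ^ 4 + h ^ 4 * (i + 1) ^ 2 := by
          rw [e]; exact Nat.add_le_add_left (Nat.mul_le_mul hp e1) _
      _ = 273 * (i + 1) ^ 2 * h ^ 4 := by ring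
      _ ≤ _ := by gcongr
  calc _ ≤ (273 * (16 * (b + 4) ^ 3) ^ 2 * h ^ 4) * (16 * (b + 4) ^ 2) * 2 := by
        gcongr; omega
    _ = 2236416 * (b + 4) ^ 8 * h ^ 4 := by ring
    _ ≤ (b + 4) ^ 12 * (b + 4) ^ 8 * h ^ 20 := by
        have : 4 ^ 12 ≤ (b + 4) ^ 12 := Nat.pow_le_pow_left (by omega) _
        have h2 : h ^ 4 ≤ h ^ 20 := Nat.pow_le_pow_right hh (by norm_num)
        refine Nat.mul_le_mul (Nat.mul_le_mul_right _ (le_trans (by norm_num) this)) h2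
    _ = _ := by rw [mul_pow]; ring

theorem exists_cell {d h p w b₀ y y₂ : ℕ} (hG : Expander G d) (hh : 1 ≤ h) (hBS : ¬ BS G h)
    (hp : p ≤ h ^ 4) (hw : w ^ 2 ≤ 2 ^ y) (hb₀ : 80 ≤ b₀) (hpoly : (h * (b₀ + 4)) ^ 40 ≤ 2 ^ b₀)
    (hd : 2 ^ (b₀ + 1) ≤ d) (hb₀y : b₀ ≤ y) (hyy₂ : y ≤ y₂) (hn : 2 ^ (y₂ + 1) ≤ Fintype.card V)
    (E : Finset V)
    (hE : #E * (1 + 2 ^ y₂ * ((2 * clk y₂ + 2) * lam V h)) ^ clk y₂ < Fintype.card V) :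
    ∃ c : V, ∃ I O : Finset V, c ∈ I ∧ I ⊆ O ∧ Disjoint O E ∧
      #O ≤ (2 ^ (y₂ + 1) + 1) ^ clk y₂ ∧ #I ≤ (2 ^ (y + 1) + 1) ^ clk y ∧ Rad G (clk y) c I ∧
      ∀ P : Finset V, c ∉ P → #P ≤ w → LossOK G p c I P →
        ∃ X ⊆ O, Disjoint X P ∧ 2 ^ y₂ ≤ #X ∧ Rad G (clk y₂) c X := by
  obtain ⟨E', hE0, hEm, hEc, hEl⟩ := exists_closure_chain (G := G) hh hBS (2 ^ y₂) (clk y₂) E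
  set J := clk y₂ with hJ
  set J₁ := clk y with hJ₁
  have hJJ : J₁ ≤ J := clk_mono hyy₂
  obtain ⟨c, hc⟩ : ∃ c, c ∉ E' J := by
    by_contra hcon
    push Not at hcon
    have h1 : E' J = univ := eq_univ_of_forall hcon
    have h2 := hEc J
    rw [h1, card_univ] at h2
    omega
  let cap : ℕ → ℕ := fun i => if i < J₁ then 2 ^ (y + 1) else 2 ^ (y₂ + 1)
  let al : ℕ → Finset V := fun i => univ \ E' (J - i)
  have hal : Monotone al := fun i j hij => sdiff_subset_sdiff subset_rfl (hEm (by omega))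
  have hcal : c ∈ al 0 := by simpa [al] using hc
  have h40 : ∀ b, b₀ ≤ b → (h * (b + 4)) ^ 40 ≤ 2 ^ b := fun b hb =>
    poly_le_two_pow (by omega) hpoly hb
  have h20 : ∀ b, b₀ ≤ b → (h * (b + 4)) ^ 20 ≤ 2 ^ b := fun b hb =>
    (Nat.pow_le_pow_right (by positivity) (by norm_num)).trans (h40 b hb)
  refine ⟨c, grow G cap al ∅ c J₁, grow G cap al ∅ c J, mem_grow_self _, grow_mono hJJ, ?_, ?_, ?_,
    grow_rad _, ?_⟩
  · have := grow_subset_al (G := G) (cap := cap) (P := ∅) hal hcal J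
    rw [Finset.disjoint_left]
    intro x hx hxE
    have := this hx
    simp only [al, Nat.sub_self, hE0, mem_sdiff] at this
    exact this.2 hxE
  · refine card_grow_le _ fun j _ => ?_
    simp only [cap]
    split_ifs
    · exact Nat.pow_le_pow_right (by norm_num) (by omega)
    · exact le_rfl
  · exact card_grow_le _ fun j hj => by simp [cap, hj]
  · intro P hcP hPw hloss
    refine ⟨grow G cap al P c J, grow_subset _, grow_disjoint hcP _, ?_, grow_rad _⟩
    set X : ℕ → Finset V := grow G cap al P c with hX
    have hXc : ∀ i, c ∈ X i := fun i => mem_grow_self i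
    have hout : ∀ i < J, #(X i) ≤ 2 ^ y₂ →
        #(nb G (X i) \ al (i + 1)) ≤ 68 * (2 * i + 2) ^ 2 * h ^ 4 := by
      intro i hi hXi
      have h1 := grow_subset_al (G := G) (cap := cap) (P := P) hal hcal i
      have h2 := hEl (J - (i + 1)) i (by omega) (X i) c (grow_rad _) hXi (by
        rw [show J - (i + 1) + 1 = J - i by omega, Finset.disjoint_left]
        intro x hx hxE
        have := h1 hx
        simp only [al, mem_sdiff] at this
        exact this.2 hxE)
      refine le_trans (card_le_card ?_) h2.le
      intro x hx
      simp only [al, mem_sdiff, mem_univ, true_and, not_not] at hx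
      exact mem_inter.2 hx
    have hin : ∀ i < J₁, #((nb G (X i) ∩ grow G cap al ∅ c (i + 1)) ∩ P) ≤ p * (i + 1) := by
      intro i hi
      refine le_trans (card_le_card ?_) (hloss i (X i)
        ((grow_subset i).trans (grow_mono hi.le)) (hXc i) (grow_disjoint hcP i) (grow_rad i))
      exact inter_subset_inter (inter_subset_inter subset_rfl (grow_mono hi)) subset_rfl
    refine dyadic_growth (a := fun i => #(X i)) (Gr := fun b => 16 * (b + 3) ^ 2) (T := clk)
      (b₀ := b₀) (fun i j hij => card_le_card (grow_mono hij)) ?_ clk_succ ?_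
      (by omega) ?_
    · intro b; positivity
    · refine le_trans ?_ (card_le_card (grow_mono (one_le_clk b₀)))
      have h0 : X 0 = {c} := rfl
      have hJ1 : 0 < J₁ := one_le_clk y
      have hcap0 : cap 0 = 2 ^ (y + 1) := by simp [cap, hJ1]
      have hL := loss_bound (b := b₀) (i := 0) hh hp (by
        have : 1 ≤ (b₀ + 4) ^ 3 := Nat.one_le_pow _ _ (by omega)
        omega)
      set L := 68 * (2 * 0 + 2) ^ 2 * h ^ 4 + p * (0 + 1) with hLdef
      have hL' : L ≤ 2 ^ b₀ := by
        refine le_trans ?_ (hL.trans (h20 b₀ le_rfl))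
        rw [mul_assoc]
        exact Nat.le_mul_of_pos_right _ (by positivity)
      have hX0 : #(X 0) = 1 := by rw [h0, card_singleton]
      have hdeg : d ≤ #(nb G (X 0)) := by
        refine (hG.deg_le c).trans (card_le_card ?_)
        intro v hv
        rw [mem_nbr] at hv
        rw [h0, mem_nb]
        exact ⟨by simpa using hv.ne', c, by simp, hv⟩
      have hpow : 2 ^ (b₀ + 1) = 2 * 2 ^ b₀ := by ring
      have hpos : 0 < 2 ^ b₀ := by positivity
      have hpow' : 2 ^ (b₀ + 1) ≤ 2 ^ (y + 1) := Nat.pow_le_pow_right (by norm_num) (by omega)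
      have h1 := card_grow_succ (G := G) (cap := cap) (al := al) (P := P) (c := c)
        (a := 2 ^ (b₀ + 1) - 1 - L) (m := L) 0
        (by rw [← hX]; omega) (by rw [← hX, hX0, hcap0]; omega)
        (by
          have e1 := hout 0 (by omega) (by rw [hX0]; exact Nat.one_le_two_pow)
          have e2 := hin 0 hJ1
          rw [← hX, hLdef]; exact Nat.add_le_add e1 e2)
      rw [← hX, hX0] at h1
      change 2 ^ b₀ ≤ #(X 1)
      rw [zero_add] at h1
      omega
    · intro b i hb hby hTi hiT hge hlt
      have hbJ : clk (b + 1) ≤ J := clk_mono (by omega)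
      have hi16 : i + 1 ≤ 16 * (b + 4) ^ 3 := by
        have := clk_le (b + 1)
        rw [show b + 1 + 3 = b + 4 by ring] at this
        omega
      have hLb := loss_bound (b := b) (i := i) hh hp hi16
      have hXy : #(X i) ≤ 2 ^ y₂ := hlt.le.trans (Nat.pow_le_pow_right (by norm_num) (by omega))
      have e1 := hout i (by omega) hXy
      obtain ⟨L, hLg, hL⟩ : ∃ L, L * (16 * (b + 3) ^ 2) ≤ 2 ^ b ∧ #(nb G (X i) \ al (i + 1)) +
          #((nb G (X i) ∩ grow G cap al ∅ c (i + 1)) ∩ P) ≤ L := by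
        by_cases hbb : b < y
        · have e2 := hin i (lt_of_lt_of_le hiT (clk_mono hbb))
          refine ⟨_, ?_, Nat.add_le_add e1 e2⟩
          have := h20 b hb
          omega
        · refine ⟨_, ?_, Nat.add_le_add e1 ((card_le_card inter_subset_right).trans hPw)⟩
          have f1 : 68 * (2 * i + 2) ^ 2 * h ^ 4 * (16 * (b + 3) ^ 2) * 2 ≤ 2 ^ b := by
            refine le_trans ?_ (hLb.trans (h20 b hb))
            gcongr
            omega
          have f2 : w * (16 * (b + 3) ^ 2) * 2 ≤ 2 ^ b := by
            rw [← Nat.pow_le_pow_iff_left (n := 2) (by norm_num)]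
            have g1 : w ^ 2 ≤ 2 ^ b := hw.trans (Nat.pow_le_pow_right (by norm_num) (by omega))
            have g2 : (16 * (b + 3) ^ 2 * 2) ^ 2 ≤ (h * (b + 4)) ^ 40 := by
              calc (16 * (b + 3) ^ 2 * 2) ^ 2 = 4 ^ 5 * (b + 3) ^ 4 := by ring
                _ ≤ (b + 4) ^ 5 * (b + 4) ^ 4 := by gcongr <;> omega
                _ = (b + 4) ^ 9 := by ring
                _ ≤ (h * (b + 4)) ^ 9 := by gcongr; exact Nat.le_mul_of_pos_left _ hh
                _ ≤ (h * (b + 4)) ^ 40 := Nat.pow_le_pow_right (by positivity) (by norm_num)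
            calc (w * (16 * (b + 3) ^ 2) * 2) ^ 2 = w ^ 2 * (16 * (b + 3) ^ 2 * 2) ^ 2 := by ring
              _ ≤ 2 ^ b * 2 ^ b := Nat.mul_le_mul g1 (g2.trans (h40 b hb))
              _ = _ := by ring
          rw [add_mul]
          omega
      have hlog : Nat.log 2 #(X i) = b :=
        Nat.log_eq_of_pow_le_of_lt_pow hge hlt
      have hexp := hG.expand (X := X i) ⟨c, hXc i⟩ (by
        have : 2 ^ (b + 1) ≤ 2 ^ y₂ := Nat.pow_le_pow_right (by norm_num) (by omega)
        rw [pow_succ] at hn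
        omega)
      rw [hlog] at hexp
      have hcap : 2 ^ b + #(X i) ≤ cap i := by
        have h4 : 2 ^ b + #(X i) ≤ 2 ^ (b + 2) := by
          have : 2 ^ (b + 2) = 4 * 2 ^ b := by ring
          rw [pow_succ] at hlt
          omega
        by_cases hi : i < J₁
        · have hby' : b < y := by
            by_contra hcon
            have := clk_mono (not_lt.1 hcon)
            omega
          simp only [cap, hi, if_true]
          exact h4.trans (Nat.pow_le_pow_right (by norm_num) (by omega))
        · simp only [cap, hi, if_false]
          exact h4.trans (Nat.pow_le_pow_right (by norm_num) (by omega))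
      set g := 8 * (b + 3) ^ 2 with hg
      have hg1 : 1 ≤ g := by
        have : 0 < (b + 3) ^ 2 := by positivity
        omega
      have hgr : 16 * (b + 3) ^ 2 = 2 * g := by rw [hg]; ring
      rw [hgr] at hLg ⊢
      set N := #(nb G (X i)) with hN
      have hLle : L ≤ min N (2 ^ b) := by
        refine le_min ?_ ?_
        · by_contra hcon
          have : g * N ≤ g * L := Nat.mul_le_mul_left _ (by omega)
          have h3 : L * (2 * g) = 2 * (g * L) := by ring
          have : 0 < 2 ^ b := by positivity
          omega
        · exact (Nat.le_mul_of_pos_right L (by omega)).trans hLg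
      have h1 := card_grow_succ (G := G) (cap := cap) (al := al) (P := P) (c := c)
        (a := min N (2 ^ b) - L) (m := L) i (by rw [← hX]; omega) (by rw [← hX]; omega)
        (by rw [← hX]; exact hL)
      rw [← hX] at h1
      have h2 : 2 ^ b + L * (2 * g) ≤ 2 * g * min N (2 ^ b) := by
        rcases le_total N (2 ^ b) with hmin | hmin
        · rw [min_eq_left hmin]
          have : 2 * g * N = 2 * (g * N) := by ring
          omega
        · rw [min_eq_right hmin]
          have : 1 * 2 ^ b ≤ g * 2 ^ b := Nat.mul_le_mul_right _ hg1
          have : 2 * g * 2 ^ b = 2 * (g * 2 ^ b) := by ring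
          omega
      calc 2 ^ b ≤ 2 * g * min N (2 ^ b) - L * (2 * g) := by omega
        _ = 2 * g * (min N (2 ^ b) - L) := by rw [Nat.mul_sub, mul_comm L]
        _ ≤ _ := Nat.mul_le_mul_left _ (by omega)

end
end
section
open scoped Classical
section
variable {V : Type*} [Fintype V] {G : SimpleGraph V}

/-- Disjoint cells with centres `c k` and inner sets `I k`, any two of which can be connected
robustly. -/
structure CellSys (G : SimpleGraph V) {κ : Type*} (p w J R : ℕ) (c : κ → V) (I : κ → Finset V) :
    Prop where
  mem : ∀ k, c k ∈ I k
  disj : ∀ k k', k ≠ k' → Disjoint (I k) (I k')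
  rad : ∀ k, Rad G J (c k) (I k)
  conn : ∀ k k', k ≠ k' → ∀ P : Finset V, c k ∉ P → c k' ∉ P → #P ≤ w →
    LossOK G p (c k) (I k) P → LossOK G p (c k') (I k') P →
    ∃ j ≤ R, ∃ f : ℕ → V, IsW G f j ∧ f 0 = c k ∧ f j = c k' ∧
      ∀ t ≤ j, f t ∉ P ∧ ∀ k'', k'' ≠ k → k'' ≠ k' → f t ∉ I k''

theorem exists_cellSys {κ : Type*} [Fintype κ] {d h p w b₀ y y₂ : ℕ} (hG : Expander G d)
    (hh : 1 ≤ h) (hBS : ¬ BS G h)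
    (hp : p ≤ h ^ 4) (hw : w ^ 2 ≤ 2 ^ y) (hb₀ : 80 ≤ b₀) (hpoly : (h * (b₀ + 4)) ^ 40 ≤ 2 ^ b₀)
    (hd : 2 ^ (b₀ + 1) ≤ d) (hb₀y : b₀ ≤ y) (hyy₂ : y ≤ y₂) (hn : 2 ^ (y₂ + 1) ≤ Fintype.card V)
    (hsize : Fintype.card κ * (2 ^ (y₂ + 1) + 1) ^ clk y₂ *
      (1 + 2 ^ y₂ * ((2 * clk y₂ + 2) * lam V h)) ^ clk y₂ < Fintype.card V)
    (hinner : 2 * gN (Fintype.card V) *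
      (w + Fintype.card κ * (2 ^ (y + 1) + 1) ^ clk y) ≤ 2 ^ y₂) :
    ∃ (c : κ → V) (I : κ → Finset V),
      CellSys G p w (clk y) (2 * clk y₂ + 32 * (Nat.log 2 (Fintype.card V) + 3) ^ 3) c I := by
  have hne : Nonempty V := by
    rw [← Fintype.card_pos_iff]
    exact lt_of_lt_of_le (by positivity) hn
  set B := (2 ^ (y₂ + 1) + 1) ^ clk y₂ with hB
  set q := (1 + 2 ^ y₂ * ((2 * clk y₂ + 2) * lam V h)) ^ clk y₂ with hq
  set M := Fintype.card κ with hM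
  have hcell : ∀ E : Finset V, ∃ c : V, ∃ I O : Finset V, #E ≤ M * B →
      (c ∈ I ∧ I ⊆ O ∧ Disjoint O E ∧
      #O ≤ B ∧ #I ≤ (2 ^ (y + 1) + 1) ^ clk y ∧ Rad G (clk y) c I ∧
      ∀ P : Finset V, c ∉ P → #P ≤ w → LossOK G p c I P →
        ∃ X ⊆ O, Disjoint X P ∧ 2 ^ y₂ ≤ #X ∧ Rad G (clk y₂) c X) := by
    intro E
    by_cases hE : #E ≤ M * B
    · obtain ⟨c, I, O, hc⟩ := exists_cell hG hh hBS hp hw hb₀ hpoly hd hb₀y hyy₂ hn E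
        (lt_of_le_of_lt (Nat.mul_le_mul_right _ hE) hsize)
      exact ⟨c, I, O, fun _ => hc⟩
    · exact ⟨hne.some, ∅, ∅, fun h => (hE h).elim⟩
  choose c I O hcell_spec using hcell
  let Es : ℕ → Finset V := fun k => Nat.rec ∅ (fun _ E => E ∪ O E) k
  have hEs : ∀ k, Es (k + 1) = Es k ∪ O (Es k) := fun k => rfl
  have hEm : Monotone Es := monotone_nat_of_le_succ fun k => by rw [hEs]; exact subset_union_left
  have hEc : ∀ k ≤ M, #(Es k) ≤ k * B := by
    intro k hk
    induction k with
    | zero => simp [Es]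
    | succ k ih =>
      have h1 := ih (by omega)
      rw [hEs]
      have h2 := (hcell_spec (Es k) (h1.trans (Nat.mul_le_mul_right _ (by omega)))).2.2.2.1
      calc _ ≤ #(Es k) + #(O (Es k)) := card_union_le _ _
        _ ≤ k * B + B := Nat.add_le_add h1 h2
        _ = _ := by ring
  let e := Fintype.equivFin κ
  let E' : κ → Finset V := fun k => Es (e k)
  have hgood := fun k : κ => hcell_spec (E' k) ((hEc (e k) (e k).2.le).trans
    (Nat.mul_le_mul_right _ (e k).2.le))
  have hOO : ∀ k k', k ≠ k' → Disjoint (O (E' k)) (O (E' k')) := by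
    have haux : ∀ k k', e k < e k' → Disjoint (O (E' k)) (O (E' k')) := by
      intro k k' hlt
      refine Disjoint.symm ((hgood k').2.2.1.mono_right ?_)
      have : Es (e k + 1) ⊆ Es (e k') := hEm hlt
      rw [hEs] at this
      exact subset_union_right.trans this
    intro k k' hne
    rcases lt_trichotomy (e k) (e k') with h | h | h
    · exact haux k k' h
    · exact (hne (e.injective h)).elim
    · exact (haux k' k h).symm
  refine ⟨fun k => c (E' k), fun k => I (E' k), fun k => (hgood k).1, ?_,
    fun k => (hgood k).2.2.2.2.2.1, ?_⟩
  · intro k k' hne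
    exact (hOO k k' hne).mono (hgood k).2.1 (hgood k').2.1
  · intro k k' hkk P hcP hcP' hPw hl hl'
    obtain ⟨X, hXO, hXP, hXc, hXr⟩ := (hgood k).2.2.2.2.2.2 P hcP hPw hl
    obtain ⟨X', hXO', hXP', hXc', hXr'⟩ := (hgood k').2.2.2.2.2.2 P hcP' hPw hl'
    let W : Finset V := P ∪ (univ.filter fun k'' => k'' ≠ k ∧ k'' ≠ k').biUnion fun k'' => I (E' k'')
    have hWc : #W ≤ w + M * (2 ^ (y + 1) + 1) ^ clk y := by
      refine (card_union_le _ _).trans (Nat.add_le_add hPw ?_)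
      refine (card_biUnion_le_card_mul _ _ _ fun k'' _ => (hgood k'').2.2.2.2.1).trans ?_
      exact Nat.mul_le_mul_right _ (card_le_univ _)
    have hOW : ∀ k'' , k'' ≠ k → k'' ≠ k' → Disjoint (O (E' k)) (I (E' k'')) ∧
        Disjoint (O (E' k')) (I (E' k'')) := fun k'' h1 h2 =>
      ⟨(hOO k k'' h1.symm).mono_right (hgood k'').2.1,
        (hOO k' k'' h2.symm).mono_right (hgood k'').2.1⟩
    have hXW : Disjoint X W := by
      refine disjoint_union_right.2 ⟨hXP, (disjoint_biUnion_right _ _ _).2 fun k'' hk'' => ?_⟩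
      simp only [mem_filter, mem_univ, true_and] at hk''
      exact (hOW k'' hk''.1 hk''.2).1.mono_left hXO
    have hXW' : Disjoint X' W := by
      refine disjoint_union_right.2 ⟨hXP', (disjoint_biUnion_right _ _ _).2 fun k'' hk'' => ?_⟩
      simp only [mem_filter, mem_univ, true_and] at hk''
      exact (hOW k'' hk''.1 hk''.2).2.mono_left hXO'
    have hpos : 0 < 2 ^ y₂ := by positivity
    have hWb : 2 * gN (Fintype.card V) * #W ≤ 2 ^ y₂ :=
      (Nat.mul_le_mul_left _ hWc).trans hinner
    obtain ⟨j, hj, f, hf, hf0, hf1, hfW⟩ := hG.connect (X := X) (Y := X') (W := W)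
      (card_pos.1 (by omega)) (card_pos.1 (by omega)) hXW hXW' (hWb.trans hXc) (hWb.trans hXc')
    obtain ⟨a, ha, g, hg, hg0, hg1, hgX⟩ := hXr _ hf0
    obtain ⟨a', ha', g', hg', hg0', hg1', hgX'⟩ := hXr' _ hf1
    have hw1 := hg.glue hf hg1
    have hw2 := hw1.glue hg'.reverse (by
      by_cases hj0 : j = 0
      · subst hj0; simp [hg1', hg1]
      · simp [hg1', hj0])
    refine ⟨a + j + a', by omega, _, hw2, by simpa using hg0, ?_, ?_⟩
    · by_cases ha0 : a' = 0
      · subst ha0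
        by_cases hj0 : j = 0
        · subst hj0; simp [← hg0', hg1', hg1]
        · simp [hj0, ← hg0', hg1']
      · simp [ha0, hg0']
    · intro t ht
      have hall : ∀ x, x ∉ W → x ∉ P ∧ ∀ k'', k'' ≠ k → k'' ≠ k' → x ∉ I (E' k'') := by
        intro x hx
        rw [mem_union, not_or] at hx
        refine ⟨hx.1, fun k'' h1 h2 h3 => hx.2 ?_⟩
        exact mem_biUnion.2 ⟨k'', by simp [h1, h2], h3⟩
      refine hall _ ?_
      by_cases h1 : t ≤ a + j
      · by_cases h2 : t ≤ a
        · simp only [h1, h2, if_true]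
          exact Finset.disjoint_left.1 hXW (hgX t h2)
        · simp only [h1, h2, if_true, if_false]
          exact hfW _ (by omega)
      · simp only [h1, if_false]
        exact Finset.disjoint_left.1 hXW' (hgX' _ (by omega))

end
end
section
open scoped Classical

/-- A walk of length `ℓ` from `u` to `v` inside `S`. -/
def Wk {V : Type*} (G : SimpleGraph V) (S : Set V) (ℓ : ℕ) (u v : V) : Prop :=
  ∃ f : ℕ → V, IsW G f ℓ ∧ f 0 = u ∧ f ℓ = v ∧ ∀ t ≤ ℓ, f t ∈ S

section
variable {V : Type*} {G : SimpleGraph V} {S S' : Set V} {a b : ℕ} {u v x : V}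

lemma Wk.mono (h : Wk G S a u v) (hS : S ⊆ S') : Wk G S' a u v := by
  obtain ⟨f, h1, h2, h3, h4⟩ := h
  exact ⟨f, h1, h2, h3, fun t ht => hS (h4 t ht)⟩

lemma Wk.symm (h : Wk G S a u v) : Wk G S a v u := by
  obtain ⟨f, h1, h2, h3, h4⟩ := h
  exact ⟨_, h1.reverse, by simpa using h3, by simpa using h2, fun t _ => h4 _ (by omega)⟩

lemma Wk.trans (h : Wk G S a u v) (h' : Wk G S b v x) : Wk G S (a + b) u x := by
  obtain ⟨f, h1, h2, h3, h4⟩ := h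
  obtain ⟨g, g1, g2, g3, g4⟩ := h'
  refine ⟨_, h1.glue g1 (h3.trans g2.symm), by simpa using h2, ?_, fun t ht => ?_⟩
  · by_cases hb : b = 0
    · subst hb; simp [h3, ← g3, g2]
    · simp [hb, g3]
  · by_cases hta : t ≤ a
    · simpa [hta] using h4 t hta
    · simpa [hta] using g4 (t - a) (by omega)

lemma Wk.lk (h : Wk G S a u v) (huv : u ≠ v) :
    ∃ ℓ ≤ a, 1 ≤ ℓ ∧ Lk G (S \ {u, v}) ℓ u v := by
  obtain ⟨f, h1, rfl, rfl, h4⟩ := h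
  obtain ⟨ℓ, h5, h6, h7⟩ := Lk.of_walk h1 huv
  refine ⟨ℓ, h5, h6, h7.mono ?_⟩
  rintro y ⟨⟨t, ht, rfl⟩, hy, hy'⟩
  exact ⟨h4 t ht, by simp [hy, hy']⟩

/-- A sub-walk. -/
lemma IsW.slice {f : ℕ → V} {n i j : ℕ} (hf : IsW G f n) (hij : i ≤ j) (hj : j ≤ n) :
    IsW G (fun t => f (i + t)) (j - i) := by
  intro t ht
  have := hf (i + t) (by omega)
  rwa [show i + t + 1 = i + (t + 1) by ring] at this

end

section
variable {V : Type*} [Fintype V] {G : SimpleGraph V}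

lemma Rad.wk {i : ℕ} {c x : V} {X : Finset V} (h : Rad G i c X) (hx : x ∈ X) :
    ∃ j ≤ i, Wk G (X : Set V) j c x := by
  obtain ⟨j, hj, f, h1, h2, h3, h4⟩ := h x hx
  exact ⟨j, hj, f, h1, h2, h3, h4⟩

/-- `A` is the interior of an arm from the centre of cell `r` to the cell `z`. -/
def IsArm {κ : Type*} (G : SimpleGraph V) (R : ℕ) (c : κ → V) (I : κ → Finset V) (r z : κ)
    (A : Finset V) : Prop :=
  #A ≤ R ∧ c r ∉ A ∧ (∀ k, k ≠ r → Disjoint (I k) A) ∧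
    ∃ ℓ ≤ R, ∃ f : ℕ → V, IsW G f ℓ ∧ f 0 = c r ∧ f ℓ ∈ I z ∧ ∀ t, 0 < t → t < ℓ → f t ∈ A

lemma CellSys.exists_arm {κ : Type*} {p w J R q : ℕ} {c : κ → V} {I : κ → Finset V}
    (hC : CellSys G p w J R c I) {r z : κ} (hrz : r ≠ z) {P : Finset V} (hP : #P ≤ w)
    (hq : q ≤ p) (hrP : c r ∉ P) (hzP : Disjoint (I z) P) (hloss : LossOK G q (c r) (I r) P) :
    ∃ A, IsArm G R c I r z A ∧ Disjoint A P ∧ LossOK G (q + 1) (c r) (I r) (P ∪ A) := by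
  let good : ℕ → Prop := fun ℓ => ∃ f : ℕ → V, IsW G f ℓ ∧ f 0 = c r ∧ f ℓ ∈ I z ∧
    ∀ t ≤ ℓ, f t ∉ P ∧ ∀ k, k ≠ r → k ≠ z → f t ∉ I k
  obtain ⟨j, hj, f₀, h1, h2, h3, h4⟩ := hC.conn r z hrz P hrP
    (Finset.disjoint_left.1 hzP (hC.mem z)) hP
    (fun i X a1 a2 a3 a4 => (hloss i X a1 a2 a3 a4).trans (Nat.mul_le_mul_right _ hq))
    (LossOK.of_disjoint hzP)
  have hex : ∃ ℓ, good ℓ := ⟨j, f₀, h1, h2, by rw [h3]; exact hC.mem z, h4⟩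
  set ℓ := Nat.find hex with hℓ
  obtain ⟨f, hf, hf0, hf1, hfa⟩ : good ℓ := Nat.find_spec hex
  have hmin : ∀ m, good m → ℓ ≤ m := fun m hm => Nat.find_min' hex hm
  have hℓR : ℓ ≤ R := (hmin j ⟨f₀, h1, h2, by rw [h3]; exact hC.mem z, h4⟩).trans hj
  have hA : ∀ y ∈ (Ioo 0 ℓ).image f, ∃ t, 0 < t ∧ t < ℓ ∧ f t = y := by
    intro y hy
    obtain ⟨t, ht, rfl⟩ := mem_image.1 hy
    exact ⟨t, (mem_Ioo.1 ht).1, (mem_Ioo.1 ht).2, rfl⟩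
  refine ⟨(Ioo 0 ℓ).image f, ⟨?_, ?_, ?_, ℓ, hℓR, f, hf, hf0, hf1, ?_⟩, ?_, ?_⟩
  · refine card_image_le.trans ?_
    rw [Nat.card_Ioo]; omega
  · intro hc
    obtain ⟨t, ht0, htℓ, hft⟩ := hA _ hc
    have := hmin (ℓ - t) ⟨fun s => f (t + s), hf.slice htℓ.le le_rfl, hft, by
      simpa [Nat.add_sub_cancel' htℓ.le] using hf1, fun s hs => hfa _ (by omega)⟩
    omega
  · intro k hk
    rw [Finset.disjoint_left]
    intro y hyI hy
    obtain ⟨t, ht0, htℓ, rfl⟩ := hA y hy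
    by_cases hkz : k = z
    · subst hkz
      have := hmin t ⟨f, hf.mono htℓ.le, hf0, hyI, fun s hs => hfa s (by omega)⟩
      omega
    · exact (hfa t htℓ.le).2 k hk hkz hyI
  · intro t ht0 ht
    exact mem_image_of_mem _ (mem_Ioo.2 ⟨ht0, ht⟩)
  · rw [Finset.disjoint_left]
    intro y hy
    obtain ⟨t, ht0, htℓ, rfl⟩ := hA y hy
    exact (hfa t htℓ.le).1
  · intro i X hXI hcX hXP hXr
    rw [disjoint_union_right] at hXP
    have hnew : (nb G X ∩ I r) ∩ (Ioo 0 ℓ).image f ⊆ (Icc 1 (i + 1)).image f := by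
      intro y hy
      obtain ⟨hy1, hy2⟩ := mem_inter.1 hy
      obtain ⟨t, ht0, htℓ, rfl⟩ := hA y hy2
      obtain ⟨j', hj', g, hg, hg0, hg1, hgX⟩ := hXr.step (mem_inter.1 hy1).1
      refine mem_image_of_mem _ (mem_Icc.2 ⟨ht0, ?_⟩)
      have hgl := hg.glue (hf.slice htℓ.le le_rfl) (by simpa using hg1)
      have := hmin (j' + 1 + (ℓ - t)) ⟨_, hgl, by simpa using hg0, ?_, ?_⟩
      · omega
      · have e1 : ¬ (j' + 1 + (ℓ - t) ≤ j' + 1) := by omega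
        simp only [e1, if_false]
        rw [show t + (j' + 1 + (ℓ - t) - (j' + 1)) = ℓ by omega]
        exact hf1
      · intro s hs
        by_cases hs1 : s ≤ j'
        · have hs2 : s ≤ j' + 1 := by omega
          simp only [hs2, if_true]
          exact ⟨Finset.disjoint_left.1 hXP.1 (hgX s hs1), fun k hk _ =>
            Finset.disjoint_left.1 (hC.disj r k hk.symm) (hXI (hgX s hs1))⟩
        · by_cases hs2 : s ≤ j' + 1
          · obtain rfl : s = j' + 1 := by omega
            simp only [le_refl, if_true, hg1]
            exact hfa t htℓ.le
          · simp only [hs2, if_false]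
            exact hfa _ (by omega)
    rw [inter_union_distrib_left]
    refine (card_union_le _ _).trans ?_
    have e1 := hloss i X hXI hcX hXP.1 hXr
    have e2 := (card_le_card hnew).trans card_image_le
    rw [Nat.card_Icc] at e2
    rw [add_mul]
    omega

/-- All units get their arms. -/
lemma CellSys.exists_arms {υ : Type*} [Fintype υ] {p w J R : ℕ} {c : υ × Option (Fin p) → V}
    {I : υ × Option (Fin p) → Finset V} (hC : CellSys G p w J R c I)
    (hw : Fintype.card (υ × Fin p) * R ≤ w) :
    ∃ A : υ × Fin p → Finset V, (∀ x, IsArm G R c I (x.1, none) (x.1, some x.2) (A x)) ∧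
      ∀ x x', x ≠ x' → Disjoint (A x) (A x') := by
  suffices hs : ∀ T : Finset (υ × Fin p), ∃ A : υ × Fin p → Finset V,
      (∀ x ∈ T, IsArm G R c I (x.1, none) (x.1, some x.2) (A x)) ∧
      (∀ x ∈ T, ∀ x' ∈ T, x ≠ x' → Disjoint (A x) (A x')) ∧
      ∀ j, LossOK G #{x ∈ T | x.1 = j} (c (j, none)) (I (j, none)) (T.biUnion A) by
    obtain ⟨A, h1, h2, -⟩ := hs univ
    exact ⟨A, fun x => h1 x (mem_univ x), fun x x' => h2 x (mem_univ x) x' (mem_univ x')⟩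
  intro T
  induction T using Finset.induction_on with
  | empty => exact ⟨fun _ => ∅, by simp, by simp, fun j => LossOK.of_disjoint (by simp)⟩
  | insert x T hx ih =>
    obtain ⟨A, h1, h2, h3⟩ := ih
    have hPc : #(T.biUnion A) ≤ w := by
      refine (card_biUnion_le_card_mul _ _ R fun y hy => (h1 y hy).1).trans (le_trans ?_ hw)
      exact Nat.mul_le_mul_right _ (card_le_univ _)
    have hcount : #{y ∈ T | y.1 = x.1} ≤ p := by
      calc #{y ∈ T | y.1 = x.1} ≤ #(univ : Finset (Fin p)) := by
            refine card_le_card_of_injOn Prod.snd (by simp) ?_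
            intro y hy y' hy' hyy
            simp only [coe_filter, Set.mem_ofPred_eq] at hy hy'
            exact Prod.ext (hy.2.trans hy'.2.symm) hyy
        _ = p := by simp
    obtain ⟨B, hB1, hB2, hB3⟩ := hC.exists_arm (r := (x.1, none)) (z := (x.1, some x.2))
      (by simp) hPc hcount (by
        intro hc
        obtain ⟨y, hy, hcy⟩ := mem_biUnion.1 hc
        by_cases hyx : y.1 = x.1
        · rw [← hyx] at hcy
          exact (h1 y hy).2.1 hcy
        · exact Finset.disjoint_left.1 ((h1 y hy).2.2.1 (x.1, none)
            (by simpa using Ne.symm hyx)) (hC.mem _) hcy)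
      (by
        refine (disjoint_biUnion_right _ _ _).2 fun y hy => (h1 y hy).2.2.1 _ (by simp))
      (h3 x.1)
    have hBT : ∀ y ∈ T, Disjoint B (A y) := fun y hy =>
      (disjoint_biUnion_right _ _ _).1 hB2 y hy
    have hupd : ∀ y ∈ T, Function.update A x B y = A y := fun y hy =>
      Function.update_of_ne (by rintro rfl; exact hx hy) _ _
    have hbi : (insert x T).biUnion (Function.update A x B) = T.biUnion A ∪ B := by
      rw [biUnion_insert, Function.update_self, union_comm]
      congr 1
      exact biUnion_congr rfl hupd
    refine ⟨Function.update A x B, ?_, ?_, ?_⟩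
    · intro y hy
      rcases mem_insert.1 hy with rfl | hy'
      · rw [Function.update_self]; exact hB1
      · rw [hupd y hy']; exact h1 y hy'
    · intro y hy y' hy' hne
      rcases mem_insert.1 hy with rfl | hyT <;> rcases mem_insert.1 hy' with rfl | hyT'
      · exact (hne rfl).elim
      · rw [Function.update_self, hupd y' hyT']; exact hBT y' hyT'
      · rw [Function.update_self, hupd y hyT]; exact (hBT y hyT).symm
      · rw [hupd y hyT, hupd y' hyT']; exact h2 y hyT y' hyT' hne
    · intro j
      rw [hbi]
      by_cases hj : x.1 = j
      · subst hj
        rw [filter_insert, if_pos rfl, card_insert_of_notMem (by simp [hx])]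
        exact hB3
      · rw [filter_insert, if_neg hj]
        intro i X a1 a2 a3 a4
        refine le_trans (card_le_card ?_)
          (h3 j i X a1 a2 (a3.mono_right subset_union_left) a4)
        intro y hy
        obtain ⟨hy1, hy2⟩ := mem_inter.1 hy
        rcases mem_union.1 hy2 with hy3 | hy3
        · exact mem_inter.2 ⟨hy1, hy3⟩
        · exact (Finset.disjoint_left.1 (hB1.2.2.1 (j, none)
            (by simpa using Ne.symm hj)) (mem_inter.1 hy1).2 hy3).elim

/-- The interior of a connection between two cells, outside all inner sets. -/
lemma CellSys.exists_bridge {κ : Type*} [Fintype κ] {p w J R : ℕ} {c : κ → V} {I : κ → Finset V}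
    (hC : CellSys G p w J R c I) {s z : κ} (hsz : s ≠ z) {W : Finset V} (hW : #W ≤ w) :
    ∃ Q, ((∀ k, Disjoint (I k) Q) ∧ ∃ ℓ ≤ R, ∃ f : ℕ → V, IsW G f ℓ ∧ f 0 ∈ I s ∧ f ℓ ∈ I z ∧
      ∀ t, 0 < t → t < ℓ → f t ∈ Q) ∧ #Q ≤ R ∧ Disjoint Q W := by
  set P := W \ univ.biUnion I with hP
  have hIP : ∀ k, Disjoint (I k) P := fun k =>
    disjoint_sdiff.mono_left (subset_biUnion_of_mem I (mem_univ k))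
  obtain ⟨j, hj, f, h1, h2, h3, h4⟩ := hC.conn s z hsz P
    (Finset.disjoint_left.1 (hIP s) (hC.mem s)) (Finset.disjoint_left.1 (hIP z) (hC.mem z))
    ((card_le_card sdiff_subset).trans hW) (LossOK.of_disjoint (hIP s))
    (LossOK.of_disjoint (hIP z))
  obtain ⟨t₀, ht₀, ht₀max⟩ := Finset.exists_max_image ((range (j + 1)).filter fun t => f t ∈ I s) id
    ⟨0, by simp [h2, hC.mem s]⟩
  simp only [mem_filter, mem_range, id] at ht₀ ht₀max
  have hjz : f j ∈ I z := by rw [h3]; exact hC.mem z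
  obtain ⟨t₁, ht₁, ht₁min⟩ := Finset.exists_min_image
    ((range (j + 1)).filter fun t => t₀ < t ∧ f t ∈ I z) id ⟨j, by
      simp only [mem_filter, mem_range]
      refine ⟨by omega, ?_, hjz⟩
      rcases Nat.lt_or_ge t₀ j with h | h
      · exact h
      · exfalso
        obtain rfl : t₀ = j := by omega
        exact Finset.disjoint_left.1 (hC.disj s z hsz) ht₀.2 hjz⟩
  simp only [mem_filter, mem_range, id] at ht₁ ht₁min
  have hQ : ∀ y ∈ (Ioo t₀ t₁).image f, ∃ t, t₀ < t ∧ t < t₁ ∧ f t = y := by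
    intro y hy
    obtain ⟨t, ht, rfl⟩ := mem_image.1 hy
    exact ⟨t, (mem_Ioo.1 ht).1, (mem_Ioo.1 ht).2, rfl⟩
  have hQI : ∀ k, Disjoint (I k) ((Ioo t₀ t₁).image f) := by
    intro k
    rw [Finset.disjoint_left]
    intro y hyI hy
    obtain ⟨t, ht0, ht1, rfl⟩ := hQ y hy
    by_cases hks : k = s
    · subst hks
      have := ht₀max t ⟨by omega, hyI⟩
      omega
    · by_cases hkz : k = z
      · subst hkz
        have := ht₁min t ⟨by omega, ht0, hyI⟩
        omega
      · exact (h4 t (by omega)).2 k hks hkz hyI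
  refine ⟨(Ioo t₀ t₁).image f, ⟨hQI, t₁ - t₀, by omega, fun t => f (t₀ + t),
    h1.slice ht₁.2.1.le (by omega), by simpa using ht₀.2, ?_, ?_⟩, ?_, ?_⟩
  · simp only [Nat.add_sub_cancel' ht₁.2.1.le]
    exact ht₁.2.2
  · intro t ht ht'
    exact mem_image_of_mem _ (mem_Ioo.2 ⟨by omega, by omega⟩)
  · refine card_image_le.trans ?_
    rw [Nat.card_Ioo]; omega
  · rw [Finset.disjoint_left]
    intro y hy hyW
    have hyI : y ∉ univ.biUnion I := by
      intro hyI
      obtain ⟨k, -, hk⟩ := mem_biUnion.1 hyI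
      exact Finset.disjoint_left.1 (hQI k) hk hy
    obtain ⟨t, ht0, ht1, rfl⟩ := hQ y hy
    exact (h4 t (by omega)).1 (mem_sdiff.2 ⟨hyW, hyI⟩)

/-- Roots with arms, and labelled links between arms of roots on opposite sides. -/
structure Net (G : SimpleGraph V) (α β : Type*) (p R : ℕ) (ρ : α ⊕ β → V)
    (D : (α ⊕ β) × Fin p → Set V) (Q : (α × Fin p) × (β × Fin p) → Set V)
    (lab : (α × Fin p) × (β × Fin p) → ℕ) : Prop where
  inj : Function.Injective ρ
  root_arm : ∀ j x, ρ j ∉ D x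
  root_bridge : ∀ j τ, ρ j ∉ Q τ
  arm_arm : ∀ x x', x ≠ x' → Disjoint (D x) (D x')
  bridge_bridge : ∀ τ τ', τ ≠ τ' → Disjoint (Q τ) (Q τ')
  arm_bridge : ∀ x τ, Disjoint (D x) (Q τ)
  lab_le : ∀ τ, 1 ≤ lab τ ∧ lab τ ≤ R
  link : ∀ τ, Lk G (D (Sum.inl τ.1.1, τ.1.2) ∪ Q τ ∪ D (Sum.inr τ.2.1, τ.2.2)) (lab τ)
    (ρ (Sum.inl τ.1.1)) (ρ (Sum.inr τ.2.1))

theorem CellSys.exists_net {α β : Type*} [Fintype α] [Fintype β] {p w J R : ℕ}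
    {c : (α ⊕ β) × Option (Fin p) → V} {I : (α ⊕ β) × Option (Fin p) → Finset V}
    (hC : CellSys G p w J R c I)
    (hw : Fintype.card ((α ⊕ β) × Fin p) * R +
      Fintype.card ((α × Fin p) × (β × Fin p)) * R ≤ w) :
    ∃ ρ D Q lab, Net G α β p (3 * R + 4 * J) ρ D Q lab := by
  obtain ⟨A, hA1, hA2⟩ := hC.exists_arms (le_trans (Nat.le_add_right _ _) hw)
  obtain ⟨Q, hQ1, hQ2⟩ := sequential_selection (V := V) (ι := (α × Fin p) × (β × Fin p))
    (fun τ Q => ((∀ k, Disjoint (I k) Q) ∧ ∃ ℓ ≤ R, ∃ f : ℕ → V, IsW G f ℓ ∧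
      f 0 ∈ I (Sum.inl τ.1.1, some τ.1.2) ∧ f ℓ ∈ I (Sum.inr τ.2.1, some τ.2.2) ∧
      ∀ t, 0 < t → t < ℓ → f t ∈ Q) ∧ ∀ x, Disjoint (A x) Q) R
    (Fintype.card ((α × Fin p) × (β × Fin p)) * R) (by
      intro τ W hW
      obtain ⟨Q, h1, h2, h3⟩ := hC.exists_bridge (s := (Sum.inl τ.1.1, some τ.1.2))
        (z := (Sum.inr τ.2.1, some τ.2.2)) (by simp) (W := univ.biUnion A ∪ W) (by
          refine (card_union_le _ _).trans (le_trans (Nat.add_le_add ?_ hW) hw)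
          refine (card_biUnion_le_card_mul _ _ R fun x _ => (hA1 x).1).trans ?_
          rw [card_univ])
      rw [disjoint_union_right] at h3
      exact ⟨Q, ⟨h1, fun x => ((disjoint_biUnion_right _ _ _).1 h3.1 x (mem_univ x)).symm⟩, h2,
        h3.2⟩) le_rfl
  let ρ : α ⊕ β → V := fun j => c (j, none)
  let D : (α ⊕ β) × Fin p → Set V := fun x => (A x : Set V) ∪ (I (x.1, some x.2) : Set V)
  have hinj : Function.Injective ρ := by
    intro j j' hjj
    by_contra hne
    refine Finset.disjoint_left.1 (hC.disj (j, none) (j', none) (by simpa using hne))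
      (hC.mem _) ?_
    change ρ j ∈ _
    rw [hjj]
    exact hC.mem _
  have hrootA : ∀ j x, ρ j ∉ A x := by
    intro j x hjx
    by_cases hj : x.1 = j
    · exact (hA1 x).2.1 (by rw [hj]; exact hjx)
    · exact Finset.disjoint_left.1 ((hA1 x).2.2.1 (j, none) (by simpa using Ne.symm hj))
        (hC.mem _) hjx
  have hrootD : ∀ j x, ρ j ∉ D x := by
    rintro j x (h | h)
    · exact hrootA j x h
    · exact Finset.disjoint_left.1 (hC.disj (j, none) (x.1, some x.2) (by simp)) (hC.mem _) h
  have hrootQ : ∀ j τ, ρ j ∉ Q τ := fun j τ h =>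
    Finset.disjoint_left.1 ((hQ1 τ).1.1.1 (j, none)) (hC.mem _) h
  have harm : ∀ x, ∃ z ∈ I (x.1, some x.2), ∃ ℓ ≤ R, Wk G (D x ∪ {ρ x.1}) ℓ (ρ x.1) z := by
    intro x
    obtain ⟨-, -, -, ℓ, hℓ, f, hf, hf0, hf1, hfA⟩ := hA1 x
    refine ⟨f ℓ, hf1, ℓ, hℓ, f, hf, hf0, rfl, fun t ht => ?_⟩
    rcases Nat.eq_zero_or_pos t with rfl | ht0
    · exact Or.inr hf0
    · rcases Nat.lt_or_ge t ℓ with h | h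
      · exact Or.inl (Or.inl (hfA t ht0 h))
      · obtain rfl : t = ℓ := by omega
        exact Or.inl (Or.inr hf1)
  have htoc : ∀ x, ∀ v ∈ I (x.1, some x.2), ∃ ℓ ≤ R + 2 * J,
      Wk G (D x ∪ {ρ x.1}) ℓ (ρ x.1) v := by
    intro x v hv
    obtain ⟨z, hz, ℓ, hℓ, hw⟩ := harm x
    obtain ⟨j₁, hj₁, hw₁⟩ := (hC.rad _).wk hz
    obtain ⟨j₂, hj₂, hw₂⟩ := (hC.rad _).wk hv
    have hsub : ((I (x.1, some x.2) : Finset V) : Set V) ⊆ D x ∪ {ρ x.1} :=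
      fun y hy => Or.inl (Or.inr hy)
    exact ⟨_, by omega, (hw.trans (hw₁.symm.mono hsub)).trans (hw₂.mono hsub)⟩
  have hlink : ∀ τ : (α × Fin p) × (β × Fin p), ∃ ℓ, (1 ≤ ℓ ∧ ℓ ≤ 3 * R + 4 * J) ∧
      Lk G (D (Sum.inl τ.1.1, τ.1.2) ∪ Q τ ∪ D (Sum.inr τ.2.1, τ.2.2)) ℓ
        (ρ (Sum.inl τ.1.1)) (ρ (Sum.inr τ.2.1)) := by
    intro τ
    obtain ⟨-, ℓ, hℓ, f, hf, hf0, hf1, hfQ⟩ := (hQ1 τ).1.1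
    obtain ⟨a, ha, hwa⟩ := htoc (Sum.inl τ.1.1, τ.1.2) _ hf0
    obtain ⟨b, hb, hwb⟩ := htoc (Sum.inr τ.2.1, τ.2.2) _ hf1
    set S : Set V := (D (Sum.inl τ.1.1, τ.1.2) ∪ Q τ ∪ D (Sum.inr τ.2.1, τ.2.2)) ∪
      {ρ (Sum.inl τ.1.1), ρ (Sum.inr τ.2.1)} with hS
    have hmid : Wk G S ℓ (f 0) (f ℓ) := by
      refine ⟨f, hf, rfl, rfl, fun t ht => ?_⟩
      rcases Nat.eq_zero_or_pos t with rfl | ht0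
      · exact Or.inl (Or.inl (Or.inl (Or.inr hf0)))
      · rcases Nat.lt_or_ge t ℓ with h | h
        · exact Or.inl (Or.inl (Or.inr (hfQ t ht0 h)))
        · obtain rfl : t = ℓ := by omega
          exact Or.inl (Or.inr (Or.inr hf1))
    have hS1 : D (Sum.inl τ.1.1, τ.1.2) ∪ {ρ (Sum.inl τ.1.1)} ⊆ S := by
      rintro y (hy | hy)
      · exact Or.inl (Or.inl (Or.inl hy))
      · exact Or.inr (Or.inl hy)
    have hS2 : D (Sum.inr τ.2.1, τ.2.2) ∪ {ρ (Sum.inr τ.2.1)} ⊆ S := by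
      rintro y (hy | hy)
      · exact Or.inl (Or.inr hy)
      · exact Or.inr (Or.inr hy)
    obtain ⟨r, hr, hr1, hL⟩ := (((hwa.mono hS1).trans hmid).trans (hwb.mono hS2).symm).lk
      (fun h => by simpa using hinj h)
    refine ⟨r, ⟨hr1, by omega⟩, hL.mono ?_⟩
    rintro y ⟨hy | hy, hy'⟩
    · exact hy
    · exact (hy' hy).elim
  choose lab hlab1 hlab2 using hlink
  refine ⟨ρ, D, fun τ => (Q τ : Set V), lab, hinj, hrootD, hrootQ, ?_, ?_, ?_, hlab1, hlab2⟩
  · intro x x' hne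
    simp only [D, Set.disjoint_union_left, Set.disjoint_union_right, Finset.disjoint_coe]
    refine ⟨⟨hA2 x x' hne, ?_⟩, ?_, ?_⟩
    · exact (hA1 x').2.2.1 (x.1, some x.2) (by simp)
    · exact ((hA1 x).2.2.1 (x'.1, some x'.2) (by simp)).symm
    · refine hC.disj _ _ ?_
      intro h
      simp only [Prod.mk.injEq, Option.some.injEq] at h
      exact hne (Prod.ext h.1 h.2)
  · intro τ τ' hne
    exact Finset.disjoint_coe.2 (hQ2 τ τ' hne)
  · intro x τ
    simp only [D, Set.disjoint_union_left, Finset.disjoint_coe]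
    exact ⟨(hQ1 τ).1.2 x, (hQ1 τ).1.1.1 _⟩

end
end
section
open scoped Classical

section
variable {V : Type*} {G : SimpleGraph V}

/-- Concatenation of consecutive links with disjoint interiors. -/
lemma Lk.chain (x : ℕ → V) (K : ℕ → Set V) (l : ℕ → ℕ) (m : ℕ) (hm : 1 ≤ m)
    (hl : ∀ k < m, Lk G (K k) (l k) (x k) (x (k + 1)))
    (hK : ∀ k < m, ∀ k' < m, k ≠ k' → Disjoint (K k) (K k'))
    (hx : Set.InjOn x (Set.Iic m)) (hxK : ∀ k < m, ∀ i ≤ m, x i ∉ K k) :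
    Lk G {y | (∃ k < m, y ∈ K k) ∨ ∃ k, 0 < k ∧ k < m ∧ y = x k} (∑ k ∈ range m, l k)
      (x 0) (x m) := by
  induction m, hm using Nat.le_induction with
  | base => simpa using hl 0 (by omega)
  | succ m hm ih =>
    have h1 := ih (fun k hk => hl k (by omega)) (fun k hk k' hk' => hK k (by omega) k' (by omega))
      (hx.mono (Set.Iic_subset_Iic.2 (by omega))) (fun k hk i hi => hxK k (by omega) i (by omega))
    rw [sum_range_succ]
    refine (h1.trans (hl m (by omega)) ?_ ?_ ?_ ?_).mono ?_
    · rw [Set.disjoint_left]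
      rintro y (⟨k, hk, hy⟩ | ⟨k, hk0, hk, rfl⟩) hy'
      · exact Set.disjoint_left.1 (hK k (by omega) m (by omega) (by omega)) hy hy'
      · exact hxK m (by omega) k (by omega) hy'
    · exact hxK m (by omega) 0 (by omega)
    · rintro (⟨k, hk, hy⟩ | ⟨k, hk0, hk, hy⟩)
      · exact hxK k (by omega) _ le_rfl hy
      · have := hx (Set.mem_Iic.2 le_rfl) (Set.mem_Iic.2 (by omega : k ≤ m + 1)) hy
        omega
    · intro h
      have := hx (Set.mem_Iic.2 (by omega)) (Set.mem_Iic.2 le_rfl) h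
      omega
    · rintro y ((( ⟨k, hk, hy⟩ | ⟨k, hk0, hk, hy⟩) | hy) | hy)
      · exact Or.inl ⟨k, by omega, hy⟩
      · exact Or.inr ⟨k, hk0, by omega, hy⟩
      · exact Or.inl ⟨m, by omega, hy⟩
      · exact Or.inr ⟨m, by omega, by omega, hy⟩

/-- The arm used at the `k`-th step of the path of pair `e`. -/
def armIx {h p : ℕ} (hp : 0 < p) (e : Fin h × Fin h) (k : ℕ) : Fin p :=
  ⟨(2 * (e.1 * h + e.2) + 1 + k) % p, Nat.mod_lt _ hp⟩

/-- The unit at position `k` of the path of pair `e`. -/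
def unitIx {h p : ℕ} (e : Fin h × Fin h) (k : ℕ) :
    Fin h ⊕ ((Fin h × Fin h) × Fin p) :=
  if hk : k < p then (if k = 0 then Sum.inl e.1 else Sum.inr (e, ⟨k, hk⟩)) else Sum.inl e.2

lemma pairCode_lt {h : ℕ} (e : Fin h × Fin h) : (e.1 : ℕ) * h + e.2 < h * h := by
  have h1 := e.1.2
  have h2 := e.2.2
  nlinarith

lemma pairCode_inj {h : ℕ} {e e' : Fin h × Fin h}
    (he : (e.1 : ℕ) * h + e.2 = e'.1 * h + e'.2) : e = e' := by
  have h2 := e.2.2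
  have h2' := e'.2.2
  have : (e.1 : ℕ) = e'.1 := by
    rcases lt_trichotomy (e.1 : ℕ) e'.1 with hlt | heq | hlt
    · nlinarith
    · exact heq
    · nlinarith
  rw [this] at he
  exact Prod.ext (Fin.ext this) (Fin.ext (by omega))

lemma armIx_inj {h p : ℕ} (hp : 0 < p) (e : Fin h × Fin h) {k k' : ℕ} (hk : k < p) (hk' : k' < p)
    (hkk : armIx hp e k = armIx hp e k') : k = k' := by
  have h1 : (2 * ((e.1 : ℕ) * h + e.2) + 1 + k) ≡ (2 * (e.1 * h + e.2) + 1 + k') [MOD p] :=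
    congrArg Fin.val hkk
  exact (Nat.ModEq.add_left_cancel' _ h1).eq_of_lt_of_lt hk hk'

lemma sum_armIx {h p : ℕ} (hp : 0 < p) (e : Fin h × Fin h) (f : Fin p → ℕ) :
    ∑ k ∈ range p, f (armIx hp e k) = ∑ j, f j := by
  rw [sum_range]
  refine Function.Bijective.sum_comp (e := fun k : Fin p => armIx hp e k) ?_ f
  rw [← Finite.injective_iff_bijective]
  exact fun k k' hkk => Fin.ext (armIx_inj hp e k.2 k'.2 hkk)

lemma unitIx_inj {h p : ℕ} {e : Fin h × Fin h} (he : e.1 ≠ e.2) {k k' : ℕ}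
    (hk : k ≤ p) (hk' : k' ≤ p)
    (hkk : (unitIx e k : Fin h ⊕ ((Fin h × Fin h) × Fin p)) = unitIx e k') : k = k' := by
  unfold unitIx at hkk
  split_ifs at hkk <;> simp at hkk <;> omega

lemma unitIx_armIx_inj {h p : ℕ} (hp : 0 < p) (hh : 2 * (h * h) ≤ p) {e e' : Fin h × Fin h}
    {k k' : ℕ} {ε ε' : Fin 2} (hk : k < p) (hk' : k' < p)
    (hu : (unitIx e (k + ε) : Fin h ⊕ ((Fin h × Fin h) × Fin p)) = unitIx e' (k' + ε'))
    (ha : armIx hp e k = armIx hp e' k') : e = e' ∧ k = k' ∧ ε = ε' := by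
  have hfin : e = e' → k + (ε : ℕ) = k' + ε' → e = e' ∧ k = k' ∧ ε = ε' := by
    rintro rfl hke
    have := armIx_inj hp e hk hk' ha
    exact ⟨rfl, this, Fin.ext (by omega)⟩
  have hε := ε.2
  have hε' := ε'.2
  have h1 := pairCode_lt e
  have h1' := pairCode_lt e'
  have hav := congrArg Fin.val ha
  simp only [armIx] at hav
  set q := (e.1 : ℕ) * h + e.2 with hq
  set q' := (e'.1 : ℕ) * h + e'.2 with hq'
  have hend : ∀ q, 2 * q + 1 + (p - 1) = 2 * q + p := by intro q; omega
  have hm : ∀ q, q < h * h → (2 * q + 1) % p = 2 * q + 1 := fun q hq => Nat.mod_eq_of_lt (by omega)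
  have hm' : ∀ q, q < h * h → (2 * q + p) % p = 2 * q := fun q hq => by
    rw [Nat.add_mod_right, Nat.mod_eq_of_lt (by omega)]
  unfold unitIx at hu
  split_ifs at hu with a1 a2 a3 a4 a5 a6 a7
  · have e1 : k = 0 := by omega
    have e2 : k' = 0 := by omega
    subst e1 e2
    rw [add_zero, add_zero, hm _ h1, hm _ h1'] at hav
    exact hfin (pairCode_inj (by omega)) (by omega)
  · have e1 : k = 0 := by omega
    have e2 : k' = p - 1 := by omega
    subst e1 e2
    rw [add_zero, hend, hm _ h1, hm' _ h1'] at hav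
    omega
  · simp only [Sum.inr.injEq, Prod.mk.injEq, Fin.mk.injEq] at hu
    exact hfin hu.1 hu.2
  · have e1 : k = p - 1 := by omega
    have e2 : k' = 0 := by omega
    subst e1 e2
    rw [add_zero, hend, hm' _ h1, hm _ h1'] at hav
    omega
  · have e1 : k = p - 1 := by omega
    have e2 : k' = p - 1 := by omega
    subst e1 e2
    rw [hend, hend, hm' _ h1, hm' _ h1'] at hav
    exact hfin (pairCode_inj (by omega)) (by omega)

end

variable {V : Type*} {G : SimpleGraph V}

theorem Net.bs {α β : Type*} {p R h : ℕ} {ρ : α ⊕ β → V} {D : (α ⊕ β) × Fin p → Set V}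
    {Q : (α × Fin p) × (β × Fin p) → Set V} {lab : (α × Fin p) × (β × Fin p) → ℕ}
    (hN : Net G α β p R ρ D Q lab) (hh : 1 ≤ h) (hp : 2 * (h * h) ≤ p)
    (a : Fin h ⊕ ((Fin h × Fin h) × Fin p) → α) (ha : Function.Injective a)
    (b : (Fin h × Fin h) × Fin p → β) (hb : Function.Injective b)
    (ar : Fin 2 → Fin p) (har : Function.Injective ar) (lam : Fin p → Fin 2 → ℕ)
    (hlab : ∀ u c j ε, lab ((a u, j), (b c, ar ε)) = lam j ε) : BS G h := by
  have hp0 : 0 < p := by nlinarith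
  let E := Fin h × Fin h
  let cu : E → ℕ → β := fun e k => b (e, ⟨k % p, Nat.mod_lt _ hp0⟩)
  let τ : E → ℕ → Fin 2 → (α × Fin p) × (β × Fin p) := fun e k ε =>
    ((a (unitIx e (k + ε)), armIx hp0 e k), (cu e k, ar ε))
  let J : E → ℕ → Fin 2 → Set V := fun e k ε =>
    D (Sum.inl (τ e k ε).1.1, (τ e k ε).1.2) ∪ Q (τ e k ε) ∪
      D (Sum.inr (τ e k ε).2.1, (τ e k ε).2.2)
  have hroot : ∀ j e k ε, ρ j ∉ J e k ε := by
    rintro j e k ε ((hj | hj) | hj)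
    · exact hN.root_arm _ _ hj
    · exact hN.root_bridge _ _ hj
    · exact hN.root_arm _ _ hj
  have hcu : ∀ {e e' k k'}, k < p → k' < p → cu e k = cu e' k' → e = e' ∧ k = k' := by
    intro e e' k k' hk hk' hc
    have := hb hc
    simp only [Prod.mk.injEq, Fin.mk.injEq, Nat.mod_eq_of_lt hk, Nat.mod_eq_of_lt hk'] at this
    exact this
  have hJ : ∀ {e e' k k' ε ε'}, k < p → k' < p → ¬ (e = e' ∧ k = k' ∧ ε = ε') →
      Disjoint (J e k ε) (J e' k' ε') := by
    intro e e' k k' ε ε' hk hk' hne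
    have h1 : ((τ e k ε).1.1, (τ e k ε).1.2) ≠ ((τ e' k' ε').1.1, (τ e' k' ε').1.2) := by
      intro hc
      simp only [τ, Prod.mk.injEq] at hc
      exact hne (unitIx_armIx_inj hp0 hp hk hk' (ha hc.1) hc.2)
    have h2 : ((τ e k ε).2.1, (τ e k ε).2.2) ≠ ((τ e' k' ε').2.1, (τ e' k' ε').2.2) := by
      intro hc
      simp only [τ, Prod.mk.injEq] at hc
      obtain ⟨h3, h4⟩ := hcu hk hk' hc.1
      exact hne ⟨h3, h4, har hc.2⟩
    simp only [J, Set.disjoint_union_left, Set.disjoint_union_right]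
    refine ⟨⟨⟨⟨hN.arm_arm _ _ ?_, (hN.arm_bridge _ _).symm⟩, hN.arm_arm _ _ (by simp)⟩,
      ⟨hN.arm_bridge _ _, hN.bridge_bridge _ _ ?_⟩, hN.arm_bridge _ _⟩,
      ⟨hN.arm_arm _ _ (by simp), (hN.arm_bridge _ _).symm⟩, hN.arm_arm _ _ ?_⟩
    · exact fun hc => h1 (Prod.ext (Sum.inl.inj (congrArg Prod.fst hc))
        (congrArg Prod.snd hc :))
    · intro hc
      rw [hc] at h1
      exact h1 rfl
    · exact fun hc => h2 (Prod.ext (Sum.inr.inj (congrArg Prod.fst hc))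
        (congrArg Prod.snd hc :))
  let K : E → ℕ → Set V := fun e k => J e k 0 ∪ J e k 1 ∪ {ρ (Sum.inr (cu e k))}
  have hKd : ∀ {e e' k k'}, k < p → k' < p → ¬ (e = e' ∧ k = k') → Disjoint (K e k) (K e' k') := by
    intro e e' k k' hk hk' hne
    have hJ' : ∀ ε ε', Disjoint (J e k ε) (J e' k' ε') := fun ε ε' =>
      hJ hk hk' fun hc => hne ⟨hc.1, hc.2.1⟩
    have hne' : ρ (Sum.inr (cu e k)) ≠ ρ (Sum.inr (cu e' k')) := fun hc =>
      hne (hcu hk hk' (Sum.inr.inj (hN.inj hc)))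
    rw [Set.disjoint_left]
    rintro y ((hy | hy) | rfl) ((hy' | hy') | hy')
    · exact Set.disjoint_left.1 (hJ' _ _) hy hy'
    · exact Set.disjoint_left.1 (hJ' _ _) hy hy'
    · rw [hy'] at hy
      exact hroot _ _ _ _ hy
    · exact Set.disjoint_left.1 (hJ' _ _) hy hy'
    · exact Set.disjoint_left.1 (hJ' _ _) hy hy'
    · rw [hy'] at hy
      exact hroot _ _ _ _ hy
    · exact hroot _ _ _ _ hy'
    · exact hroot _ _ _ _ hy'
    · exact hne' hy'
  let xx : E → ℕ → V := fun e k => ρ (Sum.inl (a (unitIx e k)))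
  have hKx : ∀ u e k, ρ (Sum.inl u) ∉ K e k := by
    rintro u e k ((hj | hj) | hj)
    · exact hroot _ _ _ _ hj
    · exact hroot _ _ _ _ hj
    · simpa using hN.inj hj
  have hlk : ∀ e : E, e.1 ≠ e.2 → ∀ k < p,
      Lk G (K e k) (lam (armIx hp0 e k) 0 + lam (armIx hp0 e k) 1) (xx e k) (xx e (k + 1)) := by
    intro e he k hk
    have h0 : Lk G (J e k 0) (lam (armIx hp0 e k) 0) (xx e k) (ρ (Sum.inr (cu e k))) := by
      have := hN.link (τ e k 0)
      rw [hlab] at this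
      exact this
    have h1 : Lk G (J e k 1) (lam (armIx hp0 e k) 1) (xx e (k + 1)) (ρ (Sum.inr (cu e k))) := by
      have := hN.link (τ e k 1)
      rw [hlab] at this
      exact this
    refine h0.trans h1.symm (hJ hk hk (by simp)) (hroot _ _ _ _) (hroot _ _ _ _) ?_
    intro hc
    have := unitIx_inj he (by omega) (by omega) (ha (Sum.inl.inj (hN.inj hc)))
    omega
  let L := ∑ j, (lam j 0 + lam j 1)
  let Reg : E → Set V := fun e => {y | (∃ k < p, y ∈ K e k) ∨ ∃ k, 0 < k ∧ k < p ∧ y = xx e k}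
  have hchain : ∀ e : E, e.1 ≠ e.2 → Lk G (Reg e) L (ρ (Sum.inl (a (Sum.inl e.1))))
      (ρ (Sum.inl (a (Sum.inl e.2)))) := by
    intro e he
    have := Lk.chain (xx e) (K e) _ p hp0 (hlk e he)
      (fun k hk k' hk' hne => hKd hk hk' fun hc => hne hc.2)
      (fun k hk k' hk' hc => unitIx_inj he hk hk' (ha (Sum.inl.inj (hN.inj hc))))
      (fun k _ i _ => hKx _ _ _)
    rw [sum_armIx hp0 e fun j => lam j 0 + lam j 1] at this
    have e0 : xx e 0 = ρ (Sum.inl (a (Sum.inl e.1))) := by simp [xx, unitIx, hp0]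
    have e1 : xx e p = ρ (Sum.inl (a (Sum.inl e.2))) := by simp [xx, unitIx]
    rw [e0, e1] at this
    exact this
  have hxx : ∀ {e k}, 0 < k → k < p → xx e k = ρ (Sum.inl (a (Sum.inr (e, ⟨k % p, Nat.mod_lt _ hp0⟩)))) := by
    intro e k h0 hk
    simp [xx, unitIx, hk, h0.ne', Nat.mod_eq_of_lt hk]
  have hRegd : ∀ e e' : E, e ≠ e' → Disjoint (Reg e) (Reg e') := by
    intro e e' hne
    rw [Set.disjoint_left]
    rintro y (⟨k, hk, hy⟩ | ⟨k, hk0, hk, rfl⟩) (⟨k', hk', hy'⟩ | ⟨k', hk0', hk', hy'⟩)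
    · exact Set.disjoint_left.1 (hKd hk hk' fun hc => hne hc.1) hy hy'
    · subst hy'
      exact hKx _ _ _ hy
    · exact hKx _ _ _ hy'
    · rw [hxx hk0 hk, hxx hk0' hk'] at hy'
      have := ha (Sum.inl.inj (hN.inj hy'))
      simp only [Sum.inr.injEq, Prod.mk.injEq] at this
      exact hne this.1
  have hRegb : ∀ i e, ρ (Sum.inl (a (Sum.inl i))) ∉ Reg e := by
    rintro i e (⟨k, hk, hy⟩ | ⟨k, hk0, hk, hy⟩)
    · exact hKx _ _ _ hy
    · rw [hxx hk0 hk] at hy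
      simpa using ha (Sum.inl.inj (hN.inj hy))
  refine ⟨L, ?_, fun i => ρ (Sum.inl (a (Sum.inl i))), ?_,
    fun z => {y | ∃ i j, i < j ∧ s(i, j) = z ∧ y ∈ Reg (i, j)}, ?_, ?_, ?_⟩
  · have h1 : 1 ≤ lam (ar 0) 0 := by
      rw [← hlab (Sum.inl ⟨0, hh⟩) ((⟨0, hh⟩, ⟨0, hh⟩), ⟨0, hp0⟩)]
      exact (hN.lab_le _).1
    calc 1 ≤ lam (ar 0) 0 + lam (ar 0) 1 := by omega
      _ ≤ L := single_le_sum (f := fun j => lam j 0 + lam j 1) (fun _ _ => Nat.zero_le _)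
        (mem_univ _)
  · intro i i' hii
    simpa using ha (Sum.inl.inj (hN.inj hii))
  · intro z _ z' _ hne
    rw [Set.disjoint_left]
    rintro y ⟨i, j, _, rfl, hy⟩ ⟨i', j', _, rfl, hy'⟩
    refine Set.disjoint_left.1 (hRegd _ _ ?_) hy hy'
    intro hc
    exact hne (congrArg (fun e : Fin h × Fin h => s(e.1, e.2)) hc)
  · rintro z _ i ⟨_, _, _, _, hy⟩
    exact hRegb _ _ hy
  · intro i j hij
    rw [SimpleGraph.top_adj] at hij
    rcases lt_or_gt_of_ne hij with hlt | hlt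
    · exact (hchain (i, j) hij).mono fun y hy => ⟨i, j, hlt, rfl, hy⟩
    · exact (hchain (j, i) hij.symm).symm.mono fun y hy => ⟨j, i, hlt, Sym2.eq_swap, hy⟩

/-- A bipartite Ramsey statement for functions on a product. -/
lemma exists_uniform {α β K : Type*} [Fintype α] [Fintype β] [Fintype K] [Nonempty K]
    (col : α → β → K) (q r : ℕ) (hβ : Fintype.card K * r ≤ Fintype.card β)
    (hα : Fintype.card K * Fintype.card β ^ r * q < Fintype.card α) :
    ∃ (a : Fin q → α) (b : Fin r → β) (c : K), Function.Injective a ∧ Function.Injective b ∧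
      ∀ i j, col (a i) (b j) = c := by
  have hstep : ∀ u : α, ∃ z : K × (Fin r → β), Function.Injective z.2 ∧
      ∀ j, col u (z.2 j) = z.1 := by
    intro u
    obtain ⟨c, hc⟩ := Fintype.exists_le_card_fiber_of_mul_le_card (col u) (n := r) hβ
    obtain ⟨f⟩ := Function.Embedding.nonempty_of_card_le (α := Fin r)
      (β := {v // v ∈ (univ.filter fun v => col u v = c)}) (by
        rw [Fintype.card_coe, Fintype.card_fin]
        exact hc)
    refine ⟨(c, fun j => (f j).1), fun j j' hj => f.injective (Subtype.ext hj), fun j => ?_⟩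
    exact (mem_filter.1 (f j).2).2
  choose z hz1 hz2 using hstep
  obtain ⟨⟨c, b⟩, hc⟩ := Fintype.exists_lt_card_fiber_of_mul_lt_card z (n := q) (by
    simpa [Fintype.card_prod, Fintype.card_fun] using hα)
  obtain ⟨f⟩ := Function.Embedding.nonempty_of_card_le (α := Fin q)
      (β := {u // u ∈ (univ.filter fun u => z u = (c, b))}) (by
        rw [Fintype.card_coe, Fintype.card_fin]
        exact hc.le)
  have hf : ∀ i, z (f i).1 = (c, b) := fun i => (mem_filter.1 (f i).2).2
  have hne : (univ.filter fun u => z u = (c, b)).Nonempty := card_pos.1 (by omega)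
  obtain ⟨u, hu⟩ := hne
  have hu' := (mem_filter.1 hu).2
  refine ⟨fun i => (f i).1, b, c, fun i i' hi => f.injective (Subtype.ext hi), ?_, ?_⟩
  · have := hz1 u
    rwa [hu'] at this
  · intro i j
    have := hz2 (f i).1 j
    rwa [hf i] at this

theorem Net.bs_of_card {α β : Type*} [Fintype α] [Fintype β] {p R h : ℕ} {ρ : α ⊕ β → V}
    {D : (α ⊕ β) × Fin p → Set V}
    {Q : (α × Fin p) × (β × Fin p) → Set V} {lab : (α × Fin p) × (β × Fin p) → ℕ}
    (hN : Net G α β p R ρ D Q lab) (hh : 1 ≤ h) (hp : 2 * (h * h) ≤ p)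
    (hβ : (R + 1) ^ (2 * p) * (h * h * p) ≤ Fintype.card β)
    (hα : (R + 1) ^ (2 * p) * Fintype.card β ^ (h * h * p) * (h + h * h * p) < Fintype.card α) :
    BS G h := by
  have hp2 : 2 ≤ p := by nlinarith
  let ar : Fin 2 → Fin p := Fin.castLE hp2
  have hK : Fintype.card (Fin p × Fin 2 → Fin (R + 1)) = (R + 1) ^ (2 * p) := by
    simp [mul_comm]
  obtain ⟨a, b, c, ha, hb, hc⟩ := exists_uniform (K := Fin p × Fin 2 → Fin (R + 1))
    (fun (u : α) (v : β) x => ⟨lab ((u, x.1), (v, ar x.2)), by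
      have := (hN.lab_le ((u, x.1), (v, ar x.2))).2
      omega⟩) (h + h * h * p) (h * h * p) (by rwa [hK]) (by rwa [hK])
  have e1 : Fintype.card (Fin h ⊕ ((Fin h × Fin h) × Fin p)) = h + h * h * p := by simp
  have e2 : Fintype.card ((Fin h × Fin h) × Fin p) = h * h * p := by simp
  refine hN.bs hh hp (a ∘ Fintype.equivFinOfCardEq e1) (ha.comp (Equiv.injective _))
    (b ∘ Fintype.equivFinOfCardEq e2) (hb.comp (Equiv.injective _)) ar
    (Fin.castLE_injective hp2) (fun j ε => (c (j, ε) : ℕ)) ?_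
  intro u v j ε
  have := congrFun (hc (Fintype.equivFinOfCardEq e1 u) (Fintype.equivFinOfCardEq e2 v)) (j, ε)
  exact congrArg Fin.val this

end
section
open scoped Classical

lemma clk_pow_le {y : ℕ} (hy : 2 ^ 100 ≤ y) : clk (y ^ 6) ≤ y ^ 19 := by
  refine (clk_le _).trans ?_
  have h3 : 3 ≤ y ^ 6 := le_trans (by norm_num) (Nat.pow_le_pow_left hy 6)
  calc 16 * (y ^ 6 + 3) ^ 3 ≤ 16 * (2 * y ^ 6) ^ 3 := by gcongr; omega
    _ = 128 * y ^ 18 := by ring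
    _ ≤ y * y ^ 18 := Nat.mul_le_mul_right _ (le_trans (by norm_num) hy)
    _ = y ^ 19 := by ring

lemma pow_pow_le_two_pow {y m : ℕ} (hy : 2 ^ 100 ≤ y) (hm : m ^ 2 ≤ y) : y ^ m ≤ 2 ^ y := by
  set r := Nat.sqrt y with hr
  have hr1 : 2 ^ 50 ≤ r := Nat.le_sqrt'.2 (by rw [← pow_mul]; exact hy)
  have hmr : m ≤ r := Nat.le_sqrt'.2 hm
  have hyr : y ≤ (r + 1) ^ 2 := (Nat.lt_succ_sqrt' y).le
  have hrr : (r + 1) ^ 2 ≤ 2 ^ r := by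
    have := poly_le_two_pow (K := 2) (h := 1) (b₀ := 16) (b := r) (by norm_num) (by norm_num)
      (le_trans (by norm_num) hr1)
    refine le_trans (Nat.pow_le_pow_left ?_ 2) this
    omega
  have hry : r * r ≤ y := by rw [← sq]; exact Nat.sqrt_le' y
  calc y ^ m ≤ y ^ r := Nat.pow_le_pow_right (by omega) hmr
    _ ≤ (2 ^ r) ^ r := Nat.pow_le_pow_left (hyr.trans hrr) r
    _ = 2 ^ (r * r) := by rw [pow_mul]
    _ ≤ 2 ^ y := Nat.pow_le_pow_right (by norm_num) hry

/-- Size estimate for the outer cells. -/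
lemma outer_size {y M L n : ℕ} (hy : 2 ^ 100 ≤ y) (hM : M ≤ 2 ^ y) (hL : L ≤ 2 ^ y)
    (hn : 2 ^ (y ^ 40) ≤ n) :
    M * (2 ^ (y ^ 6 + 1) + 1) ^ clk (y ^ 6) *
      (1 + 2 ^ (y ^ 6) * ((2 * clk (y ^ 6) + 2) * L)) ^ clk (y ^ 6) < n := by
  refine lt_of_lt_of_le ?_ hn
  have hc := clk_pow_le hy
  set c := clk (y ^ 6)
  have hy19 : 2 * c + 2 ≤ 2 ^ y := by
    refine le_trans ?_ (pow_pow_le_two_pow (m := 20) hy (le_trans (by norm_num) hy))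
    have : 1 ≤ y ^ 19 := Nat.one_le_pow _ _ (by omega)
    calc 2 * c + 2 ≤ 4 * y ^ 19 := by omega
      _ ≤ y * y ^ 19 := Nat.mul_le_mul_right _ (le_trans (by norm_num) hy)
      _ = y ^ 20 := by ring
  have h1 : 2 ^ (y ^ 6 + 1) + 1 ≤ 2 ^ (y ^ 6 + 2) := by
    have : 0 < 2 ^ (y ^ 6) := by positivity
    rw [pow_add, pow_add]; omega
  have h2 : 1 + 2 ^ (y ^ 6) * ((2 * c + 2) * L) ≤ 2 ^ (y ^ 6 + 2 * y + 1) := by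
    calc 1 + 2 ^ (y ^ 6) * ((2 * c + 2) * L) ≤ 1 + 2 ^ (y ^ 6) * (2 ^ y * 2 ^ y) := by gcongr
      _ = 1 + 2 ^ (y ^ 6 + 2 * y) := by rw [pow_add, two_mul, pow_add]
      _ ≤ 2 ^ (y ^ 6 + 2 * y + 1) := by
        have : 0 < 2 ^ (y ^ 6 + 2 * y) := by positivity
        rw [pow_succ 2 (y ^ 6 + 2 * y)]; omega
  have h3 : y + (y ^ 6 + 2) * y ^ 19 + (y ^ 6 + 2 * y + 1) * y ^ 19 < y ^ 40 := by
    have hy1 : 1 ≤ y := by omega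
    have a1 : y ^ 6 + 2 ≤ 3 * y ^ 6 := by
      have : 1 ≤ y ^ 6 := Nat.one_le_pow _ _ (by omega)
      omega
    have a2 : y ^ 6 + 2 * y + 1 ≤ 4 * y ^ 6 := by
      have b1 : 1 ≤ y ^ 6 := Nat.one_le_pow _ _ (by omega)
      have b2 : y ≤ y ^ 6 := Nat.le_self_pow (by norm_num) y
      omega
    have a3 : y ≤ y ^ 25 := Nat.le_self_pow (by norm_num) y
    calc _ ≤ y ^ 25 + 3 * y ^ 6 * y ^ 19 + 4 * y ^ 6 * y ^ 19 := by gcongr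
      _ = 8 * y ^ 25 := by ring
      _ < y * y ^ 25 := Nat.mul_lt_mul_of_pos_right (lt_of_lt_of_le (by norm_num) hy) (by positivity)
      _ = y ^ 26 := by ring
      _ ≤ y ^ 40 := Nat.pow_le_pow_right hy1 (by norm_num)
  calc _ ≤ 2 ^ y * (2 ^ (y ^ 6 + 2)) ^ c * (2 ^ (y ^ 6 + 2 * y + 1)) ^ c := by gcongr
    _ ≤ 2 ^ y * (2 ^ (y ^ 6 + 2)) ^ (y ^ 19) * (2 ^ (y ^ 6 + 2 * y + 1)) ^ (y ^ 19) := by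
      gcongr <;> exact Nat.one_le_two_pow
    _ = 2 ^ (y + (y ^ 6 + 2) * y ^ 19 + (y ^ 6 + 2 * y + 1) * y ^ 19) := by
      rw [← pow_mul, ← pow_mul, ← pow_add, ← pow_add]
    _ < 2 ^ (y ^ 40) := Nat.pow_lt_pow_right (by norm_num) h3

/-- Size estimate for the inner cells. -/
lemma inner_size {y M w g : ℕ} (hy : 2 ^ 100 ≤ y) (hM : M ≤ 2 ^ y) (hw : w ≤ 2 ^ y)
    (hg : 2 * g ≤ 2 ^ y) :
    2 * g * (w + M * (2 ^ (y + 1) + 1) ^ clk y) ≤ 2 ^ (y ^ 6) := by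
  have hc : clk y ≤ y ^ 4 := by
    refine (clk_le _).trans ?_
    calc 16 * (y + 3) ^ 3 ≤ 16 * (2 * y) ^ 3 := by gcongr; omega
      _ = 128 * y ^ 3 := by ring
      _ ≤ y * y ^ 3 := Nat.mul_le_mul_right _ (le_trans (by norm_num) hy)
      _ = y ^ 4 := by ring
  have h1 : 2 ^ (y + 1) + 1 ≤ 2 ^ (y + 2) := by
    have : 0 < 2 ^ y := by positivity
    rw [pow_add, pow_add]; omega
  have h4 : 1 ≤ (2 ^ (y + 2)) ^ (y ^ 4) := Nat.one_le_pow _ _ (by positivity)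
  have h3 : y + 1 + y + (y + 2) * y ^ 4 ≤ y ^ 6 := by
    have a3 : y ≤ y ^ 5 := Nat.le_self_pow (by norm_num) y
    have a4 : 1 ≤ y ^ 5 := Nat.one_le_pow _ _ (by omega)
    calc y + 1 + y + (y + 2) * y ^ 4 ≤ y ^ 5 + y ^ 5 + y ^ 5 + (y + 2 * y) * y ^ 4 := by
          gcongr; omega
      _ = 6 * y ^ 5 := by ring
      _ ≤ y * y ^ 5 := Nat.mul_le_mul_right _ (le_trans (by norm_num) hy)
      _ = y ^ 6 := by ring
  calc 2 * g * (w + M * (2 ^ (y + 1) + 1) ^ clk y)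
      ≤ 2 ^ y * (2 ^ y + 2 ^ y * (2 ^ (y + 2)) ^ (y ^ 4)) := by
        gcongr
        exact Nat.one_le_two_pow
    _ ≤ 2 ^ y * (2 ^ y * (2 ^ (y + 2)) ^ (y ^ 4) + 2 ^ y * (2 ^ (y + 2)) ^ (y ^ 4)) := by
        gcongr
        exact Nat.le_mul_of_pos_right _ h4
    _ = 2 ^ (y + 1 + y + (y + 2) * y ^ 4) := by
        rw [pow_add 2 (y + 1 + y), pow_add 2 (y + 1), pow_add 2 y 1, pow_mul]; ring
    _ ≤ 2 ^ (y ^ 6) := Nat.pow_le_pow_right (by norm_num) h3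

/-- Size estimates for the two sides of the net. -/
lemma net_size {h y R' : ℕ} (hh : 8000 ≤ h) (hy : h ^ 15 ≤ y) (hR : R' + 1 ≤ y ^ 128)
    {mβ mα : ℕ} (hβ : mβ = (R' + 1) ^ (2 * (2 * (h * h))) * (h * h * (2 * (h * h))))
    (hα : mα = (R' + 1) ^ (2 * (2 * (h * h))) * mβ ^ (h * h * (2 * (h * h))) *
      (h + h * h * (2 * (h * h))) + 1) :
    mβ ≤ y ^ (1600 * h ^ 6) ∧ mα ≤ y ^ (1600 * h ^ 6) := by
  have hh1 : 1 ≤ h := by omega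
  have hpow : ∀ i, 1 ≤ h ^ i := fun i => Nat.one_le_pow _ _ hh1
  have hy5 : h ^ 5 ≤ y := (Nat.pow_le_pow_right hh1 (by norm_num)).trans hy
  have hy1 : 1 ≤ y := (hpow 5).trans hy5
  have h2 : h * h * (2 * (h * h)) ≤ y := by
    refine le_trans ?_ hy5
    calc h * h * (2 * (h * h)) = 2 * h ^ 4 := by ring
      _ ≤ h * h ^ 4 := Nat.mul_le_mul_right _ (by omega)
      _ = h ^ 5 := by ring
  have h3 : h + h * h * (2 * (h * h)) ≤ y := by
    refine le_trans ?_ hy5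
    calc h + h * h * (2 * (h * h)) = h + 2 * h ^ 4 := by ring
      _ ≤ h ^ 4 + 2 * h ^ 4 := by gcongr; exact Nat.le_self_pow (by norm_num) h
      _ = 3 * h ^ 4 := by ring
      _ ≤ h * h ^ 4 := Nat.mul_le_mul_right _ (by omega)
      _ = h ^ 5 := by ring
  have h4 : (R' + 1) ^ (2 * (2 * (h * h))) ≤ y ^ (512 * h ^ 2) := by
    calc (R' + 1) ^ (2 * (2 * (h * h))) ≤ (y ^ 128) ^ (2 * (2 * (h * h))) := by gcongr
      _ = y ^ (512 * h ^ 2) := by rw [← pow_mul]; congr 1; ring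
  have hb : mβ ≤ y ^ (513 * h ^ 2) := by
    rw [hβ]
    calc _ ≤ y ^ (512 * h ^ 2) * y := by gcongr
      _ = y ^ (512 * h ^ 2 + 1) := (pow_succ _ _).symm
      _ ≤ y ^ (513 * h ^ 2) := Nat.pow_le_pow_right hy1 (by have := hpow 2; omega)
  have h26 : h ^ 2 ≤ h ^ 6 := Nat.pow_le_pow_right hh1 (by norm_num)
  have hp6 := hpow 6
  refine ⟨hb.trans (Nat.pow_le_pow_right hy1 (by omega)), ?_⟩
  have h5 : mβ ^ (h * h * (2 * (h * h))) ≤ y ^ (1026 * h ^ 6) := by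
    calc _ ≤ (y ^ (513 * h ^ 2)) ^ (h * h * (2 * (h * h))) := by gcongr
      _ = y ^ (1026 * h ^ 6) := by rw [← pow_mul]; congr 1; ring
  have h6 : 1 ≤ y ^ (512 * h ^ 2) * y ^ (1026 * h ^ 6) * y := by
    have := Nat.pos_of_ne_zero (n := y ^ (512 * h ^ 2) * y ^ (1026 * h ^ 6) * y) (by
      positivity)
    omega
  have hy2 : 2 ≤ y := by
    have : h ≤ h ^ 5 := Nat.le_self_pow (by norm_num) h
    omega
  rw [hα]
  calc _ ≤ y ^ (512 * h ^ 2) * y ^ (1026 * h ^ 6) * y + 1 := by gcongr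
    _ ≤ (y ^ (512 * h ^ 2) * y ^ (1026 * h ^ 6) * y) * 2 := by omega
    _ ≤ (y ^ (512 * h ^ 2) * y ^ (1026 * h ^ 6) * y) * y := by gcongr
    _ = y ^ (512 * h ^ 2 + 1026 * h ^ 6 + 1 + 1) := by
      rw [pow_succ y (512 * h ^ 2 + 1026 * h ^ 6 + 1), pow_succ y (512 * h ^ 2 + 1026 * h ^ 6), pow_add]
    _ ≤ y ^ (1600 * h ^ 6) := Nat.pow_le_pow_right hy1 (by omega)

lemma exists_root (N : ℕ) : ∃ y, y ^ 40 ≤ N ∧ N < (y + 1) ^ 40 := by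
  have hex : ∃ y, N < (y + 1) ^ 40 :=
    ⟨N, lt_of_lt_of_le (Nat.lt_succ_self N) (Nat.le_self_pow (by norm_num) _)⟩
  refine ⟨Nat.find hex, ?_, Nat.find_spec hex⟩
  rcases hz : Nat.find hex with _ | m
  · simp
  · by_contra hc
    have := Nat.find_min hex (m := m) (by omega)
    omega

set_option maxHeartbeats 1000000 in
theorem Expander.bs_of_pow {V : Type*} [Fintype V] [Nonempty V] {G : SimpleGraph V} {h : ℕ}
    (hh : 2 ^ 100 ≤ h) (hlog : h ^ 100 * 8 ≤ 2 ^ h) (hG : Expander G (h ^ 30100)) : BS G h := by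
  by_contra hBS
  have hh1 : 1 ≤ h := le_trans (by norm_num) hh
  have hh8 : 8000 ≤ h := le_trans (by norm_num) hh
  set n := Fintype.card V with hn
  set N := Nat.log 2 n with hN
  have hdN : h ^ 30100 < (h * (N + 3)) ^ 50 := by
    by_contra hc
    exact hBS (hG.bs hh1 (not_lt.1 hc))
  obtain ⟨y, hy1, hy2⟩ := exists_root N
  have hN3 : N + 3 ≤ 4 * (y + 1) ^ 40 := by
    have : 1 ≤ (y + 1) ^ 40 := Nat.one_le_pow _ _ (by omega)
    omega
  have hyh : h ^ 15 ≤ y := by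
    by_contra hc
    have hc' : y + 1 ≤ h ^ 15 := by omega
    have : (h * (N + 3)) ^ 50 ≤ h ^ 30100 := by
      calc (h * (N + 3)) ^ 50 ≤ (h * (h * (h ^ 15) ^ 40)) ^ 50 := by
            gcongr
            refine hN3.trans (Nat.mul_le_mul (by omega) ?_)
            exact Nat.pow_le_pow_left hc' 40
        _ = h ^ 30100 := by rw [← pow_mul, ← pow_succ', ← pow_succ', ← pow_mul]
    omega
  have hhy : h ≤ y := (Nat.le_self_pow (by norm_num) h).trans hyh
  have hy : 2 ^ 100 ≤ y := hh.trans hhy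
  have hypos : 1 ≤ y := by omega
  have hp2 : ∀ m, m ≤ 2 ^ 50 → y ^ m ≤ 2 ^ y := fun m hm => pow_pow_le_two_pow hy (by
    refine le_trans (Nat.pow_le_pow_left hm 2) (le_trans (by norm_num) hy))
  have hN42 : N + 3 ≤ y ^ 42 := by
    calc N + 3 ≤ 4 * (y + 1) ^ 40 := hN3
      _ ≤ 4 * (2 * y) ^ 40 := by gcongr; omega
      _ = 2 ^ 42 * y ^ 40 := by ring
      _ ≤ (y * y) * y ^ 40 := by
        gcongr
        exact le_trans (le_trans (by norm_num) hy) (Nat.le_mul_of_pos_left y hypos)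
      _ = y ^ 42 := by ring
  set b₀ := Nat.log 2 (h ^ 100) with hb₀
  have hb1 : 2 ^ b₀ ≤ h ^ 100 := Nat.pow_log_le_self 2 (by positivity)
  have hb2 : h ^ 100 < 2 ^ (b₀ + 1) := Nat.lt_pow_succ_log_self (by norm_num) _
  have hb3 : b₀ + 3 ≤ h := by
    refine (Nat.pow_le_pow_iff_right (a := 2) (by norm_num)).1 ?_
    calc 2 ^ (b₀ + 3) = 2 ^ b₀ * 8 := by rw [pow_add]; norm_num
      _ ≤ h ^ 100 * 8 := by gcongr
      _ ≤ 2 ^ h := hlog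
  have hb4 : 80 ≤ b₀ := by
    refine Nat.le_log_of_pow_le (by norm_num) ?_
    exact le_trans (Nat.pow_le_pow_right (by norm_num) (by norm_num : 80 ≤ 100))
      (hh.trans (Nat.le_self_pow (by norm_num) h))
  have hpoly : (h * (b₀ + 4)) ^ 40 ≤ 2 ^ b₀ := by
    have h1 : (h * (b₀ + 4)) ^ 40 * 2 ≤ h ^ 100 := by
      calc (h * (b₀ + 4)) ^ 40 * 2 ≤ (h * (2 * h)) ^ 40 * 2 := by gcongr; omega
        _ = 2 ^ 41 * h ^ 80 := by ring
        _ ≤ h ^ 20 * h ^ 80 := Nat.mul_le_mul_right _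
          (le_trans (le_trans (by norm_num) hh) (Nat.le_self_pow (n := 20) (by norm_num) h))
        _ = h ^ 100 := by rw [← pow_add]
    rw [pow_succ 2 b₀] at hb2
    omega
  set R := 2 * clk (y ^ 6) + 32 * (N + 3) ^ 3 with hR
  have hR1 : R ≤ y ^ 127 := by
    have h1 := clk_pow_le hy
    have h2 : (N + 3) ^ 3 ≤ y ^ 126 := by
      calc (N + 3) ^ 3 ≤ (y ^ 42) ^ 3 := by gcongr
        _ = y ^ 126 := by ring
    have h3 : y ^ 19 ≤ y ^ 126 := Nat.pow_le_pow_right hypos (by norm_num)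
    calc R ≤ 34 * y ^ 126 := by omega
      _ ≤ y * y ^ 126 := Nat.mul_le_mul_right _ (le_trans (by norm_num) hy)
      _ = y ^ 127 := by ring
  set R' := 3 * R + 4 * clk y with hR'
  have hR'1 : R' + 1 ≤ y ^ 128 := by
    have h1 : clk y ≤ y ^ 127 := by
      refine le_trans (clk_mono (Nat.le_self_pow (by norm_num : (6 : ℕ) ≠ 0) y)) ?_
      exact (clk_pow_le hy).trans (Nat.pow_le_pow_right hypos (by norm_num))
    have h2 : 1 ≤ y ^ 127 := Nat.one_le_pow _ _ hypos
    calc R' + 1 ≤ 8 * y ^ 127 := by omega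
      _ ≤ y * y ^ 127 := Nat.mul_le_mul_right _ (le_trans (by norm_num) hy)
      _ = y ^ 128 := by ring
  set mβ := (R' + 1) ^ (2 * (2 * (h * h))) * (h * h * (2 * (h * h))) with hmβ
  set mα := (R' + 1) ^ (2 * (2 * (h * h))) * mβ ^ (h * h * (2 * (h * h))) *
      (h + h * h * (2 * (h * h))) + 1 with hmα
  obtain ⟨hβX, hαX⟩ := net_size hh8 hyh hR'1 hmβ hmα
  clear_value R' mβ mα
  set X := y ^ (1600 * h ^ 6) with hX
  set w := y ^ (4000 * h ^ 6) with hw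
  have hX1 : 1 ≤ X := Nat.one_le_pow _ _ hypos
  have hp6 : 1 ≤ h ^ 6 := Nat.one_le_pow _ _ hh1
  have hXw : X ^ 2 * y ^ 131 ≤ w := by
    rw [hX, hw, ← pow_mul, ← pow_add]
    exact Nat.pow_le_pow_right hypos (by omega)
  have hp : 2 * (h * h) ≤ y := by
    refine le_trans ?_ hyh
    calc 2 * (h * h) ≤ h * (h * h) := Nat.mul_le_mul_right _ (by omega)
      _ = h ^ 3 := by ring
      _ ≤ h ^ 15 := Nat.pow_le_pow_right hh1 (by norm_num)
  have hp1 : 1 ≤ 2 * (h * h) := by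
    have := Nat.mul_pos hh1 hh1
    omega
  set p := 2 * (h * h) with hpdef
  have hw2 : w ^ 2 ≤ 2 ^ y := by
    rw [hw, ← pow_mul]
    refine (Nat.pow_le_pow_right hypos ?_ : _ ≤ y ^ (h ^ 7)).trans (pow_pow_le_two_pow hy ?_)
    · calc 4000 * h ^ 6 * 2 = 8000 * h ^ 6 := by ring
        _ ≤ h * h ^ 6 := Nat.mul_le_mul_right _ hh8
        _ = h ^ 7 := by ring
    · rw [← pow_mul]
      exact (Nat.pow_le_pow_right hh1 (by norm_num)).trans hyh
  have hw1 : w ≤ 2 ^ y := (Nat.le_self_pow (by norm_num) w).trans hw2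
  have hκ : Fintype.card ((Fin mα ⊕ Fin mβ) × Option (Fin p)) ≤ 2 ^ y := by
    simp only [Fintype.card_prod, Fintype.card_sum, Fintype.card_fin, Fintype.card_option]
    refine le_trans ?_ (hXw.trans hw1)
    calc (mα + mβ) * (p + 1) ≤ (X + X) * (y + y) := by gcongr
      _ = X * (4 * y) := by ring
      _ ≤ X ^ 2 * (y ^ 130 * y) := by
        gcongr
        · exact Nat.le_self_pow (by norm_num) X
        · exact le_trans (le_trans (by norm_num) hy) (Nat.le_self_pow (by norm_num) y)
      _ = X ^ 2 * y ^ 131 := by ring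
  have hwR : Fintype.card ((Fin mα ⊕ Fin mβ) × Fin p) * R +
      Fintype.card ((Fin mα × Fin p) × (Fin mβ × Fin p)) * R ≤ w := by
    simp only [Fintype.card_prod, Fintype.card_sum, Fintype.card_fin]
    refine le_trans ?_ hXw
    have hXX : X ≤ X ^ 2 := Nat.le_self_pow (by norm_num) X
    have hyy : y ≤ y ^ 2 := Nat.le_self_pow (by norm_num) y
    calc (mα + mβ) * p * R + mα * p * (mβ * p) * R
        ≤ (X + X) * y * y ^ 127 + X * y * (X * y) * y ^ 127 := by gcongr
      _ = 2 * (X * y * y ^ 127) + X ^ 2 * y ^ 2 * y ^ 127 := by ring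
      _ ≤ 2 * (X ^ 2 * y ^ 2 * y ^ 127) + X ^ 2 * y ^ 2 * y ^ 127 := by gcongr
      _ = 3 * (X ^ 2 * y ^ 129) := by ring
      _ ≤ y ^ 2 * (X ^ 2 * y ^ 129) := by
        gcongr
        exact le_trans (le_trans (by norm_num) hy) hyy
      _ = X ^ 2 * y ^ 131 := by ring
  have hn2 : 2 ^ (y ^ 40) ≤ n :=
    (Nat.pow_le_pow_right (by norm_num) hy1).trans (Nat.pow_log_le_self 2 Fintype.card_ne_zero)
  have hlam : lam V h ≤ 2 ^ y := by
    refine le_trans ?_ (hp2 (43 * 52) (by norm_num))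
    rw [pow_mul]
    refine Nat.pow_le_pow_left ?_ 52
    calc h * (N + 3) ≤ y * y ^ 42 := Nat.mul_le_mul hhy hN42
      _ = y ^ 43 := by ring
  have hg : 2 * gN n ≤ 2 ^ y := by
    refine le_trans ?_ (hp2 85 (by norm_num))
    calc 2 * gN n = 16 * (N + 3) ^ 2 := by rw [gN]; ring
      _ ≤ y * (y ^ 42) ^ 2 := by
        gcongr
        exact le_trans (by norm_num) hy
      _ = y ^ 85 := by ring
  obtain ⟨c, I, hC⟩ := exists_cellSys (κ := (Fin mα ⊕ Fin mβ) × Option (Fin p)) (p := p) (w := w)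
    (b₀ := b₀) (y := y) (y₂ := y ^ 6) hG hh1 hBS (by
      calc p ≤ h * (h * h) := Nat.mul_le_mul_right _ (by omega)
        _ = h ^ 3 := by ring
        _ ≤ h ^ 4 := Nat.pow_le_pow_right hh1 (by norm_num)) hw2 hb4 hpoly (by
      calc 2 ^ (b₀ + 1) = 2 ^ b₀ * 2 := pow_succ _ _
        _ ≤ h ^ 100 * h := Nat.mul_le_mul hb1 (by omega)
        _ = h ^ 101 := by ring
        _ ≤ h ^ 30100 := Nat.pow_le_pow_right hh1 (by norm_num)) (by omega)
    (Nat.le_self_pow (by norm_num) y) (by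
      refine le_trans (Nat.pow_le_pow_right (by norm_num) ?_) hn2
      calc y ^ 6 + 1 ≤ 2 * y ^ 6 := by
            have : 1 ≤ y ^ 6 := Nat.one_le_pow _ _ hypos
            omega
        _ ≤ y * y ^ 6 := Nat.mul_le_mul_right _ (le_trans (by norm_num) hy)
        _ = y ^ 7 := by ring
        _ ≤ y ^ 40 := Nat.pow_le_pow_right hypos (by norm_num))
    (outer_size hy hκ hlam hn2) (inner_size hy hκ hw1 hg)
  obtain ⟨ρ, D, Q, lab, hnet⟩ := hC.exists_net hwR
  rw [← hR'] at hnet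
  refine hBS (hnet.bs_of_card hh1 le_rfl ?_ ?_)
  · rw [Fintype.card_fin, hmβ]
  · rw [Fintype.card_fin, Fintype.card_fin, hmα]
    exact Nat.lt_succ_self _

/-- Graphs of large average degree contain balanced subdivisions of complete graphs. -/
theorem exists_bs : ∃ h₀ : ℕ, ∀ h ≥ h₀, ∀ (V : Type) [Fintype V] [Nonempty V] (G : SimpleGraph V),
    4 * h ^ 30100 * Fintype.card V ≤ e2 G univ → BS G h := by
  have hlim : ∀ᶠ h : ℕ in Filter.atTop, h ^ 100 * 8 ≤ 2 ^ h := by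
    have h1 := tendsto_pow_const_div_const_pow_of_one_lt 100 (one_lt_two : (1 : ℝ) < 2)
    filter_upwards [h1.eventually (gt_mem_nhds (by norm_num : (0 : ℝ) < 1 / 8))] with h hh
    rw [div_lt_div_iff₀ (by positivity) (by norm_num)] at hh
    have : (h : ℝ) ^ 100 * 8 ≤ 2 ^ h := by linarith
    exact_mod_cast this
  obtain ⟨h₁, hh₁⟩ := Filter.eventually_atTop.1 hlim
  refine ⟨max h₁ (2 ^ 100), fun h hh V _ _ G hG => ?_⟩
  have hh2 : 2 ^ 100 ≤ h := (le_max_right _ _).trans hh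
  obtain ⟨U, hU, hE⟩ := exists_expander (G := G) (d := h ^ 30100)
    (Nat.pow_pos (lt_of_lt_of_le (by norm_num) hh2)) hG
  have : Nonempty (U : Set V) := hU.to_subtype
  exact (hE.bs_of_pow hh2 (hh₁ h ((le_max_left _ _).trans hh))).induce

end
section
open scoped Classical

variable {V : Type*} {G : SimpleGraph V}

/-- No two vertices of `I` are adjacent. -/
def Indep {V : Type*} (G : SimpleGraph V) (I : Finset V) : Prop :=
  ∀ u ∈ I, ∀ v ∈ I, ¬ G.Adj u v

/-- There is no induced complete bipartite subgraph with sides of size `s` and `t`. -/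
def NoBip {V : Type*} (G : SimpleGraph V) (s t : ℕ) : Prop :=
  ∀ I J : Finset V, #I = s → #J = t → Indep G I → Indep G J → ¬ ∀ u ∈ I, ∀ v ∈ J, G.Adj u v

lemma exists_indep (G : SimpleGraph V) (b a : ℕ) (S : Finset V) (hS : a ^ b ≤ #S)
    (hC : ∀ C ⊆ S, ¬ G.IsNClique a C) : ∃ I ⊆ S, #I = b ∧ Indep G I := by
  induction b generalizing a S with
  | zero => exact ⟨∅, empty_subset _, rfl, by simp [Indep]⟩
  | succ b ihb =>
    induction a generalizing S with
    | zero => exact absurd (by simp [SimpleGraph.isNClique_iff]) (hC ∅ (empty_subset _))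
    | succ a iha =>
      have hne : S.Nonempty := card_pos.1 (lt_of_lt_of_le (by positivity) hS)
      obtain ⟨v, hv⟩ := hne
      by_cases h1 : a ^ (b + 1) ≤ #{u ∈ S | G.Adj v u}
      · obtain ⟨I, hI, hI'⟩ := iha _ h1 (by
          intro C hCs hcl
          refine hC (insert v C) ?_ ?_
          · exact insert_subset hv (hCs.trans (filter_subset _ _))
          · exact hcl.insert fun u hu => (mem_filter.1 (hCs hu)).2)
        exact ⟨I, hI.trans (filter_subset _ _), hI'⟩
      · have hsum : #S = #{u ∈ S | G.Adj v u} + #{u ∈ S | ¬ G.Adj v u} :=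
          (card_filter_add_card_filter_not _).symm
        have hv' : v ∈ ({u ∈ S | ¬ G.Adj v u} : Finset V) := by simp [hv]
        have hb : (a + 1) ^ b ≤ #(({u ∈ S | ¬ G.Adj v u} : Finset V).erase v) := by
          rw [card_erase_of_mem hv']
          have h2 : a ^ (b + 1) + (a + 1) ^ b ≤ (a + 1) ^ (b + 1) := by
            have : a ^ b ≤ (a + 1) ^ b := Nat.pow_le_pow_left (by omega) b
            rw [pow_succ, pow_succ]
            nlinarith
          omega
        obtain ⟨I, hI, hI1, hI2⟩ := ihb (a + 1) _ hb (by
          intro C hCs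
          exact hC C (hCs.trans ((erase_subset _ _).trans (filter_subset _ _))))
        have hIv : ∀ u ∈ I, u ≠ v ∧ u ∈ S ∧ ¬ G.Adj v u := fun u hu => by
          simpa using hI hu
        refine ⟨insert v I, ?_, ?_, ?_⟩
        · exact insert_subset hv fun u hu => (hIv u hu).2.1
        · rw [card_insert_of_notMem (fun h => (hIv v h).1 rfl), hI1]
        · intro u hu w hw
          rw [mem_insert] at hu hw
          rcases hu with rfl | hu <;> rcases hw with rfl | hw
          · exact G.loopless.irrefl _
          · exact (hIv w hw).2.2
          · exact fun h => (hIv u hu).2.2 h.symm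
          · exact hI2 u hu w hw

/-- Bipartite pairs are sparse when cliques and induced complete bipartite graphs are missing. -/
lemma sparse_pair {k s t : ℕ} (hs : 1 ≤ s) (hcl : ¬ HasClique G k) (hK : NoBip G s t)
    {X Y : Finset V} (hXY : #X ≤ #Y) (hY : k ^ (2 * t) ≤ #Y) :
    #X * #{z ∈ X ×ˢ Y | G.Adj z.1 z.2} ^ (2 * s) ≤ (k ^ s + 1) * (#X * #Y) ^ (2 * s) := by
  set Ω := Fintype.piFinset (fun _ : Fin (2 * s) => Y) with hΩ
  have hΩc : #Ω = #Y ^ (2 * s) := by simp [hΩ]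
  set C : (Fin (2 * s) → V) → Finset V := fun y => {a ∈ X | ∀ i, G.Adj a (y i)} with hCdef
  set bad : Finset (Finset V) :=
    {A ∈ X.powersetCard s | #{v ∈ Y | ∀ a ∈ A, G.Adj a v} < k ^ t} with hbad
  have hcl' : ∀ C : Finset V, ¬ G.IsNClique k C := fun C hC => hcl ⟨C, hC⟩
  have hpt : ∀ y, #(C y) ≤ #{A ∈ bad | A ⊆ C y} + k ^ s := by
    intro y
    by_contra hc
    push Not at hc
    have hne : ∀ A ∈ bad, A.Nonempty := by
      intro A hA
      have := (mem_powersetCard.1 (mem_filter.1 hA).1).2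
      exact card_pos.1 (by omega)
    have : Nonempty V := by
      obtain ⟨v, _⟩ : (C y).Nonempty := card_pos.1 (by omega)
      exact ⟨v⟩
    choose! rep hrep using hne
    have hc' : k ^ s ≤ #(C y \ image rep {A ∈ bad | A ⊆ C y}) := by
      have h1 := le_card_sdiff (image rep {A ∈ bad | A ⊆ C y}) (C y)
      have h2 : #(image rep {A ∈ bad | A ⊆ C y}) ≤ #{A ∈ bad | A ⊆ C y} := card_image_le
      omega
    obtain ⟨I, hI, hI1, hI2⟩ := exists_indep G s k _ hc' fun C _ => hcl' C
    have hIC : I ⊆ C y := hI.trans sdiff_subset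
    have hIX : I ⊆ X := hIC.trans (filter_subset _ _)
    have hIbad : I ∉ bad := by
      intro hb
      have h1 := hrep I hb
      have h2 := (mem_sdiff.1 (hI h1)).2
      exact h2 (mem_image.2 ⟨I, mem_filter.2 ⟨hb, hIC⟩, rfl⟩)
    have hZ : k ^ t ≤ #{v ∈ Y | ∀ a ∈ I, G.Adj a v} := by
      by_contra hc
      exact hIbad (mem_filter.2 ⟨mem_powersetCard.2 ⟨hIX, hI1⟩, not_le.1 hc⟩)
    obtain ⟨J, hJ, hJ1, hJ2⟩ := exists_indep G t k _ hZ fun C _ => hcl' C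
    exact hK I J hI1 hJ1 hI2 hJ2 fun u hu v hv => (mem_filter.1 (hJ hv)).2 u hu
  have hsum : ∑ y ∈ Ω, #(C y) ≤ ∑ y ∈ Ω, #{A ∈ bad | A ⊆ C y} + k ^ s * #Y ^ (2 * s) := by
    refine (sum_le_sum fun y _ => hpt y).trans (le_of_eq ?_)
    rw [sum_add_distrib, sum_const, smul_eq_mul, hΩc, mul_comm (k ^ s)]
  have hbadsum : ∑ y ∈ Ω, #{A ∈ bad | A ⊆ C y} ≤ #Y ^ (2 * s) := by
    simp only [card_filter]
    rw [sum_comm]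
    have h1 : ∀ A ∈ bad, ∑ y ∈ Ω, (if A ⊆ C y then 1 else 0) ≤ (k ^ t) ^ (2 * s) := by
      intro A hA
      rw [← card_filter]
      have hlt := (mem_filter.1 hA).2
      calc #{y ∈ Ω | A ⊆ C y}
          ≤ #(Fintype.piFinset fun _ : Fin (2 * s) => {v ∈ Y | ∀ a ∈ A, G.Adj a v}) := by
            refine card_le_card fun y hy => ?_
            obtain ⟨hy1, hy2⟩ := mem_filter.1 hy
            rw [Fintype.mem_piFinset] at hy1 ⊢
            exact fun i => mem_filter.2 ⟨hy1 i, fun a ha => (mem_filter.1 (hy2 ha)).2 i⟩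
        _ = #{v ∈ Y | ∀ a ∈ A, G.Adj a v} ^ (2 * s) := by simp
        _ ≤ (k ^ t) ^ (2 * s) := Nat.pow_le_pow_left hlt.le _
    have h2 : #bad ≤ #X ^ s := by
      refine (card_filter_le _ _).trans ?_
      rw [card_powersetCard]
      exact Nat.choose_le_pow _ _
    calc _ ≤ ∑ A ∈ bad, (k ^ t) ^ (2 * s) := sum_le_sum h1
      _ = #bad * (k ^ (2 * t)) ^ s := by
        rw [sum_const, smul_eq_mul, ← pow_mul, ← pow_mul]; congr 2; ring
      _ ≤ #Y ^ s * #Y ^ s := Nat.mul_le_mul (h2.trans (Nat.pow_le_pow_left hXY s))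
        (Nat.pow_le_pow_left hY s)
      _ = #Y ^ (2 * s) := by rw [← pow_add]; congr 1; ring
  have hCsum : ∑ y ∈ Ω, #(C y) = ∑ a ∈ X, #{v ∈ Y | G.Adj a v} ^ (2 * s) := by
    simp only [hCdef, card_filter _ X]
    rw [sum_comm]
    refine sum_congr rfl fun a _ => ?_
    rw [← card_filter]
    have : ({y ∈ Ω | ∀ i, G.Adj a (y i)} : Finset (Fin (2 * s) → V)) =
        Fintype.piFinset fun _ : Fin (2 * s) => {v ∈ Y | G.Adj a v} := by
      ext y
      simp only [hΩ, mem_filter, Fintype.mem_piFinset]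
      exact ⟨fun h i => ⟨h.1 i, h.2 i⟩, fun h => ⟨fun i => (h i).1, fun i => (h i).2⟩⟩
    rw [this]
    simp
  have hE : #{z ∈ X ×ˢ Y | G.Adj z.1 z.2} = ∑ a ∈ X, #{v ∈ Y | G.Adj a v} := by
    rw [card_filter, sum_product]
    simp only [card_filter]
  have hpow : (∑ a ∈ X, #{v ∈ Y | G.Adj a v}) ^ (2 * s) ≤
      #X ^ (2 * s - 1) * ∑ a ∈ X, #{v ∈ Y | G.Adj a v} ^ (2 * s) := by
    obtain ⟨m, hm⟩ : ∃ m, 2 * s = m + 1 := ⟨2 * s - 1, by omega⟩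
    rw [hm]
    rw [Nat.add_sub_cancel]
    exact pow_sum_le_card_mul_sum_pow (fun _ _ => Nat.zero_le _) m
  rw [hE]
  calc _ ≤ #X * (#X ^ (2 * s - 1) * ∑ a ∈ X, #{v ∈ Y | G.Adj a v} ^ (2 * s)) :=
        Nat.mul_le_mul_left _ hpow
    _ = #X ^ (2 * s) * ∑ y ∈ Ω, #(C y) := by
      rw [hCsum, ← mul_assoc, ← pow_succ']
      congr 2
      omega
    _ ≤ #X ^ (2 * s) * (#Y ^ (2 * s) + k ^ s * #Y ^ (2 * s)) :=
      Nat.mul_le_mul_left _ (hsum.trans (Nat.add_le_add_right hbadsum _))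
    _ = (k ^ s + 1) * (#X * #Y) ^ (2 * s) := by rw [mul_pow]; ring

end
section
open scoped Classical

variable {ι κ : Type*} [Fintype ι]

lemma card_agree {S : ι → Finset κ} {K : ℕ} (hS : ∀ i, #(S i) = K) (T : Finset ι) (g : ι → κ)
    (hg : ∀ z ∈ T, g z ∈ S z) :
    #{c ∈ Fintype.piFinset S | ∀ z ∈ T, c z = g z} * K ^ #T = K ^ Fintype.card ι := by
  have h1 : ({c ∈ Fintype.piFinset S | ∀ z ∈ T, c z = g z} : Finset (ι → κ)) =
      Fintype.piFinset fun z => if z ∈ T then {g z} else S z := by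
    ext c
    simp only [mem_filter, Fintype.mem_piFinset]
    constructor
    · rintro ⟨h1, h2⟩ z
      by_cases hz : z ∈ T
      · simp [hz, h2 z hz]
      · simpa [hz] using h1 z
    · intro h
      refine ⟨fun z => ?_, fun z hz => ?_⟩
      · have := h z
        by_cases hz : z ∈ T
        · simp only [hz, if_true, mem_singleton] at this
          exact this ▸ hg z hz
        · simpa [hz] using this
      · have := h z
        simpa [hz] using this
  rw [h1, Fintype.card_piFinset]
  have h2 : ∀ z, #(if z ∈ T then {g z} else S z) = if z ∈ T then 1 else K := by
    intro z
    split_ifs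
    · simp
    · exact hS z
  rw [prod_congr rfl fun z _ => h2 z, prod_ite, prod_const_one, one_mul, prod_const, ← pow_add]
  congr 1
  have := card_filter_add_card_filter_not (s := (univ : Finset ι)) (fun z => z ∈ T)
  rw [filter_mem_eq_inter, univ_inter] at this
  rw [add_comm, this, card_univ]

lemma card_pair_mem {S : ι → Finset κ} {K : ℕ} (hS : ∀ i, #(S i) = K) {i j : ι} (hij : i ≠ j)
    {B : Finset (κ × κ)} (hB : B ⊆ S i ×ˢ S j) :
    #{c ∈ Fintype.piFinset S | (c i, c j) ∈ B} * K ^ 2 = #B * K ^ Fintype.card ι := by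
  rw [card_eq_sum_card_fiberwise (f := fun c : ι → κ => (c i, c j)) (t := B)
    (s := {c ∈ Fintype.piFinset S | (c i, c j) ∈ B}) (fun c hc => by simpa using (mem_filter.1 hc).2), sum_mul, ← smul_eq_mul (#B), ← sum_const]
  refine sum_congr rfl fun p hp => ?_
  have hp' := mem_product.1 (hB hp)
  have := card_agree hS {i, j} (fun z => if z = i then p.1 else p.2) (by
    intro z hz
    rw [mem_insert, mem_singleton] at hz
    rcases hz with rfl | rfl
    · simpa using hp'.1
    · simpa [hij.symm] using hp'.2)
  rw [card_pair hij] at this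
  rw [← this]
  congr 2
  ext c
  simp only [mem_filter, mem_insert, mem_singleton, forall_eq_or_imp, forall_eq, if_true,
    hij.symm, if_false]
  constructor
  · rintro ⟨⟨h1, -⟩, rfl⟩
    exact ⟨h1, rfl, rfl⟩
  · rintro ⟨h1, h2, h3⟩
    have : (c i, c j) = p := Prod.ext h2 h3
    exact ⟨⟨h1, this ▸ hp⟩, this⟩

lemma card_triple_mem {S : ι → Finset κ} {K : ℕ} (hS : ∀ i, #(S i) = K) {i j k : ι} (hij : i ≠ j)
    (hik : i ≠ k) (hjk : j ≠ k) {B : Finset (κ × κ × κ)} (hB : B ⊆ S i ×ˢ S j ×ˢ S k) :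
    #{c ∈ Fintype.piFinset S | (c i, c j, c k) ∈ B} * K ^ 3 = #B * K ^ Fintype.card ι := by
  rw [card_eq_sum_card_fiberwise (f := fun c : ι → κ => (c i, c j, c k)) (t := B)
    (s := {c ∈ Fintype.piFinset S | (c i, c j, c k) ∈ B})
    (fun c hc => by simpa using (mem_filter.1 hc).2), sum_mul, ← smul_eq_mul (#B), ← sum_const]
  refine sum_congr rfl fun p hp => ?_
  have hp' := mem_product.1 (hB hp)
  have hp'' := mem_product.1 hp'.2
  have := card_agree hS {i, j, k}
    (fun z => if z = i then p.1 else if z = j then p.2.1 else p.2.2) (by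
    intro z hz
    rw [mem_insert, mem_insert, mem_singleton] at hz
    rcases hz with rfl | rfl | rfl
    · simpa using hp'.1
    · simpa [hij.symm] using hp''.1
    · simpa [hik.symm, hjk.symm] using hp''.2)
  rw [card_eq_three.2 ⟨i, j, k, hij, hik, hjk, rfl⟩] at this
  rw [← this]
  congr 2
  ext c
  simp only [mem_filter, mem_insert, mem_singleton, forall_eq_or_imp, forall_eq, if_true,
    hij.symm, hik.symm, hjk.symm, if_false]
  constructor
  · rintro ⟨⟨h1, -⟩, rfl⟩
    exact ⟨h1, rfl, rfl, rfl⟩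
  · rintro ⟨h1, h2, h3, h4⟩
    have : (c i, c j, c k) = p := Prod.ext h2 (Prod.ext h3 h4)
    exact ⟨⟨h1, this ▸ hp⟩, this⟩

/-- A choice function avoiding few bad pairs and bad triples exists. -/
lemma exists_map_avoid {S : ι → Finset κ} {K : ℕ} (hS : ∀ i, #(S i) = K) (hK : 0 < K)
    (B2 : ι → ι → Finset (κ × κ)) (B3 : ι → ι → ι → Finset (κ × κ × κ))
    (hB2 : ∀ i j, B2 i j ⊆ S i ×ˢ S j) (hB3 : ∀ i j k, B3 i j k ⊆ S i ×ˢ S j ×ˢ S k)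
    (h2 : ∀ i j, 3 * (Fintype.card ι : ℝ) ^ 2 * #(B2 i j) ≤ (K : ℝ) ^ 2)
    (h3 : ∀ i j k, 3 * (Fintype.card ι : ℝ) ^ 3 * #(B3 i j k) ≤ (K : ℝ) ^ 3) :
    ∃ c : ι → κ, (∀ i, c i ∈ S i) ∧ (∀ i j, i ≠ j → (c i, c j) ∉ B2 i j) ∧
      ∀ i j k, i ≠ j → i ≠ k → j ≠ k → (c i, c j, c k) ∉ B3 i j k := by
  by_contra hno
  push Not at hno
  rcases isEmpty_or_nonempty ι with hι | hι
  · obtain ⟨i, -⟩ := hno (fun i => hι.elim i) (fun i => hι.elim i) (fun i => hι.elim i)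
    exact hι.elim i
  set n := Fintype.card ι with hn
  have hn0 : 0 < (n : ℝ) := by exact_mod_cast Fintype.card_pos
  have hK0 : 0 < (K : ℝ) := by exact_mod_cast hK
  set X2 : ι × ι → Finset (ι → κ) := fun p =>
    {c ∈ Fintype.piFinset S | p.1 ≠ p.2 ∧ (c p.1, c p.2) ∈ B2 p.1 p.2} with hX2
  set X3 : ι × ι × ι → Finset (ι → κ) := fun p =>
    {c ∈ Fintype.piFinset S | p.1 ≠ p.2.1 ∧ p.1 ≠ p.2.2 ∧ p.2.1 ≠ p.2.2 ∧
      (c p.1, c p.2.1, c p.2.2) ∈ B3 p.1 p.2.1 p.2.2} with hX3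
  have hcov : Fintype.piFinset S ⊆ univ.biUnion X2 ∪ univ.biUnion X3 := by
    intro c hc
    rw [mem_union, mem_biUnion, mem_biUnion]
    by_cases h : ∀ i j, i ≠ j → (c i, c j) ∉ B2 i j
    · obtain ⟨i, j, k, h1, h2, h3, h4⟩ := hno c (Fintype.mem_piFinset.1 hc) h
      exact Or.inr ⟨(i, j, k), mem_univ _, mem_filter.2 ⟨hc, h1, h2, h3, h4⟩⟩
    · push Not at h
      obtain ⟨i, j, h1, h2⟩ := h
      exact Or.inl ⟨(i, j), mem_univ _, mem_filter.2 ⟨hc, h1, h2⟩⟩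
  have hcard : (#(Fintype.piFinset S) : ℝ) = (K : ℝ) ^ n := by
    rw [Fintype.card_piFinset, prod_congr rfl fun i _ => hS i, prod_const, card_univ]
    push_cast
    rfl
  have b2 : ∀ p, (#(X2 p) : ℝ) ≤ (K : ℝ) ^ n / (3 * (n : ℝ) ^ 2) := by
    intro p
    by_cases hp : p.1 = p.2
    · have : X2 p = ∅ := by simp [hX2, hp]
      rw [this, card_empty, Nat.cast_zero]
      positivity
    have h := card_pair_mem hS hp (hB2 p.1 p.2)
    have he : X2 p = {c ∈ Fintype.piFinset S | (c p.1, c p.2) ∈ B2 p.1 p.2} := by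
      simp [hX2, hp]
    rw [← he] at h
    have h' : (#(X2 p) : ℝ) * (K : ℝ) ^ 2 = #(B2 p.1 p.2) * (K : ℝ) ^ n := by exact_mod_cast h
    rw [le_div_iff₀ (by positivity)]
    have h4 := h2 p.1 p.2
    have : (#(X2 p) : ℝ) * (3 * n ^ 2) * (K : ℝ) ^ 2 ≤ (K : ℝ) ^ n * (K : ℝ) ^ 2 := by
      calc (#(X2 p) : ℝ) * (3 * n ^ 2) * (K : ℝ) ^ 2
          = (#(X2 p) : ℝ) * (K : ℝ) ^ 2 * (3 * n ^ 2) := by ring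
        _ = (3 * n ^ 2 * #(B2 p.1 p.2)) * (K : ℝ) ^ n := by rw [h']; ring
        _ ≤ (K : ℝ) ^ 2 * (K : ℝ) ^ n := mul_le_mul_of_nonneg_right h4 (by positivity)
        _ = _ := by ring
    exact le_of_mul_le_mul_right this (by positivity)
  have b3 : ∀ p, (#(X3 p) : ℝ) ≤ (K : ℝ) ^ n / (3 * (n : ℝ) ^ 3) := by
    intro p
    by_cases hp : p.1 ≠ p.2.1 ∧ p.1 ≠ p.2.2 ∧ p.2.1 ≠ p.2.2
    swap
    · have : X3 p = ∅ := by
        rw [hX3]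
        refine filter_eq_empty_iff.2 fun c _ h => hp ⟨h.1, h.2.1, h.2.2.1⟩
      rw [this, card_empty, Nat.cast_zero]
      positivity
    have h := card_triple_mem hS hp.1 hp.2.1 hp.2.2 (hB3 p.1 p.2.1 p.2.2)
    have he : X3 p = {c ∈ Fintype.piFinset S | (c p.1, c p.2.1, c p.2.2) ∈ B3 p.1 p.2.1 p.2.2} := by
      simp [hX3, hp]
    rw [← he] at h
    have h' : (#(X3 p) : ℝ) * (K : ℝ) ^ 3 = #(B3 p.1 p.2.1 p.2.2) * (K : ℝ) ^ n := by
      exact_mod_cast h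
    rw [le_div_iff₀ (by positivity)]
    have h4 := h3 p.1 p.2.1 p.2.2
    have : (#(X3 p) : ℝ) * (3 * n ^ 3) * (K : ℝ) ^ 3 ≤ (K : ℝ) ^ n * (K : ℝ) ^ 3 := by
      calc (#(X3 p) : ℝ) * (3 * n ^ 3) * (K : ℝ) ^ 3
          = (#(X3 p) : ℝ) * (K : ℝ) ^ 3 * (3 * n ^ 3) := by ring
        _ = (3 * n ^ 3 * #(B3 p.1 p.2.1 p.2.2)) * (K : ℝ) ^ n := by rw [h']; ring
        _ ≤ (K : ℝ) ^ 3 * (K : ℝ) ^ n := mul_le_mul_of_nonneg_right h4 (by positivity)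
        _ = _ := by ring
    exact le_of_mul_le_mul_right this (by positivity)
  have hle : (#(Fintype.piFinset S) : ℝ) ≤ ∑ p, (#(X2 p) : ℝ) + ∑ p, (#(X3 p) : ℝ) := by
    exact_mod_cast (card_le_card hcov).trans ((card_union_le _ _).trans
      (Nat.add_le_add card_biUnion_le card_biUnion_le))
  have s2 : ∑ p, (#(X2 p) : ℝ) ≤ (K : ℝ) ^ n / 3 := by
    refine (sum_le_sum fun p _ => b2 p).trans (le_of_eq ?_)
    rw [sum_const, card_univ, Fintype.card_prod, nsmul_eq_mul]
    push_cast
    rw [← hn]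
    field_simp
  have s3 : ∑ p, (#(X3 p) : ℝ) ≤ (K : ℝ) ^ n / 3 := by
    refine (sum_le_sum fun p _ => b3 p).trans (le_of_eq ?_)
    rw [sum_const, card_univ, Fintype.card_prod, Fintype.card_prod, nsmul_eq_mul]
    push_cast
    rw [← hn]
    field_simp
  have : 0 < (K : ℝ) ^ n := by positivity
  rw [hcard] at hle
  linarith

end
section
open scoped Classical

variable {V : Type*} {G : SimpleGraph V}

lemma card_adj_eq_sum (G : SimpleGraph V) (X Y : Finset V) :
    #{z ∈ X ×ˢ Y | G.Adj z.1 z.2} = ∑ a ∈ X, #{y ∈ Y | G.Adj a y} := by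
  rw [card_filter, sum_product]
  simp only [card_filter]

/-- If almost all pairs inside `S` have many common neighbours and the graph is locally sparse,
then it contains an induced `1`-subdivision of a complete graph. -/
theorem indSub_top_of_heavy [Fintype V] {h q Q : ℕ} {θ η : ℝ} {S : Finset V}
    (hh : 1 ≤ h) (hq : 1 ≤ q) (hQ : 3 * q ≤ Q) (hS : q ≤ #S) (hSh : 9 * h ^ 2 ≤ #S)
    (hθ0 : 0 ≤ θ) (hθ : 9 * (h : ℝ) ^ 4 * θ ≤ 1) (hη : 9 * (h : ℝ) ^ 2 * η ≤ 1)
    (hsp : ∀ X Y : Finset V, q ≤ #X → q ≤ #Y →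
      (#{z ∈ X ×ˢ Y | G.Adj z.1 z.2} : ℝ) ≤ θ * #X * #Y)
    (hnon : (#{z ∈ S ×ˢ S | #{a | G.Adj a z.1 ∧ G.Adj a z.2} < Q} : ℝ) ≤ η * (#S : ℝ) ^ 2) :
    IndSub G (⊤ : SimpleGraph (Fin h)) := by
  have hh' : (1 : ℝ) ≤ h := by exact_mod_cast hh
  have hS0 : (0 : ℝ) < #S := by exact_mod_cast (by omega : 0 < #S)
  set Exc : Finset V := {a | θ * #S < #{y ∈ S | G.Adj a y}} with hExc
  have hExcq : #Exc < q := by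
    by_contra hc
    push Not at hc
    have h1 := hsp Exc S hc hS
    rw [card_adj_eq_sum] at h1
    push_cast at h1
    have h2 : ∑ _a ∈ Exc, θ * (#S : ℝ) < ∑ a ∈ Exc, (#{y ∈ S | G.Adj a y} : ℝ) :=
      sum_lt_sum_of_nonempty (card_pos.1 (by omega)) fun a ha => (mem_filter.1 ha).2
    rw [sum_const, nsmul_eq_mul] at h2
    nlinarith
  obtain ⟨r, hr⟩ : ∃ r, Q = r + q := ⟨Q - q, by omega⟩
  have hcand : ∀ u w, ∃ C : Finset V, (∀ a ∈ C, G.Adj a u ∧ G.Adj a w ∧ a ∉ Exc) ∧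
      #C ≤ r ∧ (Q ≤ #{a | G.Adj a u ∧ G.Adj a w} → #C = r) := by
    intro u w
    by_cases hu : Q ≤ #{a | G.Adj a u ∧ G.Adj a w}
    · have h1 := le_card_sdiff Exc {a | G.Adj a u ∧ G.Adj a w}
      obtain ⟨C, hC, hC'⟩ := exists_subset_card_eq
        (show r ≤ #(({a | G.Adj a u ∧ G.Adj a w} : Finset V) \ Exc) by omega)
      refine ⟨C, fun a ha => ?_, hC'.le, fun _ => hC'⟩
      simpa [and_assoc] using hC ha
    · exact ⟨∅, by simp, by simp, fun h => absurd h hu⟩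
  choose Cand hC1 hC2 hC3 using hcand
  set B2 : Finset (V × V) := {z ∈ S ×ˢ S | z.1 = z.2 ∨ G.Adj z.1 z.2 ∨
    #{a | G.Adj a z.1 ∧ G.Adj a z.2} < Q} with hB2
  set B3 : Finset (V × V × V) := {z ∈ S ×ˢ S ×ˢ S |
    r < 2 * h * #{a ∈ Cand z.1 z.2.1 | G.Adj a z.2.2}} with hB3
  have hB2c : 3 * (h : ℝ) ^ 2 * #B2 ≤ (#S : ℝ) ^ 2 := by
    have h1 : #B2 ≤ #S + (#{z ∈ S ×ˢ S | G.Adj z.1 z.2} +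
        #{z ∈ S ×ˢ S | #{a | G.Adj a z.1 ∧ G.Adj a z.2} < Q}) := by
      rw [hB2, filter_or, filter_or]
      refine (card_union_le _ _).trans (Nat.add_le_add ?_ (card_union_le _ _))
      refine (card_le_card_of_injOn Prod.fst (t := S) ?_ ?_)
      · intro z hz
        exact (mem_product.1 (mem_filter.1 hz).1).1
      · intro z hz z' hz' he
        exact Prod.ext he ((mem_filter.1 hz).2.symm.trans (he.trans (mem_filter.1 hz').2))
    have h2 : (#B2 : ℝ) ≤ #S + (θ * #S * #S + η * (#S : ℝ) ^ 2) :=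
      le_trans (by exact_mod_cast h1) (add_le_add_right (add_le_add (hsp S S hS hS) hnon) _)
    have h3 : 9 * (h : ℝ) ^ 2 ≤ #S := by exact_mod_cast hSh
    have h4 : 9 * (h : ℝ) ^ 2 * θ ≤ 1 := by
      refine le_trans ?_ hθ
      refine mul_le_mul_of_nonneg_right ?_ hθ0
      have : (h : ℝ) ^ 2 ≤ (h : ℝ) ^ 4 := pow_le_pow_right₀ hh' (by norm_num)
      linarith
    have h5 := mul_le_mul_of_nonneg_left h2 (by positivity : 0 ≤ 9 * (h : ℝ) ^ 2)
    have h6 := mul_le_mul_of_nonneg_right h3 hS0.le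
    have h7 := mul_le_mul_of_nonneg_right h4 (sq_nonneg (#S : ℝ))
    have h8 := mul_le_mul_of_nonneg_right hη (sq_nonneg (#S : ℝ))
    have h9 : 9 * (h : ℝ) ^ 2 * (#S + (θ * #S * #S + η * (#S : ℝ) ^ 2)) =
      9 * (h : ℝ) ^ 2 * #S + (9 * (h : ℝ) ^ 2 * θ * (#S : ℝ) ^ 2) +
        9 * (h : ℝ) ^ 2 * η * (#S : ℝ) ^ 2 := by ring
    rw [h9] at h5
    rw [sq (#S : ℝ)] at *
    linarith
  have hB3c : 3 * (h : ℝ) ^ 3 * #B3 ≤ (#S : ℝ) ^ 3 := by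
    have hfib : ∀ u w, (#{z ∈ S | r < 2 * h * #{a ∈ Cand u w | G.Adj a z}} : ℝ) ≤
        2 * h * θ * #S := by
      intro u w
      set Z : Finset V := {z ∈ S | r < 2 * h * #{a ∈ Cand u w | G.Adj a z}} with hZ
      have h1 : #Z * r ≤ 2 * h * ∑ a ∈ Cand u w, #{z ∈ S | G.Adj a z} := by
        calc #Z * r = ∑ _z ∈ Z, r := by rw [sum_const, smul_eq_mul]
          _ ≤ ∑ z ∈ Z, 2 * h * #{a ∈ Cand u w | G.Adj a z} :=
            sum_le_sum fun z hz => (mem_filter.1 hz).2.le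
          _ ≤ ∑ z ∈ S, 2 * h * #{a ∈ Cand u w | G.Adj a z} :=
            sum_le_sum_of_subset (filter_subset _ _)
          _ = 2 * h * ∑ a ∈ Cand u w, #{z ∈ S | G.Adj a z} := by
            rw [← mul_sum]
            simp only [card_filter]
            rw [sum_comm]
      have h2 : (∑ a ∈ Cand u w, #{z ∈ S | G.Adj a z} : ℝ) ≤ r * (θ * #S) := by
        calc (∑ a ∈ Cand u w, (#{z ∈ S | G.Adj a z} : ℝ)) ≤ ∑ _a ∈ Cand u w, θ * #S := by
              refine sum_le_sum fun a ha => ?_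
              have := (hC1 u w a ha).2.2
              simpa [hExc] using this
          _ = #(Cand u w) * (θ * #S) := by rw [sum_const, nsmul_eq_mul]
          _ ≤ r * (θ * #S) := by
            refine mul_le_mul_of_nonneg_right ?_ (mul_nonneg hθ0 hS0.le)
            exact_mod_cast hC2 u w
      have h3 : (#Z : ℝ) * r ≤ 2 * h * (r * (θ * #S)) := by
        refine le_trans ?_ (mul_le_mul_of_nonneg_left h2 (by linarith))
        exact_mod_cast h1
      have hr0 : (0 : ℝ) < r := by exact_mod_cast (by omega : 0 < r)
      refine le_of_mul_le_mul_right (h3.trans (le_of_eq ?_)) hr0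
      ring
    have h1 : (#B3 : ℝ) ≤ #S * (#S * (2 * h * θ * #S)) := by
      rw [hB3, card_filter, sum_product]
      push_cast
      rw [← nsmul_eq_mul, ← sum_const]
      refine sum_le_sum fun u _ => ?_
      rw [sum_product, ← nsmul_eq_mul, ← sum_const]
      refine sum_le_sum fun w _ => ?_
      have := hfib u w
      rw [card_filter] at this
      push_cast at this
      exact this
    have h2 := mul_le_mul_of_nonneg_left h1 (by positivity : 0 ≤ 3 * (h : ℝ) ^ 3)
    have h3 := mul_le_mul_of_nonneg_right hθ (by positivity : 0 ≤ (#S : ℝ) ^ 3)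
    have h4 : 0 ≤ (h : ℝ) ^ 4 * θ * (#S : ℝ) ^ 3 := by positivity
    nlinarith
  obtain ⟨b, hbS, hb2, hb3⟩ := exists_map_avoid (ι := Fin h) (S := fun _ => S) (fun _ => rfl)
    (by omega) (fun _ _ => B2) (fun _ _ _ => B3) (fun _ _ => filter_subset _ _)
    (fun _ _ _ => filter_subset _ _) (fun _ _ => by simpa using hB2c)
    (fun _ _ _ => by simpa using hB3c)
  have hb2' : ∀ i j, i ≠ j → b i ≠ b j ∧ ¬ G.Adj (b i) (b j) ∧
      Q ≤ #{a | G.Adj a (b i) ∧ G.Adj a (b j)} := by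
    intro i j hij
    have := hb2 i j hij
    simp only [hB2, mem_filter, mem_product, hbS, true_and, not_or, not_lt] at this
    exact this
  have hb3' : ∀ i j k, i ≠ j → i ≠ k → j ≠ k →
      2 * h * #{a ∈ Cand (b i) (b j) | G.Adj a (b k)} ≤ r := by
    intro i j k h1 h2 h3
    have := hb3 i j k h1 h2 h3
    simp only [hB3, mem_filter, mem_product, hbS, true_and, not_lt] at this
    exact this
  have hcand' : ∀ e : (⊤ : SimpleGraph (Fin h)).edgeSet, ∃ C : Finset V, #C = q ∧
      ∀ a ∈ C, ∀ k, G.Adj a (b k) ↔ k ∈ (e : Sym2 (Fin h)) := by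
    rintro ⟨e, he⟩
    induction e with | h i j =>
    have hij : i ≠ j := by simpa using he
    have hcr := hC3 _ _ (hb2' i j hij).2.2
    set C : Finset V := {a ∈ Cand (b i) (b j) | ∀ k, k ≠ i → k ≠ j → ¬ G.Adj a (b k)} with hC
    have hsub : Cand (b i) (b j) \ C ⊆ (univ.filter fun k => k ≠ i ∧ k ≠ j).biUnion
        fun k => {a ∈ Cand (b i) (b j) | G.Adj a (b k)} := by
      intro a ha
      rw [mem_sdiff, hC, mem_filter] at ha
      obtain ⟨h1, h2⟩ := ha
      simp only [h1, true_and] at h2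
      push Not at h2
      obtain ⟨k, h3, h4, h5⟩ := h2
      exact mem_biUnion.2 ⟨k, by simp [h3, h4], mem_filter.2 ⟨h1, h5⟩⟩
    have h1 : 2 * h * #(Cand (b i) (b j) \ C) ≤ h * r := by
      calc 2 * h * #(Cand (b i) (b j) \ C)
          ≤ 2 * h * ∑ k with k ≠ i ∧ k ≠ j, #{a ∈ Cand (b i) (b j) | G.Adj a (b k)} :=
            Nat.mul_le_mul_left _ ((card_le_card hsub).trans card_biUnion_le)
        _ = ∑ k with k ≠ i ∧ k ≠ j, 2 * h * #{a ∈ Cand (b i) (b j) | G.Adj a (b k)} := mul_sum ..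
        _ ≤ ∑ k : Fin h with k ≠ i ∧ k ≠ j, r := by
          refine sum_le_sum fun k hk => ?_
          obtain ⟨-, h1, h2⟩ := mem_filter.1 hk
          exact hb3' i j k hij h1.symm h2.symm
        _ ≤ ∑ _k : Fin h, r := sum_le_sum_of_subset (filter_subset _ _)
        _ = h * r := by simp
    have h2 : 2 * #(Cand (b i) (b j) \ C) ≤ r := by
      refine Nat.le_of_mul_le_mul_left ?_ (by omega : 0 < h)
      rw [← mul_assoc, mul_comm h 2]
      exact h1
    have h3 : #(Cand (b i) (b j) \ C) + #C = r := by
      rw [card_sdiff_add_card_eq_card (filter_subset _ _), hcr]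
    obtain ⟨C', hC', hC''⟩ := exists_subset_card_eq (show q ≤ #C by omega)
    refine ⟨C', hC'', fun a ha k => ?_⟩
    obtain ⟨h4, h5⟩ := mem_filter.1 (hC' ha)
    obtain ⟨h6, h7, -⟩ := hC1 _ _ a h4
    simp only [Sym2.mem_iff]
    constructor
    · intro h8
      by_contra hc
      push Not at hc
      exact h5 k hc.1 hc.2 h8
    · rintro (rfl | rfl) <;> assumption
  choose C hCq hCadj using hcand'
  have hcardE : (Fintype.card (⊤ : SimpleGraph (Fin h)).edgeSet : ℝ) ≤ (h : ℝ) ^ 2 := by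
    have h1 : Fintype.card (⊤ : SimpleGraph (Fin h)).edgeSet ≤ Fintype.card (Sym2 (Fin h)) :=
      Fintype.card_subtype_le _
    exact_mod_cast h1.trans (card_sym2_le h)
  have hq0 : (0 : ℝ) < q := by exact_mod_cast hq
  obtain ⟨c, hc1, hc2, -⟩ := exists_map_avoid hCq hq
    (fun e e' => {z ∈ C e ×ˢ C e' | G.Adj z.1 z.2}) (fun _ _ _ => ∅)
    (fun _ _ => filter_subset _ _) (fun _ _ _ => empty_subset _)
    (by
      intro e e'
      have h1 := hsp (C e) (C e') (hCq e).ge (hCq e').ge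
      rw [hCq, hCq] at h1
      have h2 : (Fintype.card (⊤ : SimpleGraph (Fin h)).edgeSet : ℝ) ^ 2 ≤ (h : ℝ) ^ 4 := by
        calc _ ≤ ((h : ℝ) ^ 2) ^ 2 := pow_le_pow_left₀ (Nat.cast_nonneg _) hcardE 2
          _ = _ := by ring
      calc _ ≤ 3 * (h : ℝ) ^ 4 * (θ * q * q) :=
            mul_le_mul (by linarith) h1 (Nat.cast_nonneg _) (by positivity)
        _ = (9 * (h : ℝ) ^ 4 * θ) * (q : ℝ) ^ 2 / 3 := by ring
        _ ≤ 1 * (q : ℝ) ^ 2 / 3 := by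
          have := mul_le_mul_of_nonneg_right hθ (sq_nonneg (q : ℝ))
          linarith
        _ ≤ (q : ℝ) ^ 2 := by nlinarith)
    (by
      intro e e' e''
      simp only [card_empty, Nat.cast_zero, mul_zero]
      positivity)
  have hV : V := b ⟨0, hh⟩
  refine ⟨b, fun e => if he : e ∈ (⊤ : SimpleGraph (Fin h)).edgeSet then c ⟨e, he⟩ else hV,
    ?_, ?_, ?_, ?_⟩
  · intro i j hij
    by_contra hne
    exact (hb2' i j hne).1 hij
  · intro i j
    by_cases hij : i = j
    · subst hij
      exact G.loopless.irrefl _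
    · exact (hb2' i j hij).2.1
  · intro e he e' he'
    simp only [dif_pos he, dif_pos he']
    by_cases hee : e = e'
    · subst hee
      exact G.loopless.irrefl _
    · have := hc2 ⟨e, he⟩ ⟨e', he'⟩ (by simpa using hee)
      simp only [mem_filter, mem_product, hc1, true_and] at this
      exact this
  · intro e he w
    simp only [dif_pos he]
    exact hCadj ⟨e, he⟩ _ (hc1 _) w

lemma bs_top (h : ℕ) : BS (⊤ : SimpleGraph (Fin h)) h :=
  ⟨1, le_rfl, id, Function.injective_id, fun _ => ∅, by simp, by simp,
    fun _ _ hab => Lk.of_adj _ hab⟩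

end
section
open scoped Classical

variable {V : Type*} [Fintype V]

/-- The zero set of a colouring. -/
noncomputable def zs {m : ℕ} (c : V → Fin (m + 1)) : Finset V := {v | c v = 0}

/-- Expected value of `F` over a random set containing each vertex with probability
`1 / (m + 1)`. -/
noncomputable def Ex (m : ℕ) (F : Finset V → ℝ) : ℝ :=
  (∑ c : V → Fin (m + 1), F (zs c)) / ((m : ℝ) + 1) ^ Fintype.card V

lemma Ex_add (m : ℕ) (F F' : Finset V → ℝ) : Ex m (fun S => F S + F' S) = Ex m F + Ex m F' := by
  rw [Ex, Ex, Ex, sum_add_distrib, add_div]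

lemma Ex_mul (m : ℕ) (r : ℝ) (F : Finset V → ℝ) : Ex m (fun S => r * F S) = r * Ex m F := by
  rw [Ex, Ex, ← mul_sum, mul_div_assoc]

lemma Ex_mono (m : ℕ) {F F' : Finset V → ℝ} (h : ∀ S, F S ≤ F' S) : Ex m F ≤ Ex m F' :=
  div_le_div_of_nonneg_right (sum_le_sum fun c _ => h _) (by positivity)

lemma exists_pos_of_Ex {m : ℕ} {F : Finset V → ℝ} (h : 0 < Ex m F) : ∃ S, 0 < F S := by
  by_contra hc
  push Not at hc
  have : Ex m F ≤ 0 := div_nonpos_of_nonpos_of_nonneg (sum_nonpos fun c _ => hc _) (by positivity)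
  linarith

lemma Ex_count (m : ℕ) {τ : Type*} (I : Finset τ) (f : τ → Finset V) {j : ℕ}
    (hf : ∀ t ∈ I, #(f t) = j) :
    Ex m (fun S => (#{t ∈ I | f t ⊆ S} : ℝ)) = #I * (1 / ((m : ℝ) + 1)) ^ j := by
  have h1 : ∀ t ∈ I, (∑ c : V → Fin (m + 1), if f t ⊆ zs c then (1 : ℝ) else 0) *
      ((m : ℝ) + 1) ^ j = ((m : ℝ) + 1) ^ Fintype.card V := by
    intro t ht
    have := card_agree (S := fun _ : V => (univ : Finset (Fin (m + 1)))) (K := m + 1)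
      (fun _ => by simp) (f t) (fun _ => 0) (fun _ _ => mem_univ _)
    rw [hf t ht] at this
    have h3 : #(univ.filter fun c : V → Fin (m + 1) => f t ⊆ zs c) * (m + 1) ^ j =
        (m + 1) ^ Fintype.card V := by
      rw [← this]
      congr 2
      ext c
      simp [subset_iff, zs]
    rw [← sum_filter, sum_const, nsmul_eq_mul, mul_one]
    exact_mod_cast h3
  have hpos : (0 : ℝ) < (m : ℝ) + 1 := by positivity
  rw [Ex]
  simp only [card_filter]
  push_cast
  rw [sum_comm]
  have h2 : ∀ t ∈ I, (∑ c : V → Fin (m + 1), if f t ⊆ zs c then (1 : ℝ) else 0) =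
      ((m : ℝ) + 1) ^ Fintype.card V * (1 / ((m : ℝ) + 1)) ^ j := by
    intro t ht
    rw [← h1 t ht, mul_assoc, ← mul_pow, mul_one_div_cancel hpos.ne', one_pow, mul_one]
  rw [sum_congr rfl h2, sum_const, nsmul_eq_mul]
  field_simp

/-- A symmetric relation with few related pairs has a large independent set. -/
lemma exists_conflict_free {α : Type*} (R : α → α → Prop) (hsym : ∀ a b, R a b → R b a)
    (A : Finset α) {κ : ℝ} (hκ : 1 ≤ κ)
    (hR : (#{z ∈ A ×ˢ A | R z.1 z.2} : ℝ) ≤ κ * #A) :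
    ∃ A' ⊆ A, (#A : ℝ) ≤ 6 * κ * #A' ∧ ∀ a ∈ A', ∀ b ∈ A', a ≠ b → ¬ R a b := by
  set L : Finset α := {a ∈ A | (#{b ∈ A | R a b} : ℝ) ≤ 2 * κ} with hL
  have hL2 : (#A : ℝ) ≤ 2 * #L := by
    have h1 : #{z ∈ A ×ˢ A | R z.1 z.2} = ∑ a ∈ A, #{b ∈ A | R a b} := by
      rw [card_filter, sum_product]
      simp only [card_filter]
    have h2 : (∑ a ∈ A with ¬ (#{b ∈ A | R a b} : ℝ) ≤ 2 * κ, 2 * κ) ≤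
        ∑ a ∈ A, (#{b ∈ A | R a b} : ℝ) := by
      refine le_trans (sum_le_sum fun a ha => (not_le.1 (mem_filter.1 ha).2).le) ?_
      exact sum_le_sum_of_subset_of_nonneg (filter_subset _ _) fun _ _ _ => Nat.cast_nonneg _
    rw [sum_const, nsmul_eq_mul] at h2
    have h3 : (#L : ℝ) + #{a ∈ A | ¬ (#{b ∈ A | R a b} : ℝ) ≤ 2 * κ} = #A := by
      exact_mod_cast card_filter_add_card_filter_not _
    rw [h1] at hR
    push_cast at hR
    nlinarith
  obtain ⟨Free, hFree⟩ : ∃ Free : Finset α → Prop, ∀ X, Free X ↔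
      ∀ a ∈ X, ∀ b ∈ X, a ≠ b → ¬ R a b := ⟨_, fun _ => Iff.rfl⟩
  obtain ⟨A', hA'⟩ := exists_max_image (L.powerset.filter Free) card ⟨∅, by simp [hFree]⟩
  obtain ⟨hA1, hA2⟩ := hA'
  rw [mem_filter, mem_powerset, hFree] at hA1
  refine ⟨A', hA1.1.trans (filter_subset _ _), ?_, hA1.2⟩
  have hcov : L ⊆ A' ∪ A'.biUnion fun a => {b ∈ A | R a b} := by
    intro x hx
    by_contra hc
    rw [mem_union, mem_biUnion, not_or] at hc
    obtain ⟨h1, h2⟩ := hc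
    push Not at h2
    have h3 : ∀ a ∈ A', ¬ R a x := fun a ha hr =>
      h2 a ha (mem_filter.2 ⟨(mem_filter.1 hx).1, hr⟩)
    have h4 := hA2 (insert x A') (by
      rw [mem_filter, mem_powerset, hFree]
      refine ⟨insert_subset hx hA1.1, ?_⟩
      intro a ha b hb hab
      rw [mem_insert] at ha hb
      rcases ha with rfl | ha <;> rcases hb with rfl | hb
      · exact absurd rfl hab
      · exact fun h => h3 b hb (hsym _ _ h)
      · exact h3 a ha
      · exact hA1.2 a ha b hb hab)
    rw [card_insert_of_notMem h1] at h4
    omega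
  have h1 : (#L : ℝ) ≤ #A' + ∑ a ∈ A', (#{b ∈ A | R a b} : ℝ) := by
    exact_mod_cast (card_le_card hcov).trans ((card_union_le _ _).trans
      (Nat.add_le_add_left card_biUnion_le _))
  have h2 : ∑ a ∈ A', (#{b ∈ A | R a b} : ℝ) ≤ #A' * (2 * κ) := by
    rw [← nsmul_eq_mul, ← sum_const]
    exact sum_le_sum fun a ha => (mem_filter.1 (hA1.1 ha)).2
  have h3 : (0 : ℝ) ≤ #A' := Nat.cast_nonneg _
  nlinarith

end
section
open scoped Classical

variable {V : Type*} [Fintype V]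

/-- An acyclic-type orientation `out` with a family of nonadjacent pairs of out-neighbours. -/
structure PairSystem (G : SimpleGraph V) (out : V → Finset V) (P : V → Finset (V × V))
    (V1 : Finset V) : Prop where
  out_adj : ∀ v, ∀ u ∈ out v, G.Adj v u
  orient : ∀ u w, G.Adj u w → w ∈ out u ∨ u ∈ out w
  fst_mem : ∀ v ∈ V1, ∀ p ∈ P v, p.1 ∈ out v
  snd_mem : ∀ v ∈ V1, ∀ p ∈ P v, p.2 ∈ out v
  ne : ∀ v ∈ V1, ∀ p ∈ P v, p.1 ≠ p.2
  not_adj : ∀ v ∈ V1, ∀ p ∈ P v, ¬ G.Adj p.1 p.2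

/-- The vertices that must be avoided for the pair `p` to be isolated at `v`. -/
noncomputable def Rg (G : SimpleGraph V) (out : V → Finset V) (v : V) (p : V × V) : Finset V :=
  (nbr G v ∪ (out p.1 ∪ out p.2)) \ {p.1, p.2}

/-- `p` is contained in `S`, isolated from the rest of `S` as seen from `v`. -/
def Good (G : SimpleGraph V) (out : V → Finset V) (S : Finset V) (v : V) (p : V × V) : Prop :=
  p.1 ∈ S ∧ p.2 ∈ S ∧ ∀ z ∈ Rg G out v p, z ∉ S

/-- The vertices seeing an isolated pair. -/
noncomputable def goodSet (G : SimpleGraph V) (out : V → Finset V) (P : V → Finset (V × V))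
    (V1 S : Finset V) : Finset V :=
  {v ∈ V1 | ∃ p ∈ P v, Good G out S v p}

/-- Two vertices that cannot both be used as subdivision vertices. -/
def Conf (G : SimpleGraph V) (S : Finset V) (v v' : V) : Prop :=
  v ≠ v' ∧ (G.Adj v v' ∨ nbr G v ∩ S = nbr G v' ∩ S)

variable {G : SimpleGraph V} {out : V → Finset V} {P : V → Finset (V × V)} {V1 : Finset V}

lemma PairSystem.inter_eq (hP : PairSystem G out P V1) {S : Finset V} {v : V} (hv : v ∈ V1)
    {p : V × V} (hp : p ∈ P v) (hg : Good G out S v p) : nbr G v ∩ S = {p.1, p.2} := by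
  ext z
  rw [mem_inter, mem_nbr, mem_insert, mem_singleton]
  constructor
  · rintro ⟨h1, h2⟩
    by_contra hc
    refine hg.2.2 z ?_ h2
    simp only [Rg, mem_sdiff, mem_union, mem_nbr, mem_insert, mem_singleton]
    exact ⟨Or.inl h1, hc⟩
  · rintro (rfl | rfl)
    · exact ⟨hP.out_adj _ _ (hP.fst_mem v hv p hp), hg.1⟩
    · exact ⟨hP.out_adj _ _ (hP.snd_mem v hv p hp), hg.2.1⟩

lemma PairSystem.fst_out (hP : PairSystem G out P V1) {S : Finset V} {v : V} (hv : v ∈ V1)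
    {p : V × V} (hp : p ∈ P v) (hg : Good G out S v p) : ∀ z ∈ out p.1, z ∉ S := by
  intro z hz hzS
  refine hg.2.2 z ?_ hzS
  have h1 := hP.out_adj _ _ hz
  simp only [Rg, mem_sdiff, mem_union, mem_insert, mem_singleton]
  refine ⟨Or.inr (Or.inl hz), ?_⟩
  rintro (rfl | rfl)
  · exact G.loopless.irrefl _ h1
  · exact hP.not_adj v hv p hp h1

lemma PairSystem.snd_out (hP : PairSystem G out P V1) {S : Finset V} {v : V} (hv : v ∈ V1)
    {p : V × V} (hp : p ∈ P v) (hg : Good G out S v p) : ∀ z ∈ out p.2, z ∉ S := by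
  intro z hz hzS
  refine hg.2.2 z ?_ hzS
  have h1 := hP.out_adj _ _ hz
  simp only [Rg, mem_sdiff, mem_union, mem_insert, mem_singleton]
  refine ⟨Or.inr (Or.inr hz), ?_⟩
  rintro (rfl | rfl)
  · exact hP.not_adj v hv p hp h1.symm
  · exact G.loopless.irrefl _ h1

lemma PairSystem.indSub (hP : PairSystem G out P V1) {S A : Finset V}
    (hA : A ⊆ goodSet G out P V1 S) (hconf : ∀ a ∈ A, ∀ b ∈ A, a ≠ b → ¬ Conf G S a b)
    (hne : A.Nonempty) :
    ∃ B ⊆ S, ∃ H : SimpleGraph B, B.Nonempty ∧ IndSub G H ∧ #A ≤ e2 H univ := by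
  have hA' : ∀ v, ∃ p : V × V, v ∈ A → v ∈ V1 ∧ p ∈ P v ∧ Good G out S v p := by
    intro v
    by_cases hv : v ∈ A
    · obtain ⟨h1, p, h2, h3⟩ := mem_filter.1 (hA hv)
      exact ⟨p, fun _ => ⟨h1, h2, h3⟩⟩
    · exact ⟨(v, v), fun h => absurd h hv⟩
  choose p hp using hA'
  set B : Finset V := {b ∈ S | ∀ z ∈ out b, z ∉ S} with hB
  have hpB : ∀ v ∈ A, (p v).1 ∈ B ∧ (p v).2 ∈ B := by
    intro v hv
    obtain ⟨h1, h2, h3⟩ := hp v hv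
    exact ⟨mem_filter.2 ⟨h3.1, hP.fst_out h1 h2 h3⟩, mem_filter.2 ⟨h3.2.1, hP.snd_out h1 h2 h3⟩⟩
  have hadj : ∀ v ∈ A, ∀ z ∈ B, G.Adj v z ↔ z = (p v).1 ∨ z = (p v).2 := by
    intro v hv z hz
    obtain ⟨h1, h2, h3⟩ := hp v hv
    have h4 := hP.inter_eq h1 h2 h3
    have : z ∈ nbr G v ∩ S ↔ z ∈ ({(p v).1, (p v).2} : Finset V) := by rw [h4]
    rw [mem_inter, mem_nbr, mem_insert, mem_singleton] at this
    rw [← this]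
    exact ⟨fun h => ⟨h, (mem_filter.1 hz).1⟩, fun h => h.1⟩
  let H : SimpleGraph B :=
    { Adj := fun a b => a ≠ b ∧ ∃ v ∈ A, G.Adj v a ∧ G.Adj v b
      symm := ⟨fun a b ⟨h, v, hv, h1, h2⟩ => ⟨h.symm, v, hv, h2, h1⟩⟩
      loopless := ⟨fun a h => h.1 rfl⟩ }
  have hH : ∀ e ∈ H.edgeSet, ∃ v ∈ A, ∀ w : B, G.Adj v w ↔ w ∈ e := by
    intro e he
    induction e with | h a b =>
    obtain ⟨h, v, hv, h1, h2⟩ : H.Adj a b := he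
    refine ⟨v, hv, fun w => ?_⟩
    rw [hadj v hv _ a.2] at h1
    rw [hadj v hv _ b.2] at h2
    rw [hadj v hv _ w.2, Sym2.mem_iff, Subtype.ext_iff, Subtype.ext_iff]
    have h' : (a : V) ≠ b := fun h3 => h (Subtype.ext h3)
    rcases h1 with h1 | h1 <;> rcases h2 with h2 | h2
    · exact absurd (h1.trans h2.symm) h'
    · rw [h1, h2]
    · rw [h1, h2]; exact or_comm
    · exact absurd (h1.trans h2.symm) h'
  obtain ⟨v0, hv0⟩ := hne
  have : Nonempty V := ⟨v0⟩
  choose! ψ hψA hψ using hH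
  refine ⟨B, filter_subset _ _, H, ⟨_, (hpB v0 hv0).1⟩,
    ⟨Subtype.val, ψ, Subtype.val_injective, ?_, ?_, hψ⟩, ?_⟩
  · intro a b hab
    have ha := mem_filter.1 a.2
    have hb := mem_filter.1 b.2
    rcases hP.orient _ _ hab with h | h
    · exact ha.2 _ h hb.1
    · exact hb.2 _ h ha.1
  · intro e he e' he' h
    exact hconf _ (hψA e he) _ (hψA e' he') h.ne ⟨h.ne, Or.inl h⟩
  · rw [e2, ← card_attach]
    refine card_le_card_of_injOn
      (fun v : {v // v ∈ A} => ((⟨(p v).1, (hpB v v.2).1⟩ : B), (⟨(p v).2, (hpB v v.2).2⟩ : B)))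
      ?_ ?_
    · intro v _
      simp only [coe_filter, Set.mem_ofPred_eq, mem_product, mem_univ, true_and]
      obtain ⟨h1, h2, h3⟩ := hp v v.2
      refine ⟨fun h => hP.ne v h1 _ h2 (congrArg Subtype.val h), v, v.2, ?_, ?_⟩
      · exact hP.out_adj _ _ (hP.fst_mem v h1 _ h2)
      · exact hP.out_adj _ _ (hP.snd_mem v h1 _ h2)
    · intro v _ v' _ hvv
      simp only [Prod.mk.injEq, Subtype.mk.injEq] at hvv
      by_contra hc
      have hc' : (v : V) ≠ v' := fun h => hc (Subtype.ext h)
      obtain ⟨h1, h2, h3⟩ := hp v v.2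
      obtain ⟨k1, k2, k3⟩ := hp v' v'.2
      refine hconf v v.2 v' v'.2 hc' ⟨hc', Or.inr ?_⟩
      rw [hP.inter_eq h1 h2 h3, hP.inter_eq k1 k2 k3, hvv.1, hvv.2]

lemma PairSystem.card_goodSet (hP : PairSystem G out P V1) (S : Finset V) :
    #{t ∈ V1.sigma P | {t.2.1, t.2.2} ⊆ S} ≤ 2 * #(goodSet G out P V1 S) +
      #{t ∈ (V1.sigma P).sigma (fun t => Rg G out t.1 t.2) | {t.1.2.1, t.1.2.2, t.2} ⊆ S} := by
  set X : Finset (Σ _ : V, V × V) := {t ∈ V1.sigma P | {t.2.1, t.2.2} ⊆ S} with hX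
  have hsplit : #X = #{t ∈ X | Good G out S t.1 t.2} + #{t ∈ X | ¬ Good G out S t.1 t.2} :=
    (card_filter_add_card_filter_not _).symm
  rw [hsplit]
  refine Nat.add_le_add ?_ ?_
  · refine card_le_mul_card_image_of_maps_to (f := fun t : (Σ _ : V, V × V) => t.1) ?_ 2 ?_
    · intro t ht
      obtain ⟨h1, h2⟩ := mem_filter.1 ht
      have h3 := mem_sigma.1 (mem_filter.1 h1).1
      exact mem_filter.2 ⟨h3.1, t.2, h3.2, h2⟩
    · intro v hv
      obtain ⟨hv1, p, hp, hg⟩ := mem_filter.1 hv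
      have heq := hP.inter_eq hv1 hp hg
      calc _ ≤ #({⟨v, p⟩, ⟨v, (p.2, p.1)⟩} : Finset (Σ _ : V, V × V)) := by
            refine card_le_card fun t ht => ?_
            obtain ⟨h1, h2⟩ := mem_filter.1 ht
            obtain ⟨h3, h4⟩ := mem_filter.1 h1
            have h5 := mem_sigma.1 (mem_filter.1 h3).1
            obtain ⟨t1, t2, t3⟩ := t
            dsimp only at h2 h4 h5
            subst h2
            have h6 := (hP.inter_eq hv1 h5.2 h4).symm.trans heq
            have h7 := hP.ne t1 hv1 _ h5.2
            have a1 : t2 ∈ ({p.1, p.2} : Finset V) := by rw [← h6]; simp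
            have a2 : t3 ∈ ({p.1, p.2} : Finset V) := by rw [← h6]; simp
            rw [mem_insert, mem_singleton] at a1 a2
            dsimp only at h7
            rw [mem_insert, mem_singleton]
            rcases a1 with rfl | rfl <;> rcases a2 with rfl | rfl
            · exact absurd rfl h7
            · left; rfl
            · right; rfl
            · exact absurd rfl h7
        _ ≤ 2 := card_le_two
  · have : ({t ∈ X | ¬ Good G out S t.1 t.2} : Finset (Σ _ : V, V × V)) ⊆
        image Sigma.fst {t ∈ (V1.sigma P).sigma (fun t => Rg G out t.1 t.2) |
          {t.1.2.1, t.1.2.2, t.2} ⊆ S} := by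
      intro t ht
      obtain ⟨h1, h2⟩ := mem_filter.1 ht
      obtain ⟨h3, h4⟩ := mem_filter.1 h1
      rw [insert_subset_iff, singleton_subset_iff] at h4
      rw [Good] at h2
      simp only [h4, true_and] at h2
      push Not at h2
      obtain ⟨z, hz, hz'⟩ := h2
      refine mem_image.2 ⟨⟨t, z⟩, mem_filter.2 ⟨mem_sigma.2 ⟨h3, hz⟩, ?_⟩, rfl⟩
      simp [insert_subset_iff, h4, hz']
    exact (card_le_card this).trans card_image_le

end
section
open scoped Classical

variable {V : Type*} [Fintype V]

/-- Pairs together with a second common neighbour. -/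
noncomputable def idx2 (G : SimpleGraph V) (P : V → Finset (V × V)) (V1 : Finset V) :
    Finset (Σ _ : (Σ _ : V, V × V), V) :=
  (V1.sigma P).sigma fun t => {w | G.Adj w t.2.1 ∧ G.Adj w t.2.2}

/-- Triangles `v x v'` with an out-neighbour at both `v` and `v'`. -/
noncomputable def idx3 (G : SimpleGraph V) (out : V → Finset V) (V1 : Finset V) :
    Finset (Σ _ : (Σ _ : V, V × V), V × V) :=
  (V1.sigma fun v => {z ∈ out v ×ˢ nbr G v | G.Adj z.1 z.2}).sigma fun t =>
    {y ∈ out t.1 ×ˢ out t.2.2 | t.2.1 ≠ y.1 ∧ t.2.1 ≠ y.2 ∧ y.1 ≠ y.2}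

/-- Edges `v v'` with two out-neighbours at both `v` and `v'`. -/
noncomputable def idx4 (G : SimpleGraph V) (out : V → Finset V) (V1 : Finset V) :
    Finset (Σ _ : (Σ _ : V, V), (V × V) × V × V) :=
  (V1.sigma fun v => nbr G v).sigma fun t =>
    {y ∈ (out t.1 ×ˢ out t.1) ×ˢ (out t.2 ×ˢ out t.2) | y.1.1 ≠ y.1.2 ∧ y.1.1 ≠ y.2.1 ∧
      y.1.1 ≠ y.2.2 ∧ y.1.2 ≠ y.2.1 ∧ y.1.2 ≠ y.2.2 ∧ y.2.1 ≠ y.2.2}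

variable {G : SimpleGraph V} {out : V → Finset V} {P : V → Finset (V × V)} {V1 : Finset V}

lemma PairSystem.card_conf (hP : PairSystem G out P V1) (S : Finset V) :
    #{z ∈ goodSet G out P V1 S ×ˢ goodSet G out P V1 S | Conf G S z.1 z.2} ≤
      #{t ∈ idx4 G out V1 | {t.2.1.1, t.2.1.2, t.2.2.1, t.2.2.2} ⊆ S} +
      (#{t ∈ idx3 G out V1 | {t.1.2.1, t.2.1, t.2.2} ⊆ S} +
      #{t ∈ idx2 G P V1 | {t.1.2.1, t.1.2.2} ⊆ S}) := by
  have hcov : ({z ∈ goodSet G out P V1 S ×ˢ goodSet G out P V1 S | Conf G S z.1 z.2} :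
      Finset (V × V)) ⊆
      image (fun t => (t.1.1, t.1.2))
        {t ∈ idx4 G out V1 | {t.2.1.1, t.2.1.2, t.2.2.1, t.2.2.2} ⊆ S} ∪
      (image (fun t => (t.1.1, t.1.2.2)) {t ∈ idx3 G out V1 | {t.1.2.1, t.2.1, t.2.2} ⊆ S} ∪
      image (fun t => (t.1.1, t.2)) {t ∈ idx2 G P V1 | {t.1.2.1, t.1.2.2} ⊆ S}) := by
    rintro ⟨v, v'⟩ hz
    obtain ⟨h1, -, h2⟩ := mem_filter.1 hz
    obtain ⟨h3, h4⟩ := mem_product.1 h1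
    obtain ⟨hv, p, hp, hg⟩ := mem_filter.1 h3
    obtain ⟨hv', p', hp', hg'⟩ := mem_filter.1 h4
    dsimp only at hv hp hg hv' hp' hg' h2
    have e := hP.inter_eq hv hp hg
    have e' := hP.inter_eq hv' hp' hg'
    have key : ∀ x ∈ S, G.Adj v' x → x = p'.1 ∨ x = p'.2 := by
      intro x hx hxa
      have : x ∈ nbr G v' ∩ S := mem_inter.2 ⟨mem_nbr.2 hxa, hx⟩
      rwa [e', mem_insert, mem_singleton] at this
    have o1 := hP.fst_mem v hv p hp
    have o2 := hP.snd_mem v hv p hp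
    have o1' := hP.fst_mem v' hv' p' hp'
    have o2' := hP.snd_mem v' hv' p' hp'
    have n1 := hP.ne v hv p hp
    have n1' := hP.ne v' hv' p' hp'
    have b1 := hP.out_adj _ _ o1'
    have b2 := hP.out_adj _ _ o2'
    rw [mem_union, mem_union, mem_image, mem_image, mem_image]
    by_cases hboth : G.Adj v' p.1 ∧ G.Adj v' p.2
    · refine Or.inr (Or.inr ⟨⟨⟨v, p⟩, v'⟩, mem_filter.2 ⟨?_, ?_⟩, rfl⟩)
      · exact mem_sigma.2 ⟨mem_sigma.2 ⟨hv, hp⟩, by simpa using hboth⟩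
      · simp [insert_subset_iff, hg.1, hg.2.1]
    have hadj : G.Adj v v' := by
      rcases h2 with h2 | h2
      · exact h2
      · refine absurd ⟨?_, ?_⟩ hboth
        · have : p.1 ∈ nbr G v' ∩ S := by rw [← h2, e]; simp
          exact mem_nbr.1 (mem_inter.1 this).1
        · have : p.2 ∈ nbr G v' ∩ S := by rw [← h2, e]; simp
          exact mem_nbr.1 (mem_inter.1 this).1
    have tri : ∀ x y, x ∈ out v → y ∈ out v → x ∈ S → y ∈ S → x ≠ y → G.Adj v' x →
        ¬ G.Adj v' y → ∃ a ∈ ({t ∈ idx3 G out V1 | {t.1.2.1, t.2.1, t.2.2} ⊆ S} : Finset _),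
          ((a.1.1, a.1.2.2) : V × V) = (v, v') := by
      intro x y hx hy hxS hyS hxy hax hay
      have : ∃ y' ∈ out v', y' ∈ S ∧ x ≠ y' ∧ G.Adj v' y' := by
        rcases key x hxS hax with rfl | rfl
        · exact ⟨p'.2, o2', hg'.2.1, n1', b2⟩
        · exact ⟨p'.1, o1', hg'.1, n1'.symm, b1⟩
      obtain ⟨y', c1, c2, c3, c4⟩ := this
      refine ⟨⟨⟨v, (x, v')⟩, (y, y')⟩, mem_filter.2 ⟨?_, ?_⟩, rfl⟩
      · refine mem_sigma.2 ⟨mem_sigma.2 ⟨hv, ?_⟩, ?_⟩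
        · simpa [hx, hadj] using hax.symm
        · simp only [mem_filter, mem_product]
          exact ⟨⟨hy, c1⟩, hxy, c3, fun h => hay (h ▸ c4)⟩
      · simp [insert_subset_iff, hxS, hyS, c2]
    by_cases hb1 : G.Adj v' p.1
    · exact Or.inr (Or.inl (tri p.1 p.2 o1 o2 hg.1 hg.2.1 n1 hb1 fun h => hboth ⟨hb1, h⟩))
    by_cases hb2 : G.Adj v' p.2
    · exact Or.inr (Or.inl (tri p.2 p.1 o2 o1 hg.2.1 hg.1 n1.symm hb2 hb1))
    refine Or.inl ⟨⟨⟨v, v'⟩, (p, p')⟩, mem_filter.2 ⟨?_, ?_⟩, rfl⟩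
    · refine mem_sigma.2 ⟨mem_sigma.2 ⟨hv, mem_nbr.2 hadj⟩, ?_⟩
      simp only [mem_filter, mem_product]
      exact ⟨⟨⟨o1, o2⟩, o1', o2'⟩, n1, fun h => hb1 (h ▸ b1), fun h => hb1 (h ▸ b2),
        fun h => hb2 (h ▸ b1), fun h => hb2 (h ▸ b2), n1'⟩
    · simp [insert_subset_iff, hg.1, hg.2.1, hg'.1, hg'.2.1]
  refine (card_le_card hcov).trans ((card_union_le _ _).trans (Nat.add_le_add card_image_le ?_))
  exact (card_union_le _ _).trans (Nat.add_le_add card_image_le card_image_le)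

lemma card_sigma_le_mul {α : Type*} {β : α → Type*} (A : Finset α) (B : ∀ a, Finset (β a))
    {r : ℝ} (h : ∀ a ∈ A, (#(B a) : ℝ) ≤ r) : (#(A.sigma B) : ℝ) ≤ #A * r := by
  rw [card_sigma]
  push_cast
  rw [← nsmul_eq_mul, ← sum_const]
  exact sum_le_sum h

lemma PairSystem.card_pairs_le (hP : PairSystem G out P V1) {D : ℝ}
    (hD : ∀ v, (#(out v) : ℝ) ≤ D) : (#(V1.sigma P) : ℝ) ≤ Fintype.card V * D ^ 2 := by
  refine (card_sigma_le_mul V1 P (r := D ^ 2) fun v hv => ?_).trans ?_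
  · have h1 : #(P v) ≤ #(out v ×ˢ out v) := card_le_card fun p hp =>
      mem_product.2 ⟨hP.fst_mem v hv p hp, hP.snd_mem v hv p hp⟩
    rw [card_product] at h1
    have h2 : (#(P v) : ℝ) ≤ #(out v) * #(out v) := by exact_mod_cast h1
    have := hD v
    nlinarith [(Nat.cast_nonneg _ : (0 : ℝ) ≤ #(out v))]
  · refine mul_le_mul_of_nonneg_right ?_ (sq_nonneg _)
    exact_mod_cast card_le_univ V1

lemma PairSystem.card_idx2_le (hP : PairSystem G out P V1) {D Q : ℝ} (hQ0 : 0 ≤ Q)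
    (hD : ∀ v, (#(out v) : ℝ) ≤ D)
    (hQ : ∀ v ∈ V1, ∀ p ∈ P v, (#{a | G.Adj a p.1 ∧ G.Adj a p.2} : ℝ) ≤ Q) :
    (#(idx2 G P V1) : ℝ) ≤ Fintype.card V * D ^ 2 * Q := by
  refine (card_sigma_le_mul _ _ (r := Q) fun t ht => ?_).trans
    (mul_le_mul_of_nonneg_right (hP.card_pairs_le hD) hQ0)
  obtain ⟨h1, h2⟩ := mem_sigma.1 ht
  exact hQ _ h1 _ h2

lemma card_idx3_le {D W : ℝ} (hD0 : 0 ≤ D) (hW0 : 0 ≤ W) (hD : ∀ v, (#(out v) : ℝ) ≤ D)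
    (hW : ∀ v ∈ V1, (#{z ∈ out v ×ˢ nbr G v | G.Adj z.1 z.2} : ℝ) ≤ W) :
    (#(idx3 G out V1) : ℝ) ≤ Fintype.card V * W * D ^ 2 := by
  refine (card_sigma_le_mul _ _ (r := D ^ 2) fun t ht => ?_).trans
    (mul_le_mul_of_nonneg_right ((card_sigma_le_mul _ _ hW).trans ?_) (sq_nonneg _))
  · have h1 := (card_filter_le (out t.1 ×ˢ out t.2.2)
      fun y => t.2.1 ≠ y.1 ∧ t.2.1 ≠ y.2 ∧ y.1 ≠ y.2)
    rw [card_product] at h1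
    refine le_trans (b := (#(out t.1) * #(out t.2.2) : ℝ)) (by exact_mod_cast h1) ?_
    rw [sq]
    exact mul_le_mul (hD _) (hD _) (Nat.cast_nonneg _) hD0
  · refine mul_le_mul_of_nonneg_right ?_ hW0
    exact_mod_cast card_le_univ V1

lemma card_idx4_le {D W : ℝ} (hD0 : 0 ≤ D) (hW0 : 0 ≤ W) (hD : ∀ v, (#(out v) : ℝ) ≤ D)
    (hW : ∀ v ∈ V1, (#(nbr G v) : ℝ) ≤ W) :
    (#(idx4 G out V1) : ℝ) ≤ Fintype.card V * W * D ^ 4 := by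
  refine (card_sigma_le_mul _ _ (r := D ^ 4) fun t ht => ?_).trans
    (mul_le_mul_of_nonneg_right ((card_sigma_le_mul _ _ hW).trans ?_) (by positivity))
  · have h1 := (card_filter_le ((out t.1 ×ˢ out t.1) ×ˢ (out t.2 ×ˢ out t.2))
      fun y => y.1.1 ≠ y.1.2 ∧ y.1.1 ≠ y.2.1 ∧
      y.1.1 ≠ y.2.2 ∧ y.1.2 ≠ y.2.1 ∧ y.1.2 ≠ y.2.2 ∧ y.2.1 ≠ y.2.2)
    rw [card_product, card_product, card_product] at h1
    refine le_trans (b := (#(out t.1) * #(out t.1) * (#(out t.2) * #(out t.2)) : ℝ))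
      (by exact_mod_cast h1) ?_
    have h2 : ∀ v, (#(out v) * #(out v) : ℝ) ≤ D * D := fun v =>
      mul_le_mul (hD _) (hD _) (Nat.cast_nonneg _) hD0
    calc _ ≤ (D * D) * (D * D) := mul_le_mul (h2 _) (h2 _)
          (mul_nonneg (Nat.cast_nonneg _) (Nat.cast_nonneg _)) (mul_nonneg hD0 hD0)
      _ = D ^ 4 := by ring
  · refine mul_le_mul_of_nonneg_right ?_ hW0
    exact_mod_cast card_le_univ V1

end
section
open scoped Classical

variable {V : Type*} [Fintype V]
variable {G : SimpleGraph V} {out : V → Finset V} {P : V → Finset (V × V)} {V1 : Finset V}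

lemma card_avoid_le {D : ℝ}
    (hD : ∀ v, (#(out v) : ℝ) ≤ D) (hdeg : ∀ v ∈ V1, (#(nbr G v) : ℝ) ≤ 12 * D) :
    (#((V1.sigma P).sigma fun t => Rg G out t.1 t.2) : ℝ) ≤ #(V1.sigma P) * (14 * D) := by
  refine card_sigma_le_mul _ _ fun t ht => ?_
  obtain ⟨h1, h2⟩ := mem_sigma.1 ht
  have h3 : #(Rg G out t.1 t.2) ≤ #(nbr G t.1) + (#(out t.2.1) + #(out t.2.2)) :=
    (card_le_card sdiff_subset).trans ((card_union_le _ _).trans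
      (Nat.add_le_add_left (card_union_le _ _) _))
  have h4 : (#(Rg G out t.1 t.2) : ℝ) ≤ #(nbr G t.1) + (#(out t.2.1) + #(out t.2.2)) := by
    exact_mod_cast h3
  have := hdeg _ h1
  have := hD t.2.1
  have := hD t.2.2
  linarith

lemma PairSystem.Ex_goodSet (hP : PairSystem G out P V1) {D η Δ : ℝ} {m : ℕ}
    (hD0 : 0 < D) (hD : ∀ v, (#(out v) : ℝ) ≤ D)
    (hdeg : ∀ v ∈ V1, (#(nbr G v) : ℝ) ≤ 12 * D) (hη0 : 0 < η)
    (hV1 : (Fintype.card V : ℝ) ≤ 6 * #V1) (hPv : ∀ v ∈ V1, η * D ^ 2 / 32 ≤ #(P v))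
    (hΔ : 28 ≤ Δ) (hm1 : D * Δ ≤ m + 1) (hm2 : (m : ℝ) + 1 ≤ 2 * (D * Δ)) :
    Fintype.card V * η / (3072 * Δ ^ 2) ≤
      Ex m (fun S => (#(goodSet G out P V1 S) : ℝ)) := by
  set p : ℝ := 1 / ((m : ℝ) + 1) with hp
  have hp0 : 0 < p := by positivity
  have hDp1 : D * p ≤ 1 / Δ := by
    rw [hp, mul_one_div, div_le_div_iff₀ (by positivity) (by linarith)]
    linarith
  have hDp2 : 1 / (2 * Δ) ≤ D * p := by
    rw [hp, mul_one_div, div_le_div_iff₀ (by linarith) (by positivity)]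
    linarith
  have hΔ0 : 0 < Δ := by linarith
  have h1 : Ex m (fun S => (#{t ∈ V1.sigma P | {t.2.1, t.2.2} ⊆ S} : ℝ)) =
      #(V1.sigma P) * p ^ 2 := by
    refine Ex_count m _ _ fun t ht => ?_
    obtain ⟨h1, h2⟩ := mem_sigma.1 ht
    exact card_pair (hP.ne _ h1 _ h2)
  have h2 : Ex m (fun S => (#{t ∈ (V1.sigma P).sigma (fun t => Rg G out t.1 t.2) |
      {t.1.2.1, t.1.2.2, t.2} ⊆ S} : ℝ)) =
      #((V1.sigma P).sigma fun t => Rg G out t.1 t.2) * p ^ 3 := by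
    refine Ex_count m _ _ fun t ht => ?_
    obtain ⟨h1, h2⟩ := mem_sigma.1 ht
    obtain ⟨h3, h4⟩ := mem_sigma.1 h1
    have h5 := (mem_sdiff.1 h2).2
    rw [mem_insert, mem_singleton, not_or] at h5
    exact card_eq_three.2 ⟨_, _, _, hP.ne _ h3 _ h4, Ne.symm h5.1, Ne.symm h5.2, rfl⟩
  have h3 : Ex m (fun S => (#{t ∈ V1.sigma P | {t.2.1, t.2.2} ⊆ S} : ℝ)) ≤
      2 * Ex m (fun S => (#(goodSet G out P V1 S) : ℝ)) +
      Ex m (fun S => (#{t ∈ (V1.sigma P).sigma (fun t => Rg G out t.1 t.2) |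
      {t.1.2.1, t.1.2.2, t.2} ⊆ S} : ℝ)) := by
    rw [← Ex_mul, ← Ex_add]
    refine Ex_mono m fun S => ?_
    exact_mod_cast hP.card_goodSet S
  rw [h1, h2] at h3
  have h4 := card_avoid_le (P := P) hD hdeg
  have h5 : (Fintype.card V : ℝ) * η * D ^ 2 / 192 ≤ #(V1.sigma P) := by
    rw [card_sigma]
    push_cast
    have : ∑ _v ∈ V1, η * D ^ 2 / 32 ≤ ∑ v ∈ V1, (#(P v) : ℝ) := sum_le_sum hPv
    rw [sum_const, nsmul_eq_mul] at this
    have h6 : 0 ≤ η * D ^ 2 / 32 := by positivity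
    nlinarith
  have h6 : (#((V1.sigma P).sigma fun t => Rg G out t.1 t.2) : ℝ) * p ^ 3 ≤
      #(V1.sigma P) * p ^ 2 / 2 := by
    have h7 : 14 * (D * p) ≤ 1 / 2 := by
      have : 1 / Δ ≤ 1 / 28 := one_div_le_one_div_of_le (by norm_num) hΔ
      linarith
    have h8 := mul_le_mul_of_nonneg_right h4 (by positivity : 0 ≤ p ^ 3)
    have h9 : (0 : ℝ) ≤ #(V1.sigma P) * p ^ 2 := by positivity
    calc _ ≤ _ := h8
      _ = #(V1.sigma P) * p ^ 2 * (14 * (D * p)) := by ring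
      _ ≤ #(V1.sigma P) * p ^ 2 * (1 / 2) := mul_le_mul_of_nonneg_left h7 h9
      _ = _ := by ring
  have h7 : (Fintype.card V : ℝ) * η * D ^ 2 / 192 * p ^ 2 ≤ #(V1.sigma P) * p ^ 2 :=
    mul_le_mul_of_nonneg_right h5 (by positivity)
  have h8 : (1 / (2 * Δ)) ^ 2 ≤ (D * p) ^ 2 := pow_le_pow_left₀ (by positivity) hDp2 2
  have h9 := mul_le_mul_of_nonneg_left h8 (by positivity : 0 ≤ (Fintype.card V : ℝ) * η / 768)
  have h10 : (Fintype.card V : ℝ) * η / (3072 * Δ ^ 2) =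
      (Fintype.card V : ℝ) * η / 768 * (1 / (2 * Δ)) ^ 2 := by
    field_simp
    ring
  rw [h10]
  have h11 : (Fintype.card V : ℝ) * η / 768 * (D * p) ^ 2 =
    (Fintype.card V : ℝ) * η * D ^ 2 / 192 * p ^ 2 / 4 := by ring
  linarith

lemma PairSystem.Ex_conf (hP : PairSystem G out P V1) {D Q θ Δ : ℝ} {m : ℕ}
    (hD0 : 0 < D) (hD : ∀ v, (#(out v) : ℝ) ≤ D)
    (hdeg : ∀ v ∈ V1, (#(nbr G v) : ℝ) ≤ 12 * D)
    (hW : ∀ v ∈ V1, (#{z ∈ out v ×ˢ nbr G v | G.Adj z.1 z.2} : ℝ) ≤ 12 * θ * D ^ 2)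
    (hQ : ∀ v ∈ V1, ∀ p ∈ P v, (#{a | G.Adj a p.1 ∧ G.Adj a p.2} : ℝ) ≤ Q)
    (hQ0 : 0 ≤ Q) (hθ0 : 0 ≤ θ)
    (hΔ : 0 < Δ) (hθΔ : θ * Δ ≤ 1) (hQΔ : Q * Δ ^ 2 ≤ D) (hm1 : D * Δ ≤ m + 1) :
    Ex m (fun S => (#{z ∈ goodSet G out P V1 S ×ˢ goodSet G out P V1 S |
      Conf G S z.1 z.2} : ℝ)) ≤ 25 * Fintype.card V * D / Δ ^ 4 := by
  set p : ℝ := 1 / ((m : ℝ) + 1) with hp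
  have hp0 : 0 < p := by positivity
  have hDp0 : 0 < D * p := by positivity
  have hDp1 : D * p ≤ 1 / Δ := by
    rw [hp, mul_one_div, div_le_div_iff₀ (by positivity) (by linarith)]
    linarith
  have h4 : Ex m (fun S => (#{t ∈ idx4 G out V1 |
      {t.2.1.1, t.2.1.2, t.2.2.1, t.2.2.2} ⊆ S} : ℝ)) = #(idx4 G out V1) * p ^ 4 := by
    refine Ex_count m _ _ fun t ht => ?_
    obtain ⟨-, h1⟩ := mem_sigma.1 ht
    obtain ⟨-, a1, a2, a3, a4, a5, a6⟩ := mem_filter.1 h1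
    rw [card_insert_of_notMem (by simp [a1, a2, a3]), card_insert_of_notMem (by simp [a4, a5]),
      card_pair a6]
  have h3 : Ex m (fun S => (#{t ∈ idx3 G out V1 | {t.1.2.1, t.2.1, t.2.2} ⊆ S} : ℝ)) =
      #(idx3 G out V1) * p ^ 3 := by
    refine Ex_count m _ _ fun t ht => ?_
    obtain ⟨-, h1⟩ := mem_sigma.1 ht
    obtain ⟨-, a1, a2, a3⟩ := mem_filter.1 h1
    exact card_eq_three.2 ⟨_, _, _, a1, a2, a3, rfl⟩
  have h2 : Ex m (fun S => (#{t ∈ idx2 G P V1 | {t.1.2.1, t.1.2.2} ⊆ S} : ℝ)) =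
      #(idx2 G P V1) * p ^ 2 := by
    refine Ex_count m _ _ fun t ht => ?_
    obtain ⟨h1, -⟩ := mem_sigma.1 ht
    obtain ⟨h2, h3⟩ := mem_sigma.1 h1
    exact card_pair (hP.ne _ h2 _ h3)
  have h5 : Ex m (fun S => (#{z ∈ goodSet G out P V1 S ×ˢ goodSet G out P V1 S |
      Conf G S z.1 z.2} : ℝ)) ≤ #(idx4 G out V1) * p ^ 4 + (#(idx3 G out V1) * p ^ 3 +
      #(idx2 G P V1) * p ^ 2) := by
    rw [← h4, ← h3, ← h2, ← Ex_add, ← Ex_add]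
    refine Ex_mono m fun S => ?_
    exact_mod_cast hP.card_conf S
  have hn : (0 : ℝ) ≤ Fintype.card V := Nat.cast_nonneg _
  have b4 : (#(idx4 G out V1) : ℝ) * p ^ 4 ≤ 12 * Fintype.card V * D / Δ ^ 4 := by
    have := mul_le_mul_of_nonneg_right
      (card_idx4_le (G := G) (W := 12 * D) hD0.le (by positivity) hD hdeg)
      (by positivity : 0 ≤ p ^ 4)
    calc _ ≤ _ := this
      _ = 12 * Fintype.card V * D * (D * p) ^ 4 := by ring
      _ ≤ 12 * Fintype.card V * D * (1 / Δ) ^ 4 :=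
        mul_le_mul_of_nonneg_left (pow_le_pow_left₀ hDp0.le hDp1 4) (by positivity)
      _ = _ := by rw [one_div, inv_pow]; rfl
  have b3 : (#(idx3 G out V1) : ℝ) * p ^ 3 ≤ 12 * Fintype.card V * D / Δ ^ 4 := by
    have := mul_le_mul_of_nonneg_right
      (card_idx3_le (G := G) (W := 12 * θ * D ^ 2) hD0.le (by positivity) hD hW)
      (by positivity : 0 ≤ p ^ 3)
    calc _ ≤ _ := this
      _ = 12 * Fintype.card V * D * θ * (D * p) ^ 3 := by ring
      _ ≤ 12 * Fintype.card V * D * θ * (1 / Δ) ^ 3 :=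
        mul_le_mul_of_nonneg_left (pow_le_pow_left₀ hDp0.le hDp1 3) (by positivity)
      _ = 12 * Fintype.card V * D / Δ ^ 4 * (θ * Δ) := by field_simp
      _ ≤ 12 * Fintype.card V * D / Δ ^ 4 * 1 :=
        mul_le_mul_of_nonneg_left hθΔ (by positivity)
      _ = _ := mul_one _
  have b2 : (#(idx2 G P V1) : ℝ) * p ^ 2 ≤ Fintype.card V * D / Δ ^ 4 := by
    have := mul_le_mul_of_nonneg_right (hP.card_idx2_le hQ0 hD hQ) (by positivity : 0 ≤ p ^ 2)
    calc _ ≤ _ := this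
      _ = Fintype.card V * Q * (D * p) ^ 2 := by ring
      _ ≤ Fintype.card V * Q * (1 / Δ) ^ 2 :=
        mul_le_mul_of_nonneg_left (pow_le_pow_left₀ hDp0.le hDp1 2) (by positivity)
      _ = Fintype.card V / Δ ^ 4 * (Q * Δ ^ 2) := by field_simp
      _ ≤ Fintype.card V / Δ ^ 4 * D := mul_le_mul_of_nonneg_left hQΔ (by positivity)
      _ = _ := by ring
  have e : 25 * (Fintype.card V : ℝ) * D / Δ ^ 4 = 12 * Fintype.card V * D / Δ ^ 4 +
    (12 * Fintype.card V * D / Δ ^ 4 + Fintype.card V * D / Δ ^ 4) := by ring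
  rw [e]
  linarith

/-- Random sparsification of a pair system yields an induced `1`-subdivision of a dense graph. -/
theorem PairSystem.exists_indSub (hP : PairSystem G out P V1) [Nonempty V] {D Q θ η Δ : ℝ}
    {m : ℕ} (hD0 : 0 < D) (hD : ∀ v, (#(out v) : ℝ) ≤ D)
    (hdeg : ∀ v ∈ V1, (#(nbr G v) : ℝ) ≤ 12 * D)
    (hW : ∀ v ∈ V1, (#{z ∈ out v ×ˢ nbr G v | G.Adj z.1 z.2} : ℝ) ≤ 12 * θ * D ^ 2)
    (hQ : ∀ v ∈ V1, ∀ p ∈ P v, (#{a | G.Adj a p.1 ∧ G.Adj a p.2} : ℝ) ≤ Q)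
    (hQ1 : 1 ≤ Q) (hη0 : 0 < η) (hη1 : η ≤ 1) (hθ0 : 0 ≤ θ)
    (hV1 : (Fintype.card V : ℝ) ≤ 6 * #V1) (hPv : ∀ v ∈ V1, η * D ^ 2 / 32 ≤ #(P v))
    (hΔ : 28 ≤ Δ) (hθΔ : θ * Δ ≤ 1) (hQΔ : Q * Δ ^ 2 ≤ D)
    (hm1 : D * Δ ≤ m + 1) (hm2 : (m : ℝ) + 1 ≤ 2 * (D * Δ)) :
    ∃ B : Finset V, ∃ H : SimpleGraph B, B.Nonempty ∧ IndSub G H ∧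
      η ^ 2 * Δ * #B ≤ 13 * 10 ^ 9 * e2 H univ := by
  have hΔ0 : 0 < Δ := by linarith
  have hn : (0 : ℝ) < Fintype.card V := by exact_mod_cast Fintype.card_pos
  set n : ℝ := (Fintype.card V : ℝ) with hndef
  obtain ⟨a, ha⟩ : ∃ a, a = n * η / (3072 * Δ ^ 2) := ⟨_, rfl⟩
  obtain ⟨b, hb⟩ : ∃ b, b = 25 * n * D / Δ ^ 4 := ⟨_, rfl⟩
  obtain ⟨g, hg⟩ : ∃ g, g = n / (D * Δ) := ⟨_, rfl⟩
  have ha0 : 0 < a := by rw [ha]; positivity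
  have hb0 : 0 < b := by rw [hb]; positivity
  have hg0 : 0 < g := by rw [hg]; positivity
  have e1 := hP.Ex_goodSet hD0 hD hdeg hη0 hV1 hPv hΔ hm1 hm2
  have e2' := hP.Ex_conf hD0 hD hdeg hW hQ (by linarith) hθ0 hΔ0 hθΔ hQΔ hm1
  have e3 : Ex m (fun S : Finset V => (#S : ℝ)) ≤ g := by
    have h1 := Ex_count m (univ : Finset V) (fun v => {v}) (j := 1) (fun v _ => card_singleton v)
    have h2 : (fun S : Finset V => (#{t ∈ univ | ({t} : Finset V) ⊆ S} : ℝ)) =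
        fun S => (#S : ℝ) := by
      funext S
      congr 2
      ext v
      simp
    rw [h2] at h1
    rw [h1, card_univ, pow_one, hg, mul_one_div]
    exact div_le_div_of_nonneg_left hn.le (by positivity) hm1
  rw [← hndef, ← ha] at e1
  rw [← hndef, ← hb] at e2'
  have hpos : 0 < Ex m (fun S => 1 / a * (#(goodSet G out P V1 S) : ℝ) +
      ((-1 / (3 * b)) * (#{z ∈ goodSet G out P V1 S ×ˢ goodSet G out P V1 S |
        Conf G S z.1 z.2} : ℝ) + (-1 / (3 * g)) * (#S : ℝ))) := by
    rw [Ex_add, Ex_add, Ex_mul, Ex_mul, Ex_mul]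
    have h1 : 1 ≤ 1 / a * Ex m (fun S => (#(goodSet G out P V1 S) : ℝ)) := by
      rw [one_div, inv_mul_eq_div, le_div_iff₀ ha0]
      linarith
    have h2 := mul_le_mul_of_nonneg_left e2' (by positivity : 0 ≤ 1 / (3 * b))
    have h3 := mul_le_mul_of_nonneg_left e3 (by positivity : 0 ≤ 1 / (3 * g))
    have h4 : 1 / (3 * b) * b = 1 / 3 := by field_simp
    have h5 : 1 / (3 * g) * g = 1 / 3 := by field_simp
    rw [neg_div, neg_div, neg_mul, neg_mul]
    linarith
  obtain ⟨S, hS⟩ := exists_pos_of_Ex hpos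
  rw [neg_div, neg_div, neg_mul, neg_mul, one_div_mul_eq_div, one_div_mul_eq_div,
    one_div_mul_eq_div] at hS
  set A2 := goodSet G out P V1 S with hA2
  have hcn : (0 : ℝ) ≤ #{z ∈ A2 ×ˢ A2 | Conf G S z.1 z.2} / (3 * b) :=
    div_nonneg (Nat.cast_nonneg _) (by positivity)
  have hSn : (0 : ℝ) ≤ #S / (3 * g) := div_nonneg (Nat.cast_nonneg _) (by positivity)
  have hA0 : (0 : ℝ) < #A2 := by
    have : 0 < (#A2 : ℝ) / a := by linarith
    exact (div_pos_iff_of_pos_right ha0).1 this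
  have hconf : (#{z ∈ A2 ×ˢ A2 | Conf G S z.1 z.2} : ℝ) ≤ 3 * b / a * #A2 := by
    have h1 : (#{z ∈ A2 ×ˢ A2 | Conf G S z.1 z.2} : ℝ) / (3 * b) ≤ #A2 / a := by linarith
    rw [div_le_iff₀ (by positivity)] at h1
    refine h1.trans (le_of_eq ?_)
    ring
  have hSA : (#S : ℝ) ≤ 3 * g / a * #A2 := by
    have h1 : (#S : ℝ) / (3 * g) ≤ #A2 / a := by linarith
    rw [div_le_iff₀ (by positivity)] at h1
    refine h1.trans (le_of_eq ?_)
    ring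
  have hκ : 3 * b / a = 230400 * D / (Δ ^ 2 * η) := by
    rw [hb, ha]
    field_simp
    norm_num
  have hγ : 3 * g / a = 9216 * Δ / (D * η) := by
    rw [hg, ha]
    field_simp
    norm_num
  have hκ1 : 1 ≤ 3 * b / a := by
    rw [hκ, le_div_iff₀ (by positivity)]
    have h1 : Δ ^ 2 * η ≤ Δ ^ 2 * 1 := mul_le_mul_of_nonneg_left hη1 (by positivity)
    have h2 : 1 * Δ ^ 2 ≤ Q * Δ ^ 2 := mul_le_mul_of_nonneg_right hQ1 (by positivity)
    linarith
  obtain ⟨A, hA, hAc, hfree⟩ := exists_conflict_free (Conf G S)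
    (fun x y h => ⟨h.1.symm, h.2.imp (fun h => h.symm) (fun h => h.symm)⟩) A2 hκ1 hconf
  have hAne : A.Nonempty := by
    rw [← card_pos]
    by_contra hc
    have : #A = 0 := by omega
    rw [this] at hAc
    simp only [Nat.cast_zero, mul_zero] at hAc
    linarith
  obtain ⟨B, hB, H, hBne, hI, hH⟩ := hP.indSub hA hfree hAne
  refine ⟨B, H, hBne, hI, ?_⟩
  have h1 : (#B : ℝ) ≤ #S := by exact_mod_cast card_le_card hB
  have h2 : (#A : ℝ) ≤ e2 H univ := by exact_mod_cast hH
  have h3 : (#B : ℝ) ≤ 3 * g / a * (6 * (3 * b / a) * #A) :=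
    h1.trans (hSA.trans (mul_le_mul_of_nonneg_left hAc (by positivity)))
  rw [hκ, hγ] at h3
  have h4 : 9216 * Δ / (D * η) * (6 * (230400 * D / (Δ ^ 2 * η)) * #A) =
      12740198400 * #A / (η ^ 2 * Δ) := by
    field_simp
    norm_num
  rw [h4, le_div_iff₀ (by positivity)] at h3
  have h5 : (0 : ℝ) ≤ #A := Nat.cast_nonneg _
  linarith

end
section
open scoped Classical

variable {V : Type*} {G : SimpleGraph V}

lemma e2_eq_sum (G : SimpleGraph V) (U : Finset V) :
    e2 G U = ∑ v ∈ U, #{y ∈ U | G.Adj v y} := by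
  rw [e2, card_filter, sum_product]
  refine sum_congr rfl fun v _ => ?_
  rw [card_filter]

lemma exists_orientation {D : ℝ} (hD : ∀ T : Finset V, (e2 G T : ℝ) ≤ D * #T) (U : Finset V) :
    ∃ out : V → Finset V, (∀ v ∈ U, ∀ u ∈ out v, G.Adj v u) ∧
      (∀ u ∈ U, ∀ w ∈ U, G.Adj u w → w ∈ out u ∨ u ∈ out w) ∧ ∀ v ∈ U, (#(out v) : ℝ) ≤ D := by
  induction U using Finset.strongInduction with
  | H U ih =>
    rcases U.eq_empty_or_nonempty with rfl | hU
    · exact ⟨fun _ => ∅, by simp⟩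
    have h1 : ∃ v ∈ U, (#{y ∈ U | G.Adj v y} : ℝ) ≤ D := by
      refine exists_le_of_sum_le hU ?_
      have := hD U
      rw [e2_eq_sum] at this
      push_cast at this
      rw [sum_const, nsmul_eq_mul]
      linarith
    obtain ⟨v, hv, hvD⟩ := h1
    obtain ⟨out, ho1, ho2, ho3⟩ := ih (U.erase v) (erase_ssubset hv)
    refine ⟨fun u => if u = v then {y ∈ U | G.Adj v y} else out u, ?_, ?_, ?_⟩
    · intro u hu w hw
      by_cases huv : u = v
      · subst huv
        simp only [if_true, mem_filter] at hw
        exact hw.2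
      · simp only [huv, if_false] at hw
        exact ho1 u (mem_erase.2 ⟨huv, hu⟩) w hw
    · intro u hu w hw huw
      by_cases huv : u = v
      · left
        subst huv
        simp [hw, huw]
      · by_cases hwv : w = v
        · right
          subst hwv
          simp [hu, huw.symm]
        · simp only [huv, hwv, if_false]
          exact ho2 u (mem_erase.2 ⟨huv, hu⟩) w (mem_erase.2 ⟨hwv, hw⟩) huw
    · intro u hu
      by_cases huv : u = v
      · simpa only [huv, if_true] using hvD
      · simp only [huv, if_false]
        exact ho3 u (mem_erase.2 ⟨huv, hu⟩)

lemma e2_univ_le_two_mul_sum_out [Fintype V] {out : V → Finset V}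
    (ho : ∀ u w, G.Adj u w → w ∈ out u ∨ u ∈ out w) :
    e2 G univ ≤ 2 * ∑ v, #(out v) := by
  have h1 : e2 G univ ≤ #(((univ : Finset V).sigma out).image (fun x => (x.1, x.2)) ∪
      ((univ : Finset V).sigma out).image (fun x => (x.2, x.1))) := by
    refine card_le_card ?_
    rintro ⟨u, w⟩ h
    simp only [mem_filter] at h
    simp only [mem_union, mem_image, mem_sigma, mem_univ, true_and]
    rcases ho u w h.2 with h' | h'
    · exact Or.inl ⟨⟨u, w⟩, h', rfl⟩
    · exact Or.inr ⟨⟨w, u⟩, h', rfl⟩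
  have h2 := card_sigma (univ : Finset V) out
  have h3 := card_image_le (s := (univ : Finset V).sigma out) (f := fun x => (x.1, x.2))
  have h4 := card_image_le (s := (univ : Finset V).sigma out) (f := fun x => (x.2, x.1))
  have h5 := card_union_le (((univ : Finset V).sigma out).image (fun x => (x.1, x.2)))
      (((univ : Finset V).sigma out).image (fun x => (x.2, x.1)))
  omega

/-- In a graph of maximum density, many vertices have large outdegree and bounded degree. -/
lemma card_le_six_mul [Fintype V] {D : ℝ} (hD0 : 0 < D) {out : V → Finset V}
    (ho : ∀ u w, G.Adj u w → w ∈ out u ∨ u ∈ out w) (hoD : ∀ v, (#(out v) : ℝ) ≤ D)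
    (he : (e2 G univ : ℝ) = D * Fintype.card V) :
    (Fintype.card V : ℝ) ≤
      6 * #{v | D / 4 ≤ (#(out v) : ℝ) ∧ (#(nbr G v) : ℝ) ≤ 12 * D} := by
  have h1 : ∀ v : V, (#(out v) : ℝ) ≤
      D * (if D / 4 ≤ (#(out v) : ℝ) ∧ (#(nbr G v) : ℝ) ≤ 12 * D then 1 else 0) + D / 4 +
        (#(nbr G v) : ℝ) / 12 := by
    intro v
    have h0 := hoD v
    have hn : (0 : ℝ) ≤ #(nbr G v) := Nat.cast_nonneg _
    split_ifs with h
    · linarith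
    · by_cases h' : D / 4 ≤ (#(out v) : ℝ)
      · have : ¬ (#(nbr G v) : ℝ) ≤ 12 * D := fun hc => h ⟨h', hc⟩
        linarith
      · linarith
  have h2 := sum_le_sum fun v (_ : v ∈ univ) => h1 v
  rw [sum_add_distrib, sum_add_distrib, ← mul_sum, ← sum_div, sum_const, nsmul_eq_mul, card_univ,
    sum_boole] at h2
  have h3 : (e2 G univ : ℝ) ≤ 2 * ∑ v, (#(out v) : ℝ) := by
    exact_mod_cast e2_univ_le_two_mul_sum_out ho
  have h4 : (e2 G univ : ℝ) = ∑ v, (#(nbr G v) : ℝ) := by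
    exact_mod_cast e2_univ_eq G
  rw [← sum_div, ← h4] at h2
  rw [he] at h2 h3
  set c : ℝ := (#{v | D / 4 ≤ (#(out v) : ℝ) ∧ (#(nbr G v) : ℝ) ≤ 12 * D} : ℝ)
  have h5 : D * (Fintype.card V : ℝ) ≤ D * (6 * c) := by linarith
  exact le_of_mul_le_mul_left h5 hD0

/-- A densest induced subgraph. -/
lemma exists_densest [Fintype V] [Nonempty V] (G : SimpleGraph V) :
    ∃ S : Finset V, S.Nonempty ∧ ∀ T : Finset V,
      (e2 G T : ℝ) ≤ (e2 G S : ℝ) / #S * #T := by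
  obtain ⟨S, hS, hmax⟩ := exists_max_image ({S : Finset V | S.Nonempty} : Finset (Finset V))
    (fun S => (e2 G S : ℝ) / #S) ⟨univ, by simp⟩
  simp only [mem_filter, mem_univ, true_and] at hS hmax
  refine ⟨S, hS, fun T => ?_⟩
  rcases T.eq_empty_or_nonempty with rfl | hT
  · simp [e2]
  · have h0 : (0 : ℝ) < #T := by exact_mod_cast hT.card_pos
    have := hmax T hT
    rwa [div_le_iff₀ h0] at this

lemma e2_induce (G : SimpleGraph V) (S : Finset V) (T : Finset S) :
    e2 (G.induce (S : Set V)) T = e2 G (T.map (Function.Embedding.subtype _)) := by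
  rw [e2, e2]
  refine card_bij (fun p _ => ((p.1 : V), (p.2 : V))) ?_ ?_ ?_
  · rintro ⟨a, b⟩ h
    rw [mem_filter, mem_product] at h ⊢
    exact ⟨⟨mem_map_of_mem (Function.Embedding.subtype _) h.1.1,
      mem_map_of_mem (Function.Embedding.subtype _) h.1.2⟩, h.2⟩
  · rintro ⟨a, b⟩ _ ⟨c, d⟩ _ h
    rw [Prod.mk.injEq] at h ⊢
    exact ⟨Subtype.ext h.1, Subtype.ext h.2⟩
  · rintro ⟨a, b⟩ h
    simp only [mem_filter, mem_product, mem_map, Function.Embedding.subtype_apply] at h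
    obtain ⟨⟨⟨a', ha', rfl⟩, ⟨b', hb', rfl⟩⟩, h⟩ := h
    exact ⟨(a', b'), by simpa [ha', hb'] using h, rfl⟩

lemma hasClique_map {W : Type*} {H : SimpleGraph W} {k : ℕ} (f : H ↪g G) (h : HasClique H k) :
    HasClique G k := by
  obtain ⟨t, ht⟩ := h
  refine ⟨t.map f.toEmbedding, ?_⟩
  rw [SimpleGraph.isNClique_iff] at ht ⊢
  refine ⟨?_, by rw [card_map]; exact ht.2⟩
  intro a ha b hb hab
  simp only [coe_map, Set.mem_image, mem_coe] at ha hb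
  obtain ⟨a', ha', rfl⟩ := ha
  obtain ⟨b', hb', rfl⟩ := hb
  exact f.map_adj_iff.2 (ht.1 ha' hb' fun h => hab (by rw [h]))

lemma nonempty_embedding_of_not_noBip {s t : ℕ} (h : ¬ NoBip G s t) :
    Nonempty (completeBipartiteGraph (Fin s) (Fin t) ↪g G) := by
  simp only [NoBip] at h
  push Not at h
  obtain ⟨I, J, hI, hJ, hI', hJ', hIJ⟩ := h
  let e := I.equivFinOfCardEq hI
  let f := J.equivFinOfCardEq hJ
  have hd : ∀ a b, ((e.symm a : I) : V) ≠ (f.symm b : J) := by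
    intro a b hc
    have := hIJ _ (e.symm a).2 _ (f.symm b).2
    rw [hc] at this
    exact G.loopless.irrefl _ this
  refine ⟨⟨⟨Sum.elim (fun a => (e.symm a : V)) (fun b => (f.symm b : V)), ?_⟩, ?_⟩⟩
  · rintro (a | a) (b | b) hab
    · simpa using hab
    · exact absurd hab (hd a b)
    · exact absurd hab.symm (hd b a)
    · simpa using hab
  · rintro (a | a) (b | b)
    · exact iff_of_false (hI' _ (e.symm a).2 _ (e.symm b).2) (by simp)
    · exact iff_of_true (hIJ _ (e.symm a).2 _ (f.symm b).2) (by simp)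
    · exact iff_of_true (hIJ _ (e.symm b).2 _ (f.symm a).2).symm (by simp)
    · exact iff_of_false (hJ' _ (f.symm a).2 _ (f.symm b).2) (by simp)

lemma two_mul_ncard_edgeSet [Fintype V] (G : SimpleGraph V) :
    2 * G.edgeSet.ncard = e2 G univ := by
  rw [e2_univ_eq, Set.ncard_eq_toFinset_card', ← SimpleGraph.edgeFinset,
    ← SimpleGraph.sum_degrees_eq_twice_card_edges]
  refine sum_congr rfl fun v _ => ?_
  rw [← SimpleGraph.card_neighborFinset_eq_degree]
  congr 1
  ext u
  simp

end
section
open scoped Classical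

lemma card_light_pairs {V : Type*} [Fintype V] {G : SimpleGraph V} {S : Finset V} {Q : ℕ}
    {θ η : ℝ}
    (hsp : (#{z ∈ S ×ˢ S | G.Adj z.1 z.2} : ℝ) ≤ θ * #S * #S) (hθη : 4 * θ ≤ η)
    (hS : 4 ≤ η * #S)
    (hnon : η * (#S : ℝ) ^ 2 < #{z ∈ S ×ˢ S | #{a | G.Adj a z.1 ∧ G.Adj a z.2} < Q}) :
    η * (#S : ℝ) ^ 2 / 2 ≤ #{z ∈ S ×ˢ S | #{a | G.Adj a z.1 ∧ G.Adj a z.2} < Q ∧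
      z.1 ≠ z.2 ∧ ¬ G.Adj z.1 z.2} := by
  have h1 : #{z ∈ S ×ˢ S | #{a | G.Adj a z.1 ∧ G.Adj a z.2} < Q} ≤
      #{z ∈ S ×ˢ S | #{a | G.Adj a z.1 ∧ G.Adj a z.2} < Q ∧ z.1 ≠ z.2 ∧ ¬ G.Adj z.1 z.2} +
        (#S + #{z ∈ S ×ˢ S | G.Adj z.1 z.2}) := by
    have h2 : #S = #S.diag := by simp
    rw [h2]
    refine le_trans (card_le_card ?_) ((card_union_le _ _).trans
      (Nat.add_le_add_left (card_union_le _ _) _))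
    rintro ⟨u, w⟩ h
    simp only [mem_union, mem_filter, mem_product, mem_diag] at h ⊢
    by_cases h3 : u = w
    · exact Or.inr (Or.inl ⟨h.1.1, h3⟩)
    · by_cases h4 : G.Adj u w
      · exact Or.inr (Or.inr ⟨h.1, h4⟩)
      · exact Or.inl ⟨h.1, h.2, h3, h4⟩
  have h1' : (#{z ∈ S ×ˢ S | #{a | G.Adj a z.1 ∧ G.Adj a z.2} < Q} : ℝ) ≤
      #{z ∈ S ×ˢ S | #{a | G.Adj a z.1 ∧ G.Adj a z.2} < Q ∧ z.1 ≠ z.2 ∧ ¬ G.Adj z.1 z.2} +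
        (#S + #{z ∈ S ×ˢ S | G.Adj z.1 z.2}) := by exact_mod_cast h1
  have h0 : (0 : ℝ) ≤ #S := Nat.cast_nonneg _
  have h5 := mul_le_mul_of_nonneg_right hS h0
  have h6 := mul_le_mul_of_nonneg_right hθη (mul_nonneg h0 h0)
  linarith

/-- In a graph of maximum density that is sparse between all large sets, there is an induced
balanced subdivision of a large complete graph. -/
theorem hasInduced_of_densest {V : Type} [Fintype V] [Nonempty V] {G : SimpleGraph V} {h q : ℕ}
    {D θ η Δ : ℝ} (hh : 1 ≤ h) (hq : 1 ≤ q)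
    (hbs : ∀ (W : Type) [Fintype W] [Nonempty W] (H : SimpleGraph W),
      4 * h ^ 30100 * Fintype.card W ≤ e2 H univ → BS H h)
    (hsp : ∀ X Y : Finset V, q ≤ #X → q ≤ #Y →
      (#{z ∈ X ×ˢ Y | G.Adj z.1 z.2} : ℝ) ≤ θ * #X * #Y)
    (hmax : ∀ T : Finset V, (e2 G T : ℝ) ≤ D * #T) (he : (e2 G univ : ℝ) = D * Fintype.card V)
    (hqD : (q : ℝ) ≤ D / 4) (hhD : 9 * (h : ℝ) ^ 2 ≤ D / 4) (hθ0 : 0 ≤ θ)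
    (hθ : 9 * (h : ℝ) ^ 4 * θ ≤ 1) (hη : 9 * (h : ℝ) ^ 2 * η ≤ 1) (hη0 : 0 < η) (hη1 : η ≤ 1)
    (hθη : 4 * θ ≤ η) (hηD : 16 ≤ η * D) (hΔ : 28 ≤ Δ) (hθΔ : θ * Δ ≤ 1)
    (hQΔ : ((3 * q : ℕ) : ℝ) * Δ ^ 2 ≤ D)
    (hfin : 13 * 10 ^ 9 * (4 * (h : ℝ) ^ 30100) ≤ η ^ 2 * Δ) :
    HasInducedBalancedSubdivision G h := by
  have hD1 : 16 ≤ D := by nlinarith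
  have hD0 : 0 < D := by linarith
  obtain ⟨out, ho1, ho2, ho3⟩ := exists_orientation hmax univ
  simp only [mem_univ, forall_true_left] at ho1 ho2 ho3
  set V1 : Finset V := {v | D / 4 ≤ (#(out v) : ℝ) ∧ (#(nbr G v) : ℝ) ≤ 12 * D} with hV1
  have hV1c : (Fintype.card V : ℝ) ≤ 6 * #V1 := card_le_six_mul hD0 ho2 ho3 he
  have hV1m : ∀ v ∈ V1, D / 4 ≤ (#(out v) : ℝ) ∧ (#(nbr G v) : ℝ) ≤ 12 * D := fun v hv => by
    rw [hV1, mem_filter] at hv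
    exact hv.2
  clear_value V1
  have hqo : ∀ v ∈ V1, q ≤ #(out v) := fun v hv => by
    exact_mod_cast hqD.trans (hV1m v hv).1
  by_cases hheavy : ∃ v ∈ V1,
      (#{z ∈ out v ×ˢ out v | #{a | G.Adj a z.1 ∧ G.Adj a z.2} < 3 * q} : ℝ) ≤
        η * (#(out v) : ℝ) ^ 2
  · obtain ⟨v, hv, hnon⟩ := hheavy
    refine (indSub_top_of_heavy hh hq le_rfl (hqo v hv) ?_ hθ0 hθ hη hsp hnon).hasInduced
      (bs_top h)
    exact_mod_cast hhD.trans (hV1m v hv).1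
  push Not at hheavy
  obtain ⟨P, hPdef⟩ : ∃ P : V → Finset (V × V), ∀ v, P v = {z ∈ out v ×ˢ out v |
      #{a | G.Adj a z.1 ∧ G.Adj a z.2} < 3 * q ∧ z.1 ≠ z.2 ∧ ¬ G.Adj z.1 z.2} :=
    ⟨_, fun v => rfl⟩
  have hPm : ∀ v, ∀ p ∈ P v, (p.1 ∈ out v ∧ p.2 ∈ out v) ∧
      #{a | G.Adj a p.1 ∧ G.Adj a p.2} < 3 * q ∧ p.1 ≠ p.2 ∧ ¬ G.Adj p.1 p.2 := by
    intro v p hp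
    rw [hPdef, mem_filter, mem_product] at hp
    exact hp
  have hP : PairSystem G out P V1 :=
    { out_adj := ho1
      orient := ho2
      fst_mem := fun v _ p hp => (hPm v p hp).1.1
      snd_mem := fun v _ p hp => (hPm v p hp).1.2
      ne := fun v _ p hp => (hPm v p hp).2.2.1
      not_adj := fun v _ p hp => (hPm v p hp).2.2.2 }
  have hPv : ∀ v ∈ V1, η * D ^ 2 / 32 ≤ #(P v) := by
    intro v hv
    have h1 := (hV1m v hv).1
    have h2 : 4 ≤ η * #(out v) := by
      have := mul_le_mul_of_nonneg_left h1 hη0.le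
      linarith
    have h3 := card_light_pairs (hsp _ _ (hqo v hv) (hqo v hv)) hθη h2 (hheavy v hv)
    rw [hPdef]
    refine le_trans ?_ h3
    have h4 : (D / 4) ^ 2 ≤ (#(out v) : ℝ) ^ 2 := pow_le_pow_left₀ (by linarith) h1 2
    have h5 := mul_le_mul_of_nonneg_left h4 hη0.le
    linarith
  have hW : ∀ v ∈ V1, (#{z ∈ out v ×ˢ nbr G v | G.Adj z.1 z.2} : ℝ) ≤ 12 * θ * D ^ 2 := by
    intro v hv
    have hsub : out v ⊆ nbr G v := fun u hu => mem_nbr.2 (ho1 v u hu)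
    have h1 := hsp (out v) (nbr G v) (hqo v hv) ((hqo v hv).trans (card_le_card hsub))
    have h2 : (#(out v) : ℝ) * #(nbr G v) ≤ D * (12 * D) :=
      mul_le_mul (ho3 v) (hV1m v hv).2 (Nat.cast_nonneg _) hD0.le
    have h3 := mul_le_mul_of_nonneg_left h2 hθ0
    linarith
  have hq1 : (1 : ℝ) ≤ ((3 * q : ℕ) : ℝ) := by exact_mod_cast (by omega : 1 ≤ 3 * q)
  have hDΔ : 1 ≤ D * Δ := by nlinarith
  have hceil : ((⌈D * Δ⌉₊ - 1 : ℕ) : ℝ) + 1 = (⌈D * Δ⌉₊ : ℝ) := by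
    have : 1 ≤ ⌈D * Δ⌉₊ := Nat.one_le_ceil_iff.2 (by linarith)
    push_cast [this]
    ring
  have hm1 : D * Δ ≤ ((⌈D * Δ⌉₊ - 1 : ℕ) : ℝ) + 1 := by
    rw [hceil]
    exact Nat.le_ceil _
  have hm2 : ((⌈D * Δ⌉₊ - 1 : ℕ) : ℝ) + 1 ≤ 2 * (D * Δ) := by
    rw [hceil]
    have := Nat.ceil_lt_add_one (by linarith : 0 ≤ D * Δ)
    linarith
  obtain ⟨B, H, hB, hI, hBH⟩ := hP.exists_indSub hD0 ho3 (fun v hv => (hV1m v hv).2) hW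
    (Q := ((3 * q : ℕ) : ℝ)) (fun v _ p hp => by exact_mod_cast (hPm v p hp).2.1.le) hq1 hη0 hη1
    hθ0 hV1c hPv hΔ hθΔ hQΔ hm1 hm2
  have : Nonempty B := hB.to_subtype
  refine hI.hasInduced (hbs B H ?_)
  have h1 := mul_le_mul_of_nonneg_right hfin (Nat.cast_nonneg (α := ℝ) #B)
  have h2 : 13 * 10 ^ 9 * (4 * (h : ℝ) ^ 30100 * #B) ≤ 13 * 10 ^ 9 * (e2 H univ : ℝ) := by
    linarith
  have h3 := le_of_mul_le_mul_left h2 (by norm_num)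
  rw [Fintype.card_coe]
  exact_mod_cast h3

lemma card_adj_swap {V : Type*} (G : SimpleGraph V) (X Y : Finset V) :
    #{z ∈ X ×ˢ Y | G.Adj z.1 z.2} = #{z ∈ Y ×ˢ X | G.Adj z.1 z.2} := by
  refine card_bij (fun p _ => p.swap) ?_ ?_ ?_
  · rintro ⟨a, b⟩ h
    rw [mem_filter, mem_product] at h ⊢
    exact ⟨⟨h.1.2, h.1.1⟩, h.2.symm⟩
  · rintro _ _ _ _ h
    exact Prod.swap_injective h
  · rintro ⟨a, b⟩ h
    rw [mem_filter, mem_product] at h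
    refine ⟨(b, a), ?_, rfl⟩
    rw [mem_filter, mem_product]
    exact ⟨⟨h.1.2, h.1.1⟩, h.2.symm⟩

lemma sparse_of_le {V : Type*} {G : SimpleGraph V} {k s t q : ℕ} {θ : ℝ} (hs : 1 ≤ s)
    (hcl : ¬ HasClique G k) (hK : NoBip G s t) (hq : 1 ≤ q) (hqk : k ^ (2 * t) ≤ q) (hθ0 : 0 ≤ θ)
    (hθ : (k : ℝ) ^ s + 1 ≤ q * θ ^ (2 * s)) (X Y : Finset V) (hX : q ≤ #X) (hY : q ≤ #Y) :
    (#{z ∈ X ×ˢ Y | G.Adj z.1 z.2} : ℝ) ≤ θ * #X * #Y := by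
  wlog hXY : #X ≤ #Y generalizing X Y
  · rw [card_adj_swap, mul_right_comm]
    exact this Y X hY hX (by omega)
  have h1 := sparse_pair hs hcl hK hXY (hqk.trans hY)
  have h1' : (#X : ℝ) * (#{z ∈ X ×ˢ Y | G.Adj z.1 z.2} : ℝ) ^ (2 * s) ≤
      ((k : ℝ) ^ s + 1) * ((#X : ℝ) * #Y) ^ (2 * s) := by exact_mod_cast h1
  have hX0 : (0 : ℝ) < #X := by exact_mod_cast (by omega : 0 < #X)
  have hXq : (q : ℝ) ≤ #X := by exact_mod_cast hX
  have hXY0 : (0 : ℝ) ≤ (#X : ℝ) * #Y := mul_nonneg hX0.le (Nat.cast_nonneg _)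
  have h2 : (k : ℝ) ^ s + 1 ≤ #X * θ ^ (2 * s) :=
    hθ.trans (mul_le_mul_of_nonneg_right hXq (pow_nonneg hθ0 _))
  have h3 := mul_le_mul_of_nonneg_right h2 (pow_nonneg hXY0 (2 * s))
  have h4 : (#X : ℝ) * (#{z ∈ X ×ˢ Y | G.Adj z.1 z.2} : ℝ) ^ (2 * s) ≤
      #X * (θ * (#X * #Y)) ^ (2 * s) := by
    rw [mul_pow θ, ← mul_assoc]
    exact h1'.trans h3
  have h5 := le_of_mul_le_mul_left h4 hX0
  rw [mul_assoc]
  exact (pow_le_pow_iff_left₀ (Nat.cast_nonneg _) (mul_nonneg hθ0 hXY0) (by omega)).1 h5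

end
section
open scoped Classical

/-- A power of `x` with a small constant factor is bounded by a larger power of `x`. -/
lemma const_mul_pow_le {x c : ℝ} (hx : 2 ≤ x) {a b n : ℕ} (hc : c ≤ 2 ^ n) (h : n + a ≤ b) :
    c * x ^ a ≤ x ^ b := by
  have hx0 : (0 : ℝ) ≤ x := by linarith
  calc c * x ^ a ≤ x ^ n * x ^ a :=
        mul_le_mul_of_nonneg_right (hc.trans (pow_le_pow_left₀ (by norm_num) hx n))
          (pow_nonneg hx0 _)
    _ = x ^ (n + a) := (pow_add _ _ _).symm
    _ ≤ x ^ b := pow_le_pow_right₀ (by linarith) h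

theorem hasInduced_of_densest_of_pow {V : Type} [Fintype V] [Nonempty V] {G : SimpleGraph V}
    {k s t h : ℕ} {x : ℝ} (hs : 1 ≤ s) (hst : s ≤ t) (hk : 1 ≤ k) (hcl : ¬ HasClique G k)
    (hK : NoBip G s t) (hx : 2 ≤ x) (hxh : x ≤ h) (hhx : (h : ℝ) ≤ x ^ 2)
    (hkx : (k : ℝ) ^ (4000 * t) ≤ x ^ (1000000000 * s))
    (hbs : ∀ (W : Type) [Fintype W] [Nonempty W] (H : SimpleGraph W),
      4 * h ^ 30100 * Fintype.card W ≤ e2 H univ → BS H h)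
    (hmax : ∀ T : Finset V, (e2 G T : ℝ) ≤ x ^ (1000000000 * s) * #T)
    (he : (e2 G univ : ℝ) = x ^ (1000000000 * s) * Fintype.card V) :
    HasInducedBalancedSubdivision G h := by
  have hx0 : 0 < x := by linarith
  have hx1 : 1 ≤ x := by linarith
  have hk1 : (1 : ℝ) ≤ k := by exact_mod_cast hk
  have hk0 : (0 : ℝ) ≤ k := by linarith
  have hh0 : (0 : ℝ) ≤ h := Nat.cast_nonneg _
  have hkt : (k : ℝ) ^ t ≤ x ^ (250000 * s) := by
    refine (pow_le_pow_iff_left₀ (pow_nonneg hk0 _) (pow_nonneg hx0.le _)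
      (by norm_num : 4000 ≠ 0)).1 ?_
    rw [← pow_mul, ← pow_mul, mul_comm t, mul_right_comm]
    exact hkx
  have hks : (k : ℝ) ^ s ≤ x ^ (250000 * s) := (pow_le_pow_right₀ hk1 hst).trans hkt
  obtain ⟨A, hA⟩ : ∃ A, A = 125000000 * s := ⟨_, rfl⟩
  obtain ⟨N, hN⟩ : ∃ N, N = 1000000000 * s := ⟨_, rfl⟩
  rw [← hN] at hmax he
  obtain ⟨q, hq⟩ : ∃ q, q = ⌈x ^ A⌉₊ := ⟨_, rfl⟩
  have hxA : 1 ≤ x ^ A := one_le_pow₀ hx1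
  have hq1 : x ^ A ≤ q := hq ▸ Nat.le_ceil _
  have hq2 : (q : ℝ) ≤ 2 * x ^ A := by
    have := Nat.ceil_lt_add_one (by linarith : 0 ≤ x ^ A)
    rw [← hq] at this
    linarith
  have hq0 : 1 ≤ q := by exact_mod_cast hxA.trans hq1
  have hh2 : (h : ℝ) ^ 2 ≤ x ^ 4 := by
    calc (h : ℝ) ^ 2 ≤ (x ^ 2) ^ 2 := pow_le_pow_left₀ hh0 hhx 2
      _ = x ^ 4 := by rw [← pow_mul]
  have hh4 : (h : ℝ) ^ 4 ≤ x ^ 8 := by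
    calc (h : ℝ) ^ 4 ≤ (x ^ 2) ^ 4 := pow_le_pow_left₀ hh0 hhx 4
      _ = x ^ 8 := by rw [← pow_mul]
  have hhl : (h : ℝ) ^ 30100 ≤ x ^ 60200 := by
    calc (h : ℝ) ^ 30100 ≤ (x ^ 2) ^ 30100 := pow_le_pow_left₀ hh0 hhx _
      _ = x ^ 60200 := by rw [← pow_mul]
  refine hasInduced_of_densest (q := q) (D := x ^ N) (θ := 1 / x ^ 10000000)
    (η := 1 / x ^ 100000) (Δ := x ^ 400000) ?_ hq0 hbs ?_ hmax he ?_ ?_ ?_ ?_ ?_ ?_ ?_ ?_ ?_ ?_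
    ?_ ?_ ?_
  · exact_mod_cast hx1.trans hxh
  · refine sparse_of_le hs hcl hK hq0 ?_ (by positivity) ?_
    · have h1 : ((k ^ (2 * t) : ℕ) : ℝ) ≤ q := by
        push_cast
        calc (k : ℝ) ^ (2 * t) = (k ^ t) ^ 2 := by rw [← pow_mul, mul_comm]
          _ ≤ (x ^ (250000 * s)) ^ 2 := pow_le_pow_left₀ (pow_nonneg hk0 _) hkt 2
          _ = x ^ (250000 * s * 2) := by rw [← pow_mul]
          _ ≤ x ^ A := pow_le_pow_right₀ hx1 (by omega)
          _ ≤ q := hq1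
      exact_mod_cast h1
    · rw [one_div, inv_pow, ← div_eq_mul_inv, le_div_iff₀ (by positivity), ← pow_mul]
      have h1 : (1 : ℝ) ≤ x ^ (250000 * s) := one_le_pow₀ hx1
      calc ((k : ℝ) ^ s + 1) * x ^ (10000000 * (2 * s))
          ≤ (2 * x ^ (250000 * s)) * x ^ (10000000 * (2 * s)) :=
            mul_le_mul_of_nonneg_right (by linarith) (by positivity)
        _ = 2 * x ^ (250000 * s + 10000000 * (2 * s)) := by rw [pow_add, mul_assoc]
        _ ≤ x ^ A := const_mul_pow_le hx (n := 1) (by norm_num) (by omega)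
        _ ≤ q := hq1
  · have h1 : 8 * x ^ A ≤ x ^ N := const_mul_pow_le hx (n := 3) (by norm_num) (by omega)
    linarith
  · have h1 : 36 * x ^ 4 ≤ x ^ N := const_mul_pow_le hx (n := 6) (by norm_num) (by omega)
    linarith
  · positivity
  · rw [mul_one_div, div_le_one (by positivity)]
    have h1 : 9 * x ^ 8 ≤ x ^ 10000000 := const_mul_pow_le hx (n := 4) (by norm_num) (by norm_num)
    linarith
  · rw [mul_one_div, div_le_one (by positivity)]
    have h1 : 9 * x ^ 4 ≤ x ^ 100000 := const_mul_pow_le hx (n := 4) (by norm_num) (by norm_num)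
    linarith
  · positivity
  · rw [div_le_one (by positivity)]
    exact one_le_pow₀ hx1
  · rw [mul_one_div, div_le_div_iff₀ (by positivity) (by positivity), one_mul]
    exact const_mul_pow_le hx (n := 2) (by norm_num) (by norm_num)
  · rw [one_div_mul_eq_div, le_div_iff₀ (by positivity)]
    exact const_mul_pow_le hx (n := 4) (by norm_num) (by omega)
  · have h1 : 28 * x ^ 0 ≤ x ^ 400000 := const_mul_pow_le hx (n := 5) (by norm_num) (by norm_num)
    simpa using h1
  · rw [one_div_mul_eq_div, div_le_one (by positivity)]
    exact pow_le_pow_right₀ hx1 (by norm_num)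
  · push_cast
    calc 3 * (q : ℝ) * (x ^ 400000) ^ 2 ≤ 3 * (2 * x ^ A) * (x ^ 400000) ^ 2 :=
          mul_le_mul_of_nonneg_right (by linarith) (by positivity)
      _ = 6 * x ^ (A + 400000 * 2) := by rw [pow_add, pow_mul, ← mul_assoc, ← mul_assoc]; norm_num
      _ ≤ x ^ N := const_mul_pow_le hx (n := 3) (by norm_num) (by omega)
  · rw [one_div, inv_pow, inv_mul_eq_div, le_div_iff₀ (by positivity), ← pow_mul]
    calc 13 * 10 ^ 9 * (4 * (h : ℝ) ^ 30100) * x ^ (100000 * 2)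
        ≤ 13 * 10 ^ 9 * (4 * x ^ 60200) * x ^ (100000 * 2) :=
          mul_le_mul_of_nonneg_right (by linarith) (by positivity)
      _ = 52000000000 * x ^ (60200 + 100000 * 2) := by
          rw [pow_add, ← mul_assoc, ← mul_assoc]
          norm_num
      _ ≤ x ^ 400000 := const_mul_pow_le hx (n := 36) (by norm_num) (by norm_num)

end
section
open scoped Classical

lemma NoBip.induce {V : Type*} {G : SimpleGraph V} {s t : ℕ} (h : NoBip G s t) (S : Finset V) :
    NoBip (G.induce (S : Set V)) s t := by
  intro I J hI hJ hI' hJ' hIJ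
  refine h (I.map (Function.Embedding.subtype _)) (J.map (Function.Embedding.subtype _))
    (by rw [card_map, hI]) (by rw [card_map, hJ]) ?_ ?_ ?_
  · intro u hu v hv
    obtain ⟨u, hu', rfl⟩ := mem_map.1 hu
    obtain ⟨v, hv', rfl⟩ := mem_map.1 hv
    exact hI' u hu' v hv'
  · intro u hu v hv
    obtain ⟨u, hu', rfl⟩ := mem_map.1 hu
    obtain ⟨v, hv', rfl⟩ := mem_map.1 hv
    exact hJ' u hu' v hv'
  · intro u hu v hv
    obtain ⟨u, hu', rfl⟩ := mem_map.1 hu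
    obtain ⟨v, hv', rfl⟩ := mem_map.1 hv
    exact hIJ u hu' v hv'

end
end Bal

/-- For all `2 ≤ s ≤ t` and all sufficiently large `k`, every graph with
average degree at least `k ^ (4000 t)` contains a `k`-clique, an induced proper balanced
subdivision of `K_h` with `h ≥ d(G) ^ (1/(10⁹ s))`, or an induced `K_{s,t}`. -/
theorem stmt2 :
    ∀ s t : ℕ, 2 ≤ s → s ≤ t → ∃ k₀ : ℕ, ∀ k : ℕ, k₀ ≤ k →
      ∀ (V : Type) [Fintype V] (G : SimpleGraph V),
        avgDeg G ≥ (k : ℝ) ^ (4000 * t) →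
        HasClique G k ∨
        (∃ h : ℕ, (h : ℝ) ≥ avgDeg G ^ ((1 : ℝ) / (10 ^ 9 * (s : ℝ))) ∧
            HasInducedBalancedSubdivision G h) ∨
        Nonempty (completeBipartiteGraph (Fin s) (Fin t) ↪g G) := by
  intro s t hs hst
  obtain ⟨h₀, hbs⟩ := Bal.exists_bs
  obtain ⟨c, hc⟩ : ∃ c : ℕ, c = max 2 h₀ := ⟨_, rfl⟩
  obtain ⟨N, hN⟩ : ∃ N : ℕ, N = 1000000000 * s := ⟨_, rfl⟩
  refine ⟨c ^ N, fun k hk V _ G hG => ?_⟩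
  by_cases hcl : HasClique G k
  · exact Or.inl hcl
  by_cases hK : Bal.NoBip G s t
  swap
  · exact Or.inr (Or.inr (Bal.nonempty_embedding_of_not_noBip hK))
  right
  left
  have hc2 : 2 ≤ c := by omega
  have hk1 : 1 ≤ k := le_trans (Nat.one_le_pow _ _ (by omega)) hk
  have hk1' : (1 : ℝ) ≤ k := by exact_mod_cast hk1
  have hd0 : 0 < avgDeg G := lt_of_lt_of_le (by positivity) hG
  have hV : Nonempty V := by
    by_contra hV
    rw [not_nonempty_iff] at hV
    simp [avgDeg] at hd0
  obtain ⟨S, hS, hmax⟩ := Bal.exists_densest G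
  have hSn : Nonempty S := hS.to_subtype
  obtain ⟨D, hD⟩ : ∃ D : ℝ, D = (Bal.e2 G S : ℝ) / #S := ⟨_, rfl⟩
  rw [← hD] at hmax
  have hS0 : (0 : ℝ) < #S := by exact_mod_cast hS.card_pos
  have havg : avgDeg G ≤ D := by
    have h1 := hmax univ
    rw [card_univ] at h1
    rw [avgDeg, div_le_iff₀ (by exact_mod_cast Fintype.card_pos)]
    refine le_trans (le_of_eq ?_) h1
    exact_mod_cast Bal.two_mul_ncard_edgeSet G
  have hkD : (k : ℝ) ^ (4000 * t) ≤ D := hG.trans havg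
  have hD0 : 0 ≤ D := by linarith
  have hs0 : (0 : ℝ) < s := by exact_mod_cast (by omega : 0 < s)
  obtain ⟨x, hx⟩ : ∃ x : ℝ, x = D ^ ((1 : ℝ) / (10 ^ 9 * (s : ℝ))) := ⟨_, rfl⟩
  have hx0 : 0 ≤ x := hx ▸ Real.rpow_nonneg hD0 _
  have hN0 : N ≠ 0 := by omega
  have hxD : x ^ N = D := by
    have h1 : (1 : ℝ) / (10 ^ 9 * (s : ℝ)) = ((N : ℕ) : ℝ)⁻¹ := by
      rw [hN, one_div]
      push_cast
      norm_num
    rw [hx, h1]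
    exact Real.rpow_inv_natCast_pow hD0 hN0
  have hcx : (c : ℝ) ≤ x := by
    refine (pow_le_pow_iff_left₀ (Nat.cast_nonneg _) hx0 hN0).1 ?_
    rw [hxD]
    have h1 : ((c ^ N : ℕ) : ℝ) ≤ k := by exact_mod_cast hk
    rw [Nat.cast_pow] at h1
    exact h1.trans ((le_self_pow₀ hk1' (by omega)).trans hkD)
  have hc2' : (2 : ℝ) ≤ c := by exact_mod_cast hc2
  have hx2 : 2 ≤ x := hc2'.trans hcx
  have hxh : x ≤ ⌈x⌉₊ := Nat.le_ceil x
  refine ⟨⌈x⌉₊, ?_, ?_⟩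
  · refine le_trans ?_ hxh
    rw [hx]
    exact Real.rpow_le_rpow hd0.le havg (by positivity)
  have hh0 : h₀ ≤ ⌈x⌉₊ := by
    have h1 : c ≤ ⌈x⌉₊ := by exact_mod_cast hcx.trans hxh
    omega
  have hhx : (⌈x⌉₊ : ℝ) ≤ x ^ 2 := by
    have := Nat.ceil_lt_add_one hx0
    nlinarith
  let f : G.induce (S : Set V) ↪g G := SimpleGraph.Embedding.induce (S : Set V)
  have hind : HasInducedBalancedSubdivision (G.induce (S : Set V)) ⌈x⌉₊ := by
    refine Bal.hasInduced_of_densest_of_pow (k := k) (s := s) (t := t) (by omega) hst hk1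
      (fun h => hcl (Bal.hasClique_map f h)) (hK.induce S) hx2 hxh hhx ?_ (hbs _ hh0) ?_ ?_
    · rw [← hN, hxD]
      exact hkD
    · intro T
      rw [← hN, hxD, Bal.e2_induce]
      have h1 := hmax (T.map (Function.Embedding.subtype _))
      rwa [card_map] at h1
    · rw [← hN, hxD, Bal.e2_induce, hD]
      have h1 : (univ : Finset S).map (Function.Embedding.subtype _) = S := by
        ext v
        simp
      have h2 : Fintype.card (S : Set V) = #S := by simp
      rw [h1, h2, div_mul_cancel₀ _ hS0.ne']
  obtain ⟨ℓ, hℓ, ⟨g⟩⟩ := hind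
  exact ⟨ℓ, hℓ, ⟨g.trans f⟩⟩
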